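/- Let F be a number field with odd class number h(F) and unit group E_F, and let k/F be a quadratic extension in which exactly two prime ideals 𝔭₁ and 𝔭₂ of odd norm ramify (and which is unramified at all primes above 2 and at all infinite places). Suppose 𝔭₁ and 𝔭₂ are primary, write 𝔭_j^{h(F)} = (π_j) with π_j primary, set k_j = F(√π_j) with unit group E_j, and suppose [π₁/𝔭₂] = [π₂/𝔭₁] = +1. Let h be the class number of k. If (E₁/𝔭₂) = (E₂/𝔭₁) = −1, then h ≡ 2 (mod 4) and (E_F : N_{k/F}E_k) = 2. If (E₁/𝔭₂) = (E₂/𝔭₁) = +1, then h ≡ 0 (mod 4). -/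

import Mathlib

open NumberField
open scoped Classical

/-- The quadratic residue symbol `[α/𝔭] ∈ {±1}`, determined by Euler's congruence
`[α/𝔭] ≡ α^((N𝔭 - 1)/2) (mod 𝔭)`. -/
noncomputable def quadResSym (F : Type*) [Field F] [NumberField F]
    (𝔭 : Ideal (𝓞 F)) (α : 𝓞 F) : ℤ :=
  if α ^ ((Ideal.absNorm 𝔭 - 1) / 2) - 1 ∈ 𝔭 then 1 else -1

/-- An ideal `𝔭` is primary if `[ε/𝔭] = 1` for every unit `ε`, i.e. `(E_F/𝔭) = +1`. -/
def IsPrimaryIdeal (F : Type*) [Field F] [NumberField F] (𝔭 : Ideal (𝓞 F)) : Prop :=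
  ∀ ε : (𝓞 F)ˣ, quadResSym F 𝔭 (ε : 𝓞 F) = 1

/-- An element of the ring of integers is primary if it is totally positive and
congruent to a square modulo 4. -/
def IsPrimaryElem (F : Type*) [Field F] [NumberField F] (α : 𝓞 F) : Prop :=
  (∀ φ : F →+* ℝ, 0 < φ (algebraMap (𝓞 F) F α)) ∧ ∃ ξ : 𝓞 F, (4 : 𝓞 F) ∣ α - ξ ^ 2

/-- A prime ideal `𝔭` of `F` is ramified in `K` if some prime of `K` appears at least
twice in the factorization of `𝔭 O_K`. -/
def IsRamifiedIn (F K : Type*) [Field F] [NumberField F] [Field K] [NumberField K]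
    [Algebra F K] (𝔭 : Ideal (𝓞 F)) : Prop :=
  ∃ 𝔓 : Ideal (𝓞 K), 𝔓.IsPrime ∧ 𝔓 ^ 2 ∣ Ideal.map (algebraMap (𝓞 F) (𝓞 K)) 𝔭

/-- `K/F` is unramified at all infinite places: every real embedding of `F`
extends to a real embedding of `K`. -/
def UnramifiedAtInfinitePlaces (F K : Type*) [Field F] [Field K] [Algebra F K] : Prop :=
  ∀ φ : F →+* ℝ, ∃ ψ : K →+* ℝ, ψ.comp (algebraMap F K) = φ

/-- The subgroup `N_{K/F} E_K` of norms of units, inside the unit group `E_F`. -/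
noncomputable def relUnitNormRange (F K : Type*) [Field F] [NumberField F] [Field K]
    [NumberField K] [Algebra F K] : Subgroup (𝓞 F)ˣ :=
  (Units.map (RingOfIntegers.norm F : 𝓞 K →* 𝓞 F)).range



set_option linter.unusedSectionVars false

namespace Sch
open IsDedekindDomain nonZeroDivisors

section
variable {K : Type*} [Field K] [NumberField K]

/-- primes -/
abbrev Pr (K : Type*) [Field K] [NumberField K] := HeightOneSpectrum (𝓞 K)

noncomputable def ord (v : Pr K) (x : Kˣ) : ℤ := -(WithZero.log (v.valuation K (x : K)))

lemma val_ne (v : Pr K) (x : Kˣ) : v.valuation K (x : K) ≠ 0 := by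
  simp

@[simp] lemma ord_mul (v : Pr K) (x y : Kˣ) : ord v (x * y) = ord v x + ord v y := by
  simp only [ord, Units.val_mul, map_mul]
  rw [WithZero.log_mul (val_ne v x) (val_ne v y)]; ring

@[simp] lemma ord_one (v : Pr K) : ord v 1 = 0 := by simp [ord]

@[simp] lemma ord_inv (v : Pr K) (x : Kˣ) : ord v x⁻¹ = - ord v x := by
  have := ord_mul v x x⁻¹
  rw [mul_inv_cancel, ord_one] at this; linarith

@[simp] lemma ord_div (v : Pr K) (x y : Kˣ) : ord v (x / y) = ord v x - ord v y := by
  rw [div_eq_mul_inv, ord_mul, ord_inv]; ring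

@[simp] lemma ord_pow (v : Pr K) (x : Kˣ) (n : ℕ) : ord v (x ^ n) = n * ord v x := by
  induction n with
  | zero => simp
  | succ n ih => rw [pow_succ, ord_mul, ih]; push_cast; ring

@[simp] lemma ord_zpow (v : Pr K) (x : Kˣ) (n : ℤ) : ord v (x ^ n) = n * ord v x := by
  cases n with
  | ofNat n => simp
  | negSucc n => rw [zpow_negSucc, ord_inv, ord_pow, Int.negSucc_eq]; push_cast; ring

@[simp] lemma ord_neg (v : Pr K) (x : Kˣ) : ord v (-x) = ord v x := by
  simp [ord, Valuation.map_neg]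

lemma val_eq (v : Pr K) (x : Kˣ) : v.valuation K (x : K) = WithZero.exp (-(ord v x)) := by
  simp [ord, WithZero.exp_log]

lemma val_le_one_iff (v : Pr K) (x : Kˣ) : v.valuation K (x : K) ≤ 1 ↔ 0 ≤ ord v x := by
  rw [val_eq, ← WithZero.exp_zero, WithZero.exp_le_exp]; simp

lemma val_lt_one_iff (v : Pr K) (x : Kˣ) : v.valuation K (x : K) < 1 ↔ 0 < ord v x := by
  rw [val_eq, ← WithZero.exp_zero, WithZero.exp_lt_exp]; simp

lemma val_eq_one_iff (v : Pr K) (x : Kˣ) : v.valuation K (x : K) = 1 ↔ ord v x = 0 := by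
  rw [val_eq, ← WithZero.exp_zero, WithZero.exp_inj]; simp

lemma exists_int (x : Kˣ) (h : ∀ v, 0 ≤ ord v x) : ∃ a : 𝓞 K, (a : K) = x := by
  obtain ⟨a, ha⟩ := HeightOneSpectrum.mem_integers_of_valuation_le_one K (R := 𝓞 K) (x : K)
    (fun v => (val_le_one_iff v x).2 (h v))
  exact ⟨a, ha⟩

/-- unit of K from nonzero integer -/
noncomputable def uI (a : 𝓞 K) (ha : a ≠ 0) : Kˣ := Units.mk0 (a : K) (by simpa using ha)

@[simp] lemma uI_val (a : 𝓞 K) (ha : a ≠ 0) : ((uI a ha : Kˣ) : K) = a := rfl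

lemma ord_int_nonneg (v : Pr K) (x : Kˣ) (a : 𝓞 K) (h : (a : K) = x) : 0 ≤ ord v x := by
  rw [← val_le_one_iff, ← h]; exact HeightOneSpectrum.valuation_le_one v a

lemma ord_int_pos_iff (v : Pr K) (x : Kˣ) (a : 𝓞 K) (h : (a : K) = x) :
    0 < ord v x ↔ a ∈ v.asIdeal := by
  rw [← val_lt_one_iff, ← h]; exact HeightOneSpectrum.valuation_lt_one_iff_mem v a

lemma exists_unit (x : Kˣ) (h : ∀ v, ord v x = 0) : ∃ e : (𝓞 K)ˣ, ((e : 𝓞 K) : K) = x := by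
  obtain ⟨a, ha⟩ := exists_int x (fun v => (h v).ge)
  obtain ⟨b, hb⟩ := exists_int x⁻¹ (fun v => by simp [h v])
  have : a * b = 1 := by
    apply RingOfIntegers.coe_injective
    rw [map_mul]
    simp [ha, hb]
  exact ⟨⟨a, b, this, by rw [mul_comm]; exact this⟩, ha⟩

lemma ord_unit (e : (𝓞 K)ˣ) (x : Kˣ) (h : ((e : 𝓞 K) : K) = x) (v : Pr K) : ord v x = 0 := by
  have h1 := ord_int_nonneg v x _ h
  have h2 := ord_int_nonneg v x⁻¹ ((e⁻¹ : (𝓞 K)ˣ) : 𝓞 K) (by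
    rw [Units.val_inv_eq_inv_val, ← h]
    refine eq_inv_of_mul_eq_one_left ?_
    rw [← map_mul]; simp)
  rw [ord_inv] at h2; linarith

lemma ord_eq_count (v : Pr K) (x : Kˣ) :
    FractionalIdeal.count K v (FractionalIdeal.spanSingleton (𝓞 K)⁰ (x : K)) = ord v x := by
  have key : ∀ (a : 𝓞 K) (ha : a ≠ 0),
      FractionalIdeal.count K v (FractionalIdeal.spanSingleton (𝓞 K)⁰ (a : K)) = ord v (uI a ha) := by
    intro a ha
    have h1 : FractionalIdeal.spanSingleton (𝓞 K)⁰ (a : K) = ((Ideal.span {a} : Ideal (𝓞 K)) : FractionalIdeal (𝓞 K)⁰ K) := by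
      rw [FractionalIdeal.coeIdeal_span_singleton]
    rw [h1, FractionalIdeal.count_coe K v (by simpa using ha)]
    simp only [ord, uI_val]
    erw [HeightOneSpectrum.valuation_of_algebraMap]
    rw [HeightOneSpectrum.intValuation_if_neg _ ha]
    simp
  obtain ⟨a, b, hb, hab⟩ := IsFractionRing.div_surjective (A := 𝓞 K) (x : K)
  have hb0 : b ≠ 0 := nonZeroDivisors.ne_zero hb
  have ha0 : a ≠ 0 := by
    rintro rfl
    simp at hab
    exact x.ne_zero hab.symm
  have hx : x * uI b hb0 = uI a ha0 := by
    ext; simp only [Units.val_mul, uI_val]; rw [← hab]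
    have : (b : K) ≠ 0 := by simpa using hb0
    field_simp
  have h2 : FractionalIdeal.spanSingleton (𝓞 K)⁰ (x : K) * FractionalIdeal.spanSingleton (𝓞 K)⁰ (b : K)
      = FractionalIdeal.spanSingleton (𝓞 K)⁰ (a : K) := by
    rw [FractionalIdeal.spanSingleton_mul_spanSingleton, ← uI_val a ha0, ← hx]; rfl
  have h3 := congrArg (FractionalIdeal.count K v) h2
  rw [FractionalIdeal.count_mul K v (FractionalIdeal.spanSingleton_ne_zero_iff.2 x.ne_zero) (FractionalIdeal.spanSingleton_ne_zero_iff.2 (by simpa using hb0)), key _ hb0, key _ ha0, ← hx, ord_mul] at h3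
  linarith

lemma ord_finite (x : Kˣ) : {v : Pr K | ord v x ≠ 0}.Finite := by
  have := FractionalIdeal.finite_factors (K := K) (FractionalIdeal.spanSingleton (𝓞 K)⁰ (x : K))
  refine (Filter.eventually_cofinite.1 this).subset ?_
  intro v hv
  simpa [ord_eq_count] using hv

/-- class of a divisor -/
lemma exists_cl (K : Type*) [Field K] [NumberField K] :
    ∃ cl : (Pr K →₀ ℤ) →+ Additive (ClassGroup (𝓞 K)), Function.Surjective cl ∧
    ∀ f, cl f = 0 ↔ ∃ x : Kˣ, ∀ v, ord v x = f v := by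
  let I : Pr K → (FractionalIdeal (𝓞 K)⁰ K)ˣ := fun v =>
    Units.mk0 (v.asIdeal : FractionalIdeal (𝓞 K)⁰ K) (FractionalIdeal.coeIdeal_ne_zero.2 v.ne_bot)
  let D : (Pr K →₀ ℤ) →+ Additive (FractionalIdeal (𝓞 K)⁰ K)ˣ :=
    Finsupp.liftAddHom (fun v => (zmultiplesHom _ (Additive.ofMul (I v))))
  have hD : ∀ f, ((Additive.toMul (D f) : (FractionalIdeal (𝓞 K)⁰ K)ˣ) : FractionalIdeal (𝓞 K)⁰ K) =
      f.prod (fun v n => (v.asIdeal : FractionalIdeal (𝓞 K)⁰ K) ^ n) := by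
    intro f
    simp only [D, Finsupp.liftAddHom_apply, Finsupp.sum, toMul_sum, Finsupp.prod, Units.coe_prod]
    refine Finset.prod_congr rfl fun v _ => ?_
    simp [I]
  have hcount : ∀ f v, FractionalIdeal.count K v ((Additive.toMul (D f) : (FractionalIdeal (𝓞 K)⁰ K)ˣ) : FractionalIdeal (𝓞 K)⁰ K) = f v := by
    intro f v
    rw [hD]; exact FractionalIdeal.count_finsuppProd K v f
  have hext : ∀ J J' : (FractionalIdeal (𝓞 K)⁰ K)ˣ, (∀ v, FractionalIdeal.count K v (J : FractionalIdeal (𝓞 K)⁰ K) = FractionalIdeal.count K v (J' : FractionalIdeal (𝓞 K)⁰ K)) → J = J' := by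
    intro J J' h
    ext1
    rw [← FractionalIdeal.finprod_heightOneSpectrum_factorization' K J.ne_zero,
      ← FractionalIdeal.finprod_heightOneSpectrum_factorization' K J'.ne_zero]
    exact finprod_congr fun v => by rw [h v]
  let c : (FractionalIdeal (𝓞 K)⁰ K)ˣ →* ClassGroup (𝓞 K) :=
    ClassGroup.mk K
  have hcs : Function.Surjective c := by
    intro y
    refine ClassGroup.induction K (P := fun y => ∃ a, c a = y) (fun I => ⟨I, rfl⟩) y
  refine ⟨c.toAdditive.comp D, ?_, ?_⟩
  · have : Function.Surjective D := by
      intro J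
      let g : Pr K →₀ ℤ := Finsupp.ofSupportFinite
        (fun v => FractionalIdeal.count K v ((Additive.toMul J : (FractionalIdeal (𝓞 K)⁰ K)ˣ) : FractionalIdeal (𝓞 K)⁰ K))
        (Filter.eventually_cofinite.1 (FractionalIdeal.finite_factors (K := K) _))
      refine ⟨g, ?_⟩
      apply Additive.toMul.injective
      apply hext
      intro v
      rw [hcount]; rfl
    rw [AddMonoidHom.coe_comp]
    exact Function.Surjective.comp (fun y => by obtain ⟨a, ha⟩ := hcs (Additive.toMul y); exact ⟨Additive.ofMul a, ha⟩) this
  · intro f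
    have : (c.toAdditive.comp D) f = 0 ↔ ClassGroup.mk K (Additive.toMul (D f)) = 1 := by rfl
    rw [this]
    have h4 : ClassGroup.mk K (Additive.toMul (D f)) = 1 ↔ ∃ x, toPrincipalIdeal (𝓞 K) K x = Additive.toMul (D f) := by
      rw [← (ClassGroup.equiv K).map_eq_one_iff, ClassGroup.equiv_mk K, QuotientGroup.mk'_apply,
        QuotientGroup.eq_one_iff]
      simp
    rw [h4]
    constructor
    · rintro ⟨x, hx⟩
      refine ⟨x, fun v => ?_⟩
      rw [← hcount f v, ← hx, coe_toPrincipalIdeal, ord_eq_count]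
    · rintro ⟨x, hx⟩
      refine ⟨x, ?_⟩
      apply hext
      intro v
      rw [hcount f v, coe_toPrincipalIdeal, ord_eq_count, hx]

lemma card_cl (K : Type*) [Field K] [NumberField K] : Nat.card (Additive (ClassGroup (𝓞 K))) = classNumber K := by
  rw [classNumber, ← Nat.card_eq_fintype_card]; rfl

end
end Sch


set_option linter.all false

namespace Sch
open IsDedekindDomain nonZeroDivisors

section
variable {K : Type*} [Field K] [NumberField K]

/-- S-units -/
def AS (S : Set (Pr K)) : Subgroup Kˣ where
  carrier := {x | ∀ v, v ∉ S → ord v x = 0}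
  mul_mem' := by intro a b ha hb v hv; simp [ha v hv, hb v hv]
  one_mem' := by intro v _; simp
  inv_mem' := by intro a ha v hv; simp [ha v hv]

lemma mem_AS {S : Set (Pr K)} {x : Kˣ} : x ∈ AS S ↔ ∀ v, v ∉ S → ord v x = 0 := Iff.rfl

lemma mem_AS_empty {x : Kˣ} : x ∈ AS (∅ : Set (Pr K)) ↔ ∀ v, ord v x = 0 := by
  simp [mem_AS]

/-- all orders are even -/
def Vev (x : Kˣ) : Prop := ∀ v, Even (ord v x)

/-- units times squares -/
def E2 (K : Type*) [Field K] [NumberField K] : Subgroup Kˣ :=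
  AS (∅ : Set (Pr K)) ⊔ (powMonoidHom 2 : Kˣ →* Kˣ).range

lemma mem_E2 {x : Kˣ} : x ∈ E2 K ↔ ∃ e ∈ AS (∅ : Set (Pr K)), ∃ y : Kˣ, x = e * y ^ 2 := by
  rw [E2, Subgroup.mem_sup]
  constructor
  · rintro ⟨e, he, z, ⟨y, rfl⟩, rfl⟩; exact ⟨e, he, y, rfl⟩
  · rintro ⟨e, he, y, rfl⟩; exact ⟨e, he, _, ⟨y, rfl⟩, rfl⟩

lemma sq_mem_E2 (y : Kˣ) : y ^ 2 ∈ E2 K := mem_E2.2 ⟨1, one_mem _, y, by simp⟩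

lemma unit_mem_E2 {e : Kˣ} (h : e ∈ AS (∅ : Set (Pr K))) : e ∈ E2 K := mem_E2.2 ⟨e, h, 1, by simp⟩

lemma E2_of_odd_pow {x : Kˣ} {g : ℕ} (hg : Odd g) (h : x ^ g ∈ E2 K) : x ∈ E2 K := by
  obtain ⟨m, rfl⟩ := hg
  have h2 := (E2 K).mul_mem h ((E2 K).inv_mem (sq_mem_E2 (x ^ m)))
  have : x ^ (2 * m + 1) * ((x ^ m) ^ 2)⁻¹ = x := by
    rw [← pow_mul, mul_comm m 2, pow_succ, mul_comm, inv_mul_cancel_left]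
  rwa [this] at h2

lemma E2_V {x : Kˣ} (h : x ∈ E2 K) : Vev x := by
  obtain ⟨e, he, y, rfl⟩ := mem_E2.1 h
  intro v
  simp [mem_AS_empty.1 he v]

lemma div_lemma (f : Pr K →₀ ℤ) : ∃ x : Kˣ, ∀ v, ord v x = classNumber K * f v := by
  obtain ⟨cl, -, hcl⟩ := exists_cl K
  have : cl ((classNumber K) • f) = 0 := by
    rw [map_nsmul, ← card_cl, card_nsmul_eq_zero']
  obtain ⟨x, hx⟩ := (hcl _).1 this
  exact ⟨x, fun v => by simp [hx v]⟩

lemma gen_lemma (v : Pr K) : ∃ p : Kˣ, ord v p = classNumber K ∧ ∀ v', v' ≠ v → ord v' p = 0 := by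
  obtain ⟨p, hp⟩ := div_lemma (Finsupp.single v 1)
  exact ⟨p, by simp [hp v], fun v' h => by simp [hp v', Finsupp.single_apply, h.symm]⟩

lemma classNumber_pos' : 0 < classNumber K := by
  rw [← card_cl]; exact Nat.card_pos

lemma sq_lemma (ho : Odd (classNumber K)) (S : Set (Pr K)) (x : Kˣ) (h : ∀ v, v ∉ S → Even (ord v x)) :
    ∃ u ∈ AS S, ∃ b, x = u * b ^ 2 := by
  let f : Pr K →₀ ℤ := Finsupp.ofSupportFinite (fun v => if v ∈ S then 0 else ord v x / 2)
    ((ord_finite x).subset (by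
      intro v hv
      simp only [Function.mem_support] at hv
      intro h0
      apply hv
      simp [h0]))
  obtain ⟨b, hb⟩ := div_lemma f
  obtain ⟨m, hm⟩ := ho
  refine ⟨x ^ classNumber K / b ^ 2, ?_, b / x ^ m, ?_⟩
  · intro v hv
    obtain ⟨c, hc⟩ := h v hv
    have : f v = c := by
      simp only [f, Finsupp.ofSupportFinite_coe, hv, if_false, hc]; omega
    simp only [ord_div, ord_pow, hb, this, hc]; push_cast; ring
  · rw [hm]
    ext; push_cast; field_simp; ring

lemma V_E2_of_odd (ho : Odd (classNumber K)) (x : Kˣ) (h : Vev x) : x ∈ E2 K := by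
  obtain ⟨u, hu, b, hb⟩ := sq_lemma ho ∅ x (fun v _ => h v)
  exact mem_E2.2 ⟨u, hu, b, hb⟩

/-- half divisor -/
lemma half_div (x : Kˣ) (h : Vev x) : ∃ f : Pr K →₀ ℤ, ∀ v, ord v x = 2 * f v := by
  refine ⟨Finsupp.ofSupportFinite (fun v => ord v x / 2)
    ((ord_finite x).subset (by
      intro v hv
      simp only [Function.mem_support] at hv
      intro h0
      apply hv
      simp [h0])), fun v => ?_⟩
  obtain ⟨c, hc⟩ := h v
  simp only [Finsupp.ofSupportFinite_coe, hc]; omega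

lemma E2_iff_half (cl : (Pr K →₀ ℤ) →+ Additive (ClassGroup (𝓞 K)))
    (hcl : ∀ f, cl f = 0 ↔ ∃ x : Kˣ, ∀ v, ord v x = f v)
    (x : Kˣ) (f : Pr K →₀ ℤ) (h : ∀ v, ord v x = 2 * f v) : cl f = 0 ↔ x ∈ E2 K := by
  rw [hcl, mem_E2]
  constructor
  · rintro ⟨y, hy⟩
    exact ⟨x / y ^ 2, mem_AS_empty.2 (fun v => by simp [hy, h]), y, by simp⟩
  · rintro ⟨e, he, y, rfl⟩
    refine ⟨y, fun v => ?_⟩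
    have := h v
    simp [mem_AS_empty.1 he v] at this
    exact this

lemma half_exists (cl : (Pr K →₀ ℤ) →+ Additive (ClassGroup (𝓞 K)))
    (hs : Function.Surjective cl) (hcl : ∀ f, cl f = 0 ↔ ∃ x : Kˣ, ∀ v, ord v x = f v)
    (c : Additive (ClassGroup (𝓞 K))) (hc : c + c = 0) :
    ∃ f x, cl f = c ∧ (∀ v, ord v x = 2 * f v) ∧ Vev x := by
  obtain ⟨f, rfl⟩ := hs c
  rw [← map_add] at hc
  obtain ⟨x, hx⟩ := (hcl _).1 hc
  have hx' : ∀ v, ord v x = 2 * f v := fun v => by rw [hx]; simp; ring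
  exact ⟨f, x, rfl, hx', fun v => by rw [hx']; simp⟩

lemma odd_of_V (h : ∀ x : Kˣ, Vev x → x ∈ E2 K) : Odd (classNumber K) := by
  obtain ⟨cl, hs, hcl⟩ := exists_cl K
  by_contra hodd
  rw [Nat.not_odd_iff_even, even_iff_two_dvd, ← card_cl] at hodd
  haveI : Fact (Nat.Prime 2) := ⟨Nat.prime_two⟩
  obtain ⟨c, hc⟩ := exists_prime_addOrderOf_dvd_card' 2 hodd
  have h2 : c + c = 0 := by rw [← two_nsmul, ← hc]; exact addOrderOf_nsmul_eq_zero c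
  obtain ⟨f, x, hf, hx, hV⟩ := half_exists cl hs hcl c h2
  have := (E2_iff_half cl hcl x f hx).2 (h x hV)
  rw [hf] at this
  rw [this] at hc
  simp at hc

lemma unique_two {g : ℕ} (hg : Odd g) (hK : classNumber K = 2 * g) (x y : Kˣ) (hx : Vev x) (hy : Vev y)
    (hx' : x ∉ E2 K) (hy' : y ∉ E2 K) : x * y ∈ E2 K := by
  obtain ⟨cl, hs, hcl⟩ := exists_cl K
  obtain ⟨f, hf⟩ := half_div x hx
  obtain ⟨f', hf'⟩ := half_div y hy
  rw [← E2_iff_half cl hcl x f hf] at hx'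
  rw [← E2_iff_half cl hcl y f' hf'] at hy'
  rw [← E2_iff_half cl hcl (x * y) (f + f') (fun v => by simp [hf, hf']; ring), map_add]
  have h2 : cl f + cl f = 0 := by
    rw [← map_add, hcl]; exact ⟨x, fun v => by rw [hf]; simp; ring⟩
  have h2' : cl f' + cl f' = 0 := by
    rw [← map_add, hcl]; exact ⟨y, fun v => by rw [hf']; simp; ring⟩
  generalize cl f = c at *
  generalize cl f' = c' at *
  have ho : addOrderOf c = 2 := by
    haveI : Fact (Nat.Prime 2) := ⟨Nat.prime_two⟩
    exact addOrderOf_eq_prime (by rw [two_nsmul]; exact h2) hx'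
  have hcard : Nat.card (Additive (ClassGroup (𝓞 K)) ⧸ AddSubgroup.zmultiples c) = g := by
    have := AddSubgroup.card_eq_card_quotient_mul_card_addSubgroup (AddSubgroup.zmultiples c)
    rw [card_cl, hK, Nat.card_zmultiples, ho] at this
    omega
  have hz : (QuotientAddGroup.mk c' : Additive (ClassGroup (𝓞 K)) ⧸ AddSubgroup.zmultiples c) = 0 := by
    have e1 : g • (QuotientAddGroup.mk c' : Additive (ClassGroup (𝓞 K)) ⧸ AddSubgroup.zmultiples c) = 0 := by
      rw [← hcard]; exact card_nsmul_eq_zero'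
    obtain ⟨m, rfl⟩ := hg
    have e2 : (2 * m + 1) • c' = c' := by
      rw [add_nsmul, mul_comm, mul_nsmul, two_nsmul, ← nsmul_add, h2']; simp
    rw [← QuotientAddGroup.mk_nsmul, e2] at e1
    exact e1
  rw [QuotientAddGroup.eq_zero_iff, AddSubgroup.mem_zmultiples_iff] at hz
  obtain ⟨n, hn⟩ := hz
  rcases Int.even_or_odd' n with ⟨m, rfl | rfl⟩
  · exfalso; apply hy'
    rw [← hn, mul_comm, mul_zsmul]; simp [two_zsmul, h2, ← zsmul_add]
  · rw [← hn, add_zsmul, mul_comm, mul_zsmul, two_zsmul, h2, smul_zero, one_zsmul, zero_add, h2]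

lemma not_four_dvd (h : ∀ x y : Kˣ, Vev x → Vev y → x ∉ E2 K → y ∉ E2 K → x * y ∈ E2 K)
    (h2 : ∃ n : ℕ, Odd n ∧ ∀ v : Pr K, ∃ x : Kˣ, ord v x = 2 * n ∧ ∀ v', v' ≠ v → ord v' x = 0) :
    ¬ 4 ∣ classNumber K := by
  intro h4
  obtain ⟨cl, hs, hcl⟩ := exists_cl K
  obtain ⟨n, hn, hn'⟩ := h2
  have key : ∀ c : Additive (ClassGroup (𝓞 K)), (2 * n) • c = 0 := by
    have : ((2 * n) • cl) = 0 := by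
      apply Finsupp.addHom_ext
      intro v m
      obtain ⟨x, hx, hx'⟩ := hn' v
      rw [AddMonoidHom.nsmul_apply, ← map_nsmul, AddMonoidHom.zero_apply, hcl]
      refine ⟨x ^ m, fun w => ?_⟩
      by_cases hw : w = v
      · subst hw; simp [hx]; ring
      · simp [hx' w hw, Finsupp.single_apply, Ne.symm hw]
    intro c
    obtain ⟨f, rfl⟩ := hs c
    exact DFunLike.congr_fun this f
  haveI : Fact (Nat.Prime 2) := ⟨Nat.prime_two⟩
  rw [← card_cl] at h4
  have h4' : 2 ^ 2 ∣ Nat.card (ClassGroup (𝓞 K)) := h4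
  obtain ⟨H, hH⟩ := Sylow.exists_subgroup_card_pow_prime 2 h4'
  have hsq : ∀ c ∈ H, c * c = 1 := by
    intro c hc
    have e1 : c ^ 4 = 1 := by
      have : (⟨c, hc⟩ : H) ^ Nat.card H = 1 := pow_card_eq_one'
      rw [hH] at this
      simpa [Subtype.ext_iff] using this
    have e2 : c ^ (2 * n) = 1 := key (Additive.ofMul c)
    obtain ⟨m, rfl⟩ := hn
    have : c ^ (2 * (2 * m + 1)) = (c ^ 4) ^ m * (c * c) := by
      rw [← pow_two, ← pow_mul, ← pow_add]; congr 1; ring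
    rw [this, e1] at e2; simpa using e2
  have hH2 : 2 < Nat.card H := by rw [hH]; norm_num
  obtain ⟨a, ha⟩ : ∃ a : H, a ≠ 1 := by
    haveI : Nontrivial H := (Finite.one_lt_card_iff_nontrivial).1 (by omega)
    exact exists_ne 1
  obtain ⟨b, hb⟩ : ∃ b : H, b ∉ ({1, a} : Finset H) := by
    by_contra hcon
    push Not at hcon
    haveI := Fintype.ofFinite H
    have : (Finset.univ : Finset H) ⊆ {1, a} := fun b _ => hcon b
    have h5 := Finset.card_le_card this
    rw [Finset.card_univ, ← Nat.card_eq_fintype_card] at h5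
    have := Finset.card_le_two (a := (1 : H)) (b := a)
    omega
  simp only [Finset.mem_insert, Finset.mem_singleton, not_or] at hb
  obtain ⟨f, x, hf, hx, hV⟩ := half_exists cl hs hcl (Additive.ofMul (a : ClassGroup (𝓞 K))) (hsq a a.2)
  obtain ⟨f', y, hf', hy, hV'⟩ := half_exists cl hs hcl (Additive.ofMul (b : ClassGroup (𝓞 K))) (hsq b b.2)
  have := h x y hV hV' (by
      rw [← E2_iff_half cl hcl x f hx, hf]; intro h0; exact ha (Subtype.ext h0)) (by
      rw [← E2_iff_half cl hcl y f' hy, hf']; intro h0; exact hb.1 (Subtype.ext h0))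
  rw [← E2_iff_half cl hcl (x * y) (f + f') (fun v => by simp [hx, hy]; ring), map_add, hf, hf'] at this
  apply hb.2
  apply Subtype.ext
  have e3 : (a : ClassGroup (𝓞 K)) * b = 1 := this
  calc (b : ClassGroup (𝓞 K)) = (a * a) * b := by rw [hsq a a.2, one_mul]
    _ = a := by rw [mul_assoc, e3, mul_one]

end
end Sch


set_option linter.all false

namespace Sch

section
open Module

lemma sqIndex_prod (X Y : Type*) [AddCommGroup X] [AddCommGroup Y] :
    (nsmulAddMonoidHom (α := X × Y) 2).range.index =
    (nsmulAddMonoidHom (α := X) 2).range.index * (nsmulAddMonoidHom (α := Y) 2).range.index := by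
  rw [← AddSubgroup.index_prod]
  congr 1
  ext ⟨x, y⟩
  simp only [AddMonoidHom.mem_range, nsmulAddMonoidHom_apply, AddSubgroup.mem_prod, Prod.exists, Prod.smul_mk, Prod.mk.injEq]
  constructor
  · rintro ⟨a, b, h1, h2⟩; exact ⟨⟨a, h1⟩, ⟨b, h2⟩⟩
  · rintro ⟨⟨a, h1⟩, ⟨b, h2⟩⟩; exact ⟨a, b, h1, h2⟩

lemma sqIndex_aux (A : Type*) [AddCommGroup A] (n : ℕ) (T : Type) [AddCommGroup T] [Finite T]
    (f : A ≃+ (Fin n →₀ ℤ) × T) :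
    (nsmulAddMonoidHom (α := A) 2).range.index = 2 ^ finrank ℤ A * Nat.card (nsmulAddMonoidHom (α := A) 2).ker := by
  have h1 : (nsmulAddMonoidHom (α := A) 2).range.index = (nsmulAddMonoidHom (α := (Fin n →₀ ℤ) × T) 2).range.index := by
    simpa [AddEquiv.map_range_nsmulAddMonoidHom]
        using (AddSubgroup.index_map_equiv (nsmulAddMonoidHom (α := A) 2).range f).symm
  have h2 : Nat.card (nsmulAddMonoidHom (α := A) 2).ker = Nat.card (nsmulAddMonoidHom (α := T) 2).ker := by
    refine Nat.card_congr ⟨fun x => ⟨(f x.1).2, ?_⟩, fun t => ⟨f.symm (0, t.1), ?_⟩, ?_, ?_⟩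
    · have := x.2
      rw [AddMonoidHom.mem_ker, nsmulAddMonoidHom_apply] at this ⊢
      rw [← Prod.smul_snd, ← map_nsmul, this]; simp
    · have := t.2
      rw [AddMonoidHom.mem_ker, nsmulAddMonoidHom_apply] at this ⊢
      rw [← map_nsmul, Prod.smul_mk, this]; simp
    · intro x
      have := x.2
      rw [AddMonoidHom.mem_ker, nsmulAddMonoidHom_apply] at this
      have h3 : (2 : ℕ) • (f x.1).1 = 0 := by rw [← Prod.smul_fst, ← map_nsmul, this]; simp
      have h4 : (f x.1).1 = 0 := by
        ext i
        have := DFunLike.congr_fun h3 i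
        simpa using this
      apply Subtype.ext
      simp only
      rw [← h4]; simp
    · intro t; simp
  have h3 : finrank ℤ A = n := by
    rw [f.toIntLinearEquiv.finrank_eq, Module.finrank_eq_of_rank_eq (n := n)]
    rw [LinearMap.rank_eq_of_surjective (f := LinearMap.fst ℤ (Fin n →₀ ℤ) T) Prod.fst_surjective, rank_finsupp_self]
    have : Module.rank ℤ (LinearMap.ker (LinearMap.fst ℤ (Fin n →₀ ℤ) T)) = 0 := by
      rw [rank_eq_zero_iff]
      rintro ⟨⟨x, t⟩, hx⟩
      refine ⟨Nat.card T, by exact_mod_cast Nat.card_pos.ne', ?_⟩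
      have hx' : x = 0 := hx
      subst hx'
      apply Subtype.ext
      have : Nat.card T • t = 0 := card_nsmul_eq_zero'
      simp [this]
    rw [this]; simp
  rw [h1, sqIndex_prod, h2, h3, AddSubgroup.index_range_nsmul]
  congr 1
  · simp
  · have e1 := AddSubgroup.index_mul_card (nsmulAddMonoidHom (α := T) 2).range
    have e2 := AddSubgroup.index_mul_card (nsmulAddMonoidHom (α := T) 2).ker
    rw [AddSubgroup.index_ker, ← e1, mul_comm] at e2
    have : 0 < Nat.card (nsmulAddMonoidHom (α := T) 2).range := Nat.card_pos
    exact (Nat.eq_of_mul_eq_mul_right this e2).symm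

lemma sqIndex_add (A : Type*) [AddCommGroup A] [Module.Finite ℤ A] :
    (nsmulAddMonoidHom (α := A) 2).range.index = 2 ^ finrank ℤ A * Nat.card (nsmulAddMonoidHom (α := A) 2).ker := by
  haveI : AddGroup.FG A := Module.Finite.iff_addGroup_fg.mp inferInstance
  obtain ⟨n, ι, _, p, hp, e, ⟨f⟩⟩ := AddCommGroup.equiv_free_prod_directSum_zmod A
  haveI : ∀ i, NeZero (p i ^ e i) := fun i => ⟨pow_ne_zero _ (hp i).ne_zero⟩
  haveI : Finite (DirectSum ι fun i => ZMod (p i ^ e i)) := by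
    haveI : Fintype (DirectSum ι fun i => ZMod (p i ^ e i)) :=
      Fintype.ofEquiv (∀ i, ZMod (p i ^ e i)) DFinsupp.equivFunOnFintype.symm
    exact Finite.of_fintype _
  exact sqIndex_aux A n _ f

abbrev sq2 (A : Type*) [CommGroup A] : A →* A := powMonoidHom 2

noncomputable abbrev rk (A : Type*) [CommGroup A] : ℕ := finrank ℤ (Additive A)

lemma sqIndex (A : Type*) [CommGroup A] [Module.Finite ℤ (Additive A)] :
    (sq2 A).range.index = 2 ^ rk A * Nat.card (sq2 A).ker :=
  sqIndex_add (Additive A)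

lemma rk_le_of_inj {A B : Type*} [CommGroup A] [CommGroup B] [Module.Finite ℤ (Additive B)] (f : A →* B)
    (hf : Function.Injective f) : rk A ≤ rk B :=
  LinearMap.finrank_le_finrank_of_injective (f := f.toAdditive.toIntLinearMap) hf

lemma rk_ker_add {A B : Type*} [CommGroup A] [CommGroup B] [Module.Finite ℤ (Additive A)] (f : A →* B) :
    rk f.range + rk f.ker = rk A := by
  have h := Submodule.finrank_quotient_add_finrank (LinearMap.ker (f.toAdditive.toIntLinearMap))
  rw [(f.toAdditive.toIntLinearMap).quotKerEquivRange.finrank_eq] at h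
  exact h

lemma fin_of_inj {A B : Type*} [CommGroup A] [CommGroup B] [Module.Finite ℤ (Additive B)] (f : A →* B)
    (hf : Function.Injective f) : Module.Finite ℤ (Additive A) :=
  Module.Finite.of_injective (f.toAdditive.toIntLinearMap) hf

instance {A : Type*} [CommGroup A] [Module.Finite ℤ (Additive A)] (H : Subgroup A) :
    Module.Finite ℤ (Additive H) := fin_of_inj H.subtype Subtype.val_injective

lemma rk_zero_of_torsion {A : Type*} [CommGroup A] (n : ℕ) (hn : n ≠ 0) (h : ∀ a : A, a ^ n = 1) : rk A = 0 := by
  have : Module.rank ℤ (Additive A) = 0 := by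
    rw [rank_eq_zero_iff]
    intro x
    exact ⟨n, by exact_mod_cast hn, by rw [natCast_zsmul]; exact h x.toMul⟩
  simp [rk, finrank, this]

/-- ranks agree when powers are contained -/
lemma rk_eq_of_pow {A : Type*} [CommGroup A] [Module.Finite ℤ (Additive A)] (H H' : Subgroup A) (hH : H ≤ H')
    (n : ℕ) (hn : n ≠ 0) (h : ∀ a ∈ H', a ^ n ∈ H) : rk H = rk H' := by
  apply le_antisymm
  · exact rk_le_of_inj (Subgroup.inclusion hH) (Subgroup.inclusion_injective hH)
  · let g : H' →* H := ⟨⟨fun a => ⟨a.1 ^ n, h a.1 a.2⟩, by simp⟩, by intro a b; ext; simp [mul_pow]⟩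
    have h1 := rk_ker_add g
    have h2 : rk g.ker = 0 := by
      apply rk_zero_of_torsion n hn
      rintro ⟨a, ha⟩
      have : (g a : A) = 1 := by rw [MonoidHom.mem_ker.1 ha]; rfl
      ext
      exact this
    have h3 : rk g.range ≤ rk H := rk_le_of_inj g.range.subtype Subtype.val_injective
    omega

lemma herbrand_aux {A : Type*} [CommGroup A] [Module.Finite ℤ (Additive A)] (P Q : A →* A)
    (hP : ∀ a ∈ Q.ker, P a = a ^ 2) (hPQ : P.range ≤ Q.ker) :
    (P.ker ⊔ Q.ker).index * P.range.relIndex Q.ker = 2 ^ rk Q.ker * Nat.card (sq2 Q.ker).ker := by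
  rw [← sqIndex]
  have h1 : (Q.ker.map P) = Q.ker.map (sq2 A) := by
    ext x; simp only [Subgroup.mem_map]
    constructor
    · rintro ⟨a, ha, rfl⟩; exact ⟨a, ha, by simp [sq2, hP a ha]⟩
    · rintro ⟨a, ha, rfl⟩; exact ⟨a, ha, by simp [sq2, hP a ha]⟩
  have h2 : (Q.ker.map P).relIndex Q.ker = (sq2 Q.ker).range.index := by
    rw [h1, Subgroup.relIndex]; congr 1
    ext ⟨x, hx⟩
    simp [Subgroup.mem_subgroupOf, sq2, Subtype.ext_iff]
  have h3 : (Q.ker.map P).relIndex P.range = (P.ker ⊔ Q.ker).index := by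
    rw [MonoidHom.range_eq_map, Subgroup.relIndex_map_map, sup_comm]; simp
  rw [← h2, ← h3]
  apply Subgroup.relIndex_mul_relIndex _ _ _ _ hPQ
  rw [MonoidHom.range_eq_map]; exact Subgroup.map_mono le_top

/-- Herbrand quotient for an involution -/
theorem herbrand {A : Type*} [CommGroup A] [Module.Finite ℤ (Additive A)] (s : A →* A) (hs : ∀ a, s (s a) = a)
    (P Q : A →* A) (hP : ∀ a, P a = a * s a) (hQ : ∀ a, Q a = a / s a) :
    Q.range.relIndex P.ker * 2 ^ rk Q.ker = P.range.relIndex Q.ker * 2 ^ rk P.ker ∧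
    rk P.ker + rk Q.ker = rk A ∧ P.range.relIndex Q.ker ≠ 0 := by
  have kP : ∀ a, a ∈ P.ker ↔ s a = a⁻¹ := by
    intro a; rw [MonoidHom.mem_ker, hP, mul_eq_one_iff_inv_eq, eq_comm]
  have kQ : ∀ a, a ∈ Q.ker ↔ s a = a := by
    intro a; rw [MonoidHom.mem_ker, hQ, div_eq_one, eq_comm]
  have rPQ : P.range ≤ Q.ker := by
    rintro _ ⟨a, rfl⟩; rw [kQ, hP, map_mul, hs, mul_comm]
  have rQP : Q.range ≤ P.ker := by
    rintro _ ⟨a, rfl⟩; rw [kP, hQ, map_div, hs, inv_div]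
  have h1 := herbrand_aux P Q (fun a ha => by rw [hP, (kQ a).1 ha, pow_two]) rPQ
  have h2 := herbrand_aux Q P (fun a ha => by rw [hQ, (kP a).1 ha, pow_two, div_inv_eq_mul]) rQP
  have hfin : Finite (sq2 P.ker).ker ∧ Nat.card (sq2 Q.ker).ker = Nat.card (sq2 P.ker).ker := by
    have hE : Nat.card (sq2 Q.ker).ker = Nat.card (sq2 P.ker).ker := by
      refine Nat.card_congr ⟨fun x => ⟨⟨x.1.1, ?_⟩, ?_⟩, fun x => ⟨⟨x.1.1, ?_⟩, ?_⟩, fun x => rfl, fun x => rfl⟩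
      · obtain ⟨⟨x, hx⟩, h⟩ := x
        have h' : x ^ 2 = 1 := congrArg Subtype.val (MonoidHom.mem_ker.1 h)
        rw [kP, (kQ x).1 hx]; rw [pow_two] at h'; exact eq_inv_of_mul_eq_one_left h'
      · obtain ⟨⟨x, hx⟩, h⟩ := x
        have h' : x ^ 2 = 1 := congrArg Subtype.val (MonoidHom.mem_ker.1 h)
        exact Subtype.ext h'
      · obtain ⟨⟨x, hx⟩, h⟩ := x
        have h' : x ^ 2 = 1 := congrArg Subtype.val (MonoidHom.mem_ker.1 h)
        rw [kQ, (kP x).1 hx]; rw [pow_two] at h'; exact (eq_inv_of_mul_eq_one_left h').symm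
      · obtain ⟨⟨x, hx⟩, h⟩ := x
        have h' : x ^ 2 = 1 := congrArg Subtype.val (MonoidHom.mem_ker.1 h)
        exact Subtype.ext h'
    refine ⟨?_, hE⟩
    have : Module.Finite ℤ (Additive (sq2 P.ker).ker) := inferInstance
    haveI : AddGroup.FG (Additive (sq2 P.ker).ker) := Module.Finite.iff_addGroup_fg.mp inferInstance
    have ht : AddMonoid.IsTorsion (Additive (sq2 P.ker).ker) := by
      intro x
      rw [isOfFinAddOrder_iff_nsmul_eq_zero]
      exact ⟨2, by norm_num, Subtype.ext (MonoidHom.mem_ker.1 x.toMul.2)⟩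
    exact AddCommGroup.finite_of_fg_torsion (Additive (sq2 P.ker).ker) ht
  obtain ⟨hf, hE⟩ := hfin
  have hpos : 0 < Nat.card (sq2 P.ker).ker := Nat.card_pos
  rw [hE] at h1
  rw [sup_comm] at h2
  generalize (P.ker ⊔ Q.ker).index = n at *
  have hn : 0 < n := by
    rcases Nat.eq_zero_or_pos n with rfl | h
    · rw [zero_mul] at h1
      exact absurd h1.symm (Nat.mul_pos (by positivity) hpos).ne'
    · exact h
  refine ⟨?_, ?_, ?_⟩
  · apply Nat.eq_of_mul_eq_mul_left (Nat.mul_pos hn hpos)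
    calc _ = (n * Q.range.relIndex P.ker) * (2 ^ rk Q.ker * Nat.card (sq2 P.ker).ker) := by ring
      _ = (n * P.range.relIndex Q.ker) * (2 ^ rk P.ker * Nat.card (sq2 P.ker).ker) := by rw [h1, h2]; ring
      _ = _ := by ring
  · rw [← rk_ker_add P, add_comm]; congr 1
    refine (rk_eq_of_pow _ _ rPQ 2 (by norm_num) (fun a ha => ⟨a, ?_⟩)).symm
    rw [hP, (kQ a).1 ha, pow_two]
  · intro h0
    rw [h0] at h1
    rw [mul_zero] at h1
    exact absurd h1.symm (Nat.mul_pos (by positivity) hpos).ne'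

end
end Sch


set_option linter.all false

namespace Sch
open IsDedekindDomain nonZeroDivisors

section
variable {M L : Type*} [Field M] [NumberField M] [Field L] [NumberField L] [Algebra M L]

structure Quad (M L : Type*) [Field M] [Field L] [Algebra M L] where
  s : L ≃ₐ[M] L
  ne : s ≠ 1
  deg : Module.finrank M L = 2

lemma quad_exists (M L : Type*) [Field M] [NumberField M] [Field L] [NumberField L] [Algebra M L]
    (h : Module.finrank M L = 2) : Nonempty (Quad M L) := by
  haveI : Algebra.IsQuadraticExtension M L := ⟨h⟩
  have hc : Nat.card (L ≃ₐ[M] L) = 2 := by rw [IsGalois.card_aut_eq_finrank, h]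
  haveI : Nontrivial (L ≃ₐ[M] L) := by
    rw [← Finite.one_lt_card_iff_nontrivial, hc]; norm_num
  obtain ⟨s, hs⟩ := exists_ne (1 : L ≃ₐ[M] L)
  exact ⟨⟨s, hs, h⟩⟩

namespace Quad
variable (Q : Quad M L)
include Q

lemma univ (t : L ≃ₐ[M] L) : t = 1 ∨ t = Q.s := by
  haveI : Algebra.IsQuadraticExtension M L := ⟨Q.deg⟩
  have hc : Nat.card (L ≃ₐ[M] L) = 2 := by rw [IsGalois.card_aut_eq_finrank, Q.deg]
  by_contra! h
  have h3 : ({1, Q.s, t} : Finset (L ≃ₐ[M] L)).card = 3 := by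
    rw [Finset.card_eq_three]
    exact ⟨1, Q.s, t, Q.ne.symm, h.1.symm, h.2.symm, rfl⟩
  have := Finset.card_le_univ ({1, Q.s, t} : Finset (L ≃ₐ[M] L))
  rw [h3, ← Nat.card_eq_fintype_card, hc] at this
  omega

lemma ss (x : L) : Q.s (Q.s x) = x := by
  have h : Q.s * Q.s = 1 := by
    rcases Q.univ (Q.s * Q.s) with h | h
    · exact h
    · exact absurd (mul_eq_left.1 h) Q.ne
  exact DFunLike.congr_fun h x

@[simp] lemma s_map (x : M) : Q.s (algebraMap M L x) = algebraMap M L x := Q.s.commutes x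

lemma fix (x : L) (h : Q.s x = x) : ∃ y : M, algebraMap M L y = x := by
  haveI : Algebra.IsQuadraticExtension M L := ⟨Q.deg⟩
  have := (IsGalois.mem_range_algebraMap_iff_fixed (F := M) x).2 (fun t => by
    rcases Q.univ t with rfl | rfl
    · rfl
    · exact h)
  exact this

lemma norm_eq (x : L) : algebraMap M L (Algebra.norm M x) = x * Q.s x := by
  haveI : Algebra.IsQuadraticExtension M L := ⟨Q.deg⟩
  rw [Algebra.norm_eq_prod_automorphisms]
  have : (Finset.univ : Finset (L ≃ₐ[M] L)) = {1, Q.s} := by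
    ext t; simp [Q.univ t]
  rw [this, Finset.prod_pair Q.ne.symm]; rfl

omit Q in
/-- inclusion on units -/
abbrev i (M L : Type*) [Field M] [Field L] [Algebra M L] : Mˣ →* Lˣ := Units.map (algebraMap M L : M →* L)
omit Q in
noncomputable abbrev N (M L : Type*) [Field M] [Field L] [Algebra M L] : Lˣ →* Mˣ := Units.map (Algebra.norm M : L →* M)
abbrev S : Lˣ →* Lˣ := Units.map (Q.s : L →* L)

lemma S_val (x : Lˣ) : ((Q.S x : Lˣ) : L) = Q.s x := rfl

@[simp] lemma SS (x : Lˣ) : Q.S (Q.S x) = x := by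
  ext; simp [Q.ss]

@[simp] lemma S_i (x : Mˣ) : Q.S (i M L x) = i M L x := by
  ext; simp

omit Q in
lemma i_inj : Function.Injective (i M L) := by
  intro x y h
  ext
  have := congrArg Units.val h
  simpa using this

lemma i_N (x : Lˣ) : i M L (N M L x) = x * Q.S x := by
  ext; exact Q.norm_eq x

lemma N_i (x : Mˣ) : N M L (i M L x) = x ^ 2 := by
  apply i_inj (L := L)
  rw [Q.i_N, S_i, map_pow, pow_two]

lemma N_S (x : Lˣ) : N M L (Q.S x) = N M L x := by
  apply i_inj (L := L)
  rw [Q.i_N, Q.i_N, SS, mul_comm]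

lemma fixU (x : Lˣ) (h : Q.S x = x) : ∃ y : Mˣ, i M L y = x := by
  obtain ⟨y, hy⟩ := Q.fix x (congrArg Units.val h)
  have : y ≠ 0 := by rintro rfl; simp at hy; exact x.ne_zero hy.symm
  exact ⟨Units.mk0 y this, by ext; simpa using hy⟩

lemma h90 (x : Lˣ) (h : x * Q.S x = 1) : ∃ b : Lˣ, x = b / Q.S b := by
  obtain ⟨t, ht⟩ : ∃ t : L, t + x * Q.s t ≠ 0 := by
    by_contra! hh
    have h1 := hh 1
    rw [map_one, mul_one] at h1
    have hx : (x : L) = -1 := by linear_combination h1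
    apply Q.ne
    ext t
    have := hh t
    rw [hx] at this
    change Q.s t = t
    linear_combination -this
  have hx : (x : L) * Q.s x = 1 := by
    have := congrArg Units.val h
    simpa using this
  refine ⟨Units.mk0 _ ht, ?_⟩
  rw [eq_div_iff_mul_eq']
  ext
  simp only [Units.val_mul, S_val, Units.val_mk0, map_add, map_mul, Q.ss]
  linear_combination t * hx

lemma s_sqrt (b : L) (x : M) (hb : b ^ 2 = algebraMap M L x) (hx : ¬ IsSquare x) : Q.s b = -b := by
  have h1 : Q.s b ^ 2 = b ^ 2 := by rw [← map_pow, hb, s_map]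
  rcases sq_eq_sq_iff_eq_or_eq_neg.1 h1 with h | h
  · obtain ⟨y, rfl⟩ := Q.fix b h
    exfalso; apply hx
    refine ⟨y, (algebraMap M L).injective ?_⟩
    rw [← hb, map_mul, pow_two]
  · exact h

lemma exists_anti : ∃ d : Lˣ, Q.S d = -d := by
  obtain ⟨t, ht⟩ : ∃ t, Q.s t ≠ t := by
    by_contra! h
    exact Q.ne (by ext t; exact h t)
  refine ⟨Units.mk0 (t - Q.s t) (sub_ne_zero.2 ht.symm), ?_⟩
  ext; simp [Q.ss]

lemma anti_sq (d : Lˣ) (hd : Q.S d = -d) : ∃ x : Mˣ, i M L x = d ^ 2 ∧ ¬ IsSquare x := by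
  obtain ⟨x, hx⟩ := Q.fixU (d ^ 2) (by rw [map_pow, hd]; ext; simp)
  refine ⟨x, hx, ?_⟩
  rintro ⟨y, rfl⟩
  have h1 : (d : L) ^ 2 = (algebraMap M L y) ^ 2 := by
    have := congrArg Units.val hx
    rw [pow_two (algebraMap M L y)]
    simpa using this.symm
  have h2 : Q.s d = -d := congrArg Units.val hd
  rcases sq_eq_sq_iff_eq_or_eq_neg.1 h1 with h | h
  · rw [h] at h2; simp at h2
    rw [self_eq_neg] at h2; simp at h2
  · rw [h] at h2; simp at h2
    rw [neg_eq_self] at h2; simp at h2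

/-- decomposition -/
lemma decomp (t : L) (ht : ∀ y : M, algebraMap M L y ≠ t) (y : L) :
    ∃ a b : M, y = algebraMap M L a + algebraMap M L b * t := by
  have hts : t - Q.s t ≠ 0 := by
    intro h
    obtain ⟨y, hy⟩ := Q.fix t (sub_eq_zero.1 h).symm
    exact ht y hy
  obtain ⟨b, hb⟩ := Q.fix ((y - Q.s y) / (t - Q.s t)) (by
    rw [map_div₀, map_sub, map_sub, Q.ss, Q.ss, ← neg_sub, ← neg_sub t, neg_div_neg_eq])
  have hb' : algebraMap M L b * (t - Q.s t) = y - Q.s y := by rw [hb]; field_simp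
  obtain ⟨a, ha⟩ := Q.fix (y - algebraMap M L b * t) (by
    rw [map_sub, map_mul, s_map]; linear_combination hb')
  exact ⟨a, b, by rw [ha]; ring⟩

end Quad

/-! primes -/

noncomputable abbrev un (M : Type*) [Field M] [NumberField M] [Algebra M L] (w : Pr L) : Pr M := w.under (𝓞 M)

noncomputable def ee (M : Type*) [Field M] [NumberField M] [Algebra M L] (w : Pr L) : ℕ :=
  (un M w).asIdeal.ramificationIdx' w.asIdeal

lemma un_lo (w : Pr L) : w.asIdeal.LiesOver (un M w).asIdeal := ⟨rfl⟩

lemma val_map (w : Pr L) (x : M) : w.valuation L (algebraMap M L x) = (un M w).valuation M x ^ ee M w := by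
  haveI := un_lo (M := M) w
  rw [← HeightOneSpectrum.valuation_liesOver L (un M w) w x]; rfl

lemma ord_map (w : Pr L) (x : Mˣ) : ord w (Quad.i M L x) = ee M w * ord (un M w) x := by
  unfold ord
  simp only [Units.coe_map, MonoidHom.coe_coe]
  rw [val_map, WithZero.log_pow]; simp

lemma ee_pos (M : Type*) [Field M] [NumberField M] [Algebra M L] (w : Pr L) : 0 < ee M w := by
  haveI := un_lo (M := M) w
  exact Nat.pos_of_ne_zero (Ideal.IsDedekindDomain.ramificationIdx'_ne_zero_of_liesOver w.asIdeal (un M w).ne_bot)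

lemma un_surj (v : Pr M) : ∃ w : Pr L, un M w = v := by
  obtain ⟨P, hP, h⟩ := v.asIdeal.exists_ideal_over_prime_of_isIntegral_of_isDomain (S := 𝓞 L) (by
    rw [(RingHom.injective_iff_ker_eq_bot _).1 (RingOfIntegers.algebraMap.injective M L)]; exact bot_le)
  refine ⟨⟨P, hP, ?_⟩, ?_⟩
  · rintro rfl
    apply v.ne_bot
    rw [← h, ← RingHom.ker_eq_comap_bot]
    exact (RingHom.injective_iff_ker_eq_bot _).1 (RingOfIntegers.algebraMap.injective M L)
  · ext1; exact h

lemma val_lt_map (w : Pr L) (x : M) : w.valuation L (algebraMap M L x) < 1 ↔ (un M w).valuation M x < 1 := by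
  rw [val_map, pow_lt_one_iff (ee_pos M w).ne']

lemma val_le_map (w : Pr L) (x : M) : w.valuation L (algebraMap M L x) ≤ 1 ↔ (un M w).valuation M x ≤ 1 := by
  rw [val_map, pow_le_one_iff (ee_pos M w).ne']

lemma exists_unif (v : Pr M) : ∃ x : Mˣ, ord v x = 1 := by
  obtain ⟨p, hp⟩ := v.valuation_exists_uniformizer M
  have : p ≠ 0 := by rintro rfl; rw [map_zero] at hp; exact WithZero.exp_ne_zero hp.symm
  refine ⟨Units.mk0 p this, ?_⟩
  simp [ord, hp]

/-- the conjugate prime -/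
noncomputable def sg (s : L ≃ₐ[M] L) (w : Pr L) : Pr L :=
  HeightOneSpectrum.comap ((RingOfIntegers.mapRingEquiv (s : L ≃+* L) : 𝓞 L ≃+* 𝓞 L) : 𝓞 L →+* 𝓞 L)
    (RingEquiv.surjective _) w

lemma mem_sg (s : L ≃ₐ[M] L) (w : Pr L) (a : 𝓞 L) :
    a ∈ (sg s w).asIdeal ↔ RingOfIntegers.mapRingEquiv (s : L ≃+* L) a ∈ w.asIdeal := Iff.rfl

lemma mem_pow_sg (s : L ≃ₐ[M] L) (w : Pr L) (a : 𝓞 L) (n : ℕ) :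
    a ∈ (sg s w).asIdeal ^ n ↔ RingOfIntegers.mapRingEquiv (s : L ≃+* L) a ∈ w.asIdeal ^ n := by
  have h : (sg s w).asIdeal = w.asIdeal.map (RingOfIntegers.mapRingEquiv (s : L ≃+* L)).symm :=
    (Ideal.map_symm (RingOfIntegers.mapRingEquiv (s : L ≃+* L))).symm
  rw [h, ← Ideal.map_pow, Ideal.map_symm]; rfl

lemma intval_sg (s : L ≃ₐ[M] L) (w : Pr L) (a : 𝓞 L) :
    (sg s w).intValuation a = w.intValuation (RingOfIntegers.mapRingEquiv (s : L ≃+* L) a) := by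
  rcases eq_or_ne a 0 with rfl | ha
  · simp
  have hb : RingOfIntegers.mapRingEquiv (s : L ≃+* L) a ≠ 0 := by simpa using ha
  have key : ∀ n : ℕ, (sg s w).intValuation a ≤ WithZero.exp (-(n:ℤ)) ↔
      w.intValuation (RingOfIntegers.mapRingEquiv (s : L ≃+* L) a) ≤ WithZero.exp (-(n:ℤ)) := by
    intro n
    rw [HeightOneSpectrum.intValuation_le_pow_iff_mem, HeightOneSpectrum.intValuation_le_pow_iff_mem, mem_pow_sg]
  rw [HeightOneSpectrum.intValuation_eq_exp_neg_multiplicity _ ha,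
    HeightOneSpectrum.intValuation_eq_exp_neg_multiplicity _ hb] at key ⊢
  exact le_antisymm ((key _).2 le_rfl) ((key _).1 le_rfl)

lemma val_sg (s : L ≃ₐ[M] L) (w : Pr L) (x : L) : (sg s w).valuation L x = w.valuation L (s x) := by
  obtain ⟨a, b, hb, rfl⟩ := IsFractionRing.div_surjective (A := 𝓞 L) x
  rw [map_div₀, map_div₀, map_div₀, HeightOneSpectrum.valuation_of_algebraMap, HeightOneSpectrum.valuation_of_algebraMap,
    intval_sg, intval_sg, ← HeightOneSpectrum.valuation_of_algebraMap (K := L), ← HeightOneSpectrum.valuation_of_algebraMap (K := L)]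
  rfl

end
end Sch


set_option linter.all false

namespace Sch
open IsDedekindDomain nonZeroDivisors

section
variable {M L : Type*} [Field M] [NumberField M] [Field L] [NumberField L] [Algebra M L]

lemma pr_eq_of_le (v w : Pr M) (h : v.asIdeal ≤ w.asIdeal) : v = w := by
  ext1
  exact (v.isPrime.isMaximal v.ne_bot).eq_of_le w.isPrime.ne_top h

lemma exists_approx (v w : Pr M) (h : v ≠ w) : ∃ x : Mˣ, ord v x = 1 ∧ ord w x = 0 := by
  obtain ⟨a, ha⟩ := v.intValuation_exists_uniformizer
  have hav : v.valuation M (a : M) = WithZero.exp (-1 : ℤ) := by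
    rw [← ha]; exact v.valuation_of_algebraMap a
  obtain ⟨b, hb, hbw⟩ : ∃ b ∈ v.asIdeal, b ∉ w.asIdeal := by
    by_contra! hh; exact h (pr_eq_of_le v w hh)
  have hb1 : v.valuation M (b : M) ≤ WithZero.exp (-1 : ℤ) := by
    have := (v.intValuation_le_pow_iff_mem b 1).2 (by simpa using hb)
    rw [← v.valuation_of_algebraMap (K := M)] at this
    simpa using this
  have key : ∃ c : 𝓞 M, v.valuation M (c : M) = WithZero.exp (-1 : ℤ) ∧ c ∉ w.asIdeal := by
    by_cases haw : a ∈ w.asIdeal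
    · refine ⟨a + b ^ 2, ?_, fun hc => hbw (w.isPrime.mem_of_pow_mem 2 ((Ideal.add_mem_iff_right _ haw).1 hc))⟩
      have : v.valuation M ((b ^ 2 : 𝓞 M) : M) < v.valuation M (a : M) := by
        rw [hav]
        push_cast
        rw [map_pow]
        calc _ ≤ WithZero.exp (-1 : ℤ) ^ 2 := pow_le_pow_left₀ zero_le hb1 2
          _ < _ := by rw [← WithZero.exp_nsmul, WithZero.exp_lt_exp]; norm_num
      rw [← hav]
      push_cast at this ⊢
      exact Valuation.map_add_eq_of_lt_left _ this
    · exact ⟨a, hav, haw⟩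
  obtain ⟨c, hc1, hc2⟩ := key
  have hc0 : c ≠ 0 := by rintro rfl; exact hc2 (zero_mem _)
  refine ⟨uI c hc0, ?_, ?_⟩
  · simp [ord, hc1]
  · have h1 := ord_int_nonneg w (uI c hc0) c rfl
    have h2 := mt (ord_int_pos_iff w (uI c hc0) c rfl).1 hc2
    omega

lemma ext_ord (v w : Pr M) (h : ∀ x, ord v x = ord w x) : v = w := by
  by_contra hne
  obtain ⟨x, h1, h2⟩ := exists_approx v w hne
  rw [h, h2] at h1; omega

namespace Quad
variable (Q : Quad M L)
include Q

lemma ord_sg (w : Pr L) (x : Lˣ) : ord (sg Q.s w) x = ord w (Q.S x) := by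
  unfold ord; rw [val_sg]; rfl

lemma sg_sg (w : Pr L) : sg Q.s (sg Q.s w) = w := by
  apply ext_ord; intro x; rw [Q.ord_sg, Q.ord_sg, SS]

lemma un_sg (w : Pr L) : un M (sg Q.s w) = un M w := by
  ext a
  change algebraMap (𝓞 M) (𝓞 L) a ∈ (sg Q.s w).asIdeal ↔ algebraMap (𝓞 M) (𝓞 L) a ∈ w.asIdeal
  rw [mem_sg]
  have : RingOfIntegers.mapRingEquiv (Q.s : L ≃+* L) (algebraMap (𝓞 M) (𝓞 L) a) = algebraMap (𝓞 M) (𝓞 L) a := by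
    ext; exact Q.s_map (a : M)
  rw [this]

lemma same_un (w w' : Pr L) (h : un M w = un M w') : w' = w ∨ w' = sg Q.s w := by
  by_contra! hh
  have hsub : ¬ ((w'.asIdeal : Set (𝓞 L)) ⊆ w.asIdeal ∪ (sg Q.s w).asIdeal) := by
    rw [Ideal.subset_union]
    rintro (h | h)
    · exact hh.1 (pr_eq_of_le _ _ h)
    · exact hh.2 (pr_eq_of_le _ _ h)
  rw [Set.not_subset] at hsub
  obtain ⟨a, ha, hb⟩ := hsub
  rw [Set.mem_union, not_or] at hb
  have ha0 : a ≠ 0 := by rintro rfl; exact hb.1 (zero_mem _)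
  have h1 : 0 < ord w' (uI a ha0) := (ord_int_pos_iff w' _ a rfl).2 ha
  have h2 : ord w (uI a ha0) = 0 :=
    le_antisymm (not_lt.1 (mt (ord_int_pos_iff w _ a rfl).1 hb.1)) (ord_int_nonneg w _ a rfl)
  have h3 : ord (sg Q.s w) (uI a ha0) = 0 :=
    le_antisymm (not_lt.1 (mt (ord_int_pos_iff (sg Q.s w) _ a rfl).1 hb.2)) (ord_int_nonneg _ _ a rfl)
  have h4 : 0 ≤ ord w' (Q.S (uI a ha0)) := by
    rw [← ord_sg]; exact ord_int_nonneg _ _ a rfl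
  have e1 := ord_map w (N M L (uI a ha0))
  have e2 := ord_map w' (N M L (uI a ha0))
  rw [Q.i_N, ord_mul, ← Q.ord_sg, h2, h3] at e1
  rw [Q.i_N, ord_mul, ← h] at e2
  have := ee_pos M w
  have : ord (un M w) (N M L (uI a ha0)) = 0 := by
    rcases mul_eq_zero.1 (show (ee M w : ℤ) * _ = 0 by rw [← e1]; rfl) with h | h
    · omega
    · exact h
  rw [this] at e2
  omega

lemma ee_split (w : Pr L) (h : sg Q.s w ≠ w) : ee M w = 1 := by
  obtain ⟨x, h1, h2⟩ := exists_approx w (sg Q.s w) h.symm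
  have e1 := ord_map w (N M L x)
  rw [Q.i_N, ord_mul, ← Q.ord_sg, h1, h2] at e1
  have := ee_pos M w
  have h3 := Int.eq_one_or_neg_one_of_mul_eq_one (u := (ee M w : ℤ)) (v := ord (un M w) (N M L x)) (by rw [← e1]; rfl)
  omega

lemma ee_le (w : Pr L) : ee M w = 1 ∨ ee M w = 2 := by
  by_cases h : sg Q.s w = w
  · obtain ⟨x, hx⟩ := exists_unif w
    have e1 := ord_map w (N M L x)
    rw [Q.i_N, ord_mul, ← Q.ord_sg, h, hx] at e1
    have h2 : (ee M w : ℤ) ∣ 2 := ⟨_, by rw [← e1]; rfl⟩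
    have h3 : ee M w ∣ 2 := by exact_mod_cast h2
    exact (Nat.dvd_prime Nat.prime_two).1 h3
  · left; exact Q.ee_split w h

lemma ram_sg (w : Pr L) (h : ee M w = 2) : sg Q.s w = w := by
  by_contra hh; have := Q.ee_split w hh; omega

lemma ee_sg (w : Pr L) : ee M (sg Q.s w) = ee M w := by
  by_cases h : sg Q.s w = w
  · rw [h]
  · rw [Q.ee_split w h, Q.ee_split (sg Q.s w) (by rw [Q.sg_sg]; exact fun h' => h h'.symm)]

lemma ee_same (w w' : Pr L) (h : un M w = un M w') : ee M w = ee M w' := by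
  rcases Q.same_un w w' h with rfl | rfl
  · rfl
  · rw [ee_sg]

/-- residue approximations at ramified primes -/
lemma ram_approx (w : Pr L) (h : ee M w = 2) (y : L) (hy : w.valuation L y ≤ 1) :
    ∃ c : M, w.valuation L (y - algebraMap M L c) < 1 ∧ (un M w).valuation M c ≤ 1 := by
  obtain ⟨t, ht⟩ := exists_unif w
  have key : ∀ (b : Mˣ), Even (ord w (i M L b)) := by
    intro b; rw [ord_map, h]; exact ⟨ord (un M w) b, by push_cast; ring⟩
  obtain ⟨a, b, hab⟩ := Q.decomp t (by
    rintro m hm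
    have hm0 : m ≠ 0 := by rintro rfl; simp at hm; exact t.ne_zero hm.symm
    have := key (Units.mk0 m hm0)
    rw [show i M L (Units.mk0 m hm0) = t by ext; simpa using hm, ht] at this
    exact absurd this (by decide)) y
  have hc : w.valuation L (y - algebraMap M L a) < 1 := by
    rw [hab, add_sub_cancel_left]
    rcases eq_or_ne b 0 with rfl | hb
    · simp
    set B := Units.mk0 b hb
    have hB : algebraMap M L b * t = ((i M L B * t : Lˣ) : L) := by simp [B]
    rw [hB, val_lt_one_iff, ord_mul, ht]
    by_contra hneg
    obtain ⟨k, hk⟩ := key B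
    have h1 : (1 : WithZero (Multiplicative ℤ)) < w.valuation L ((i M L B * t : Lˣ) : L) := by
      rw [← not_le, val_le_one_iff, ord_mul, ht]; omega
    rcases eq_or_ne a 0 with rfl | ha
    · rw [hab, map_zero, zero_add, hB] at hy; exact absurd hy (not_le.2 h1)
    · set A := Units.mk0 a ha
      have hA : algebraMap M L a = ((i M L A : Lˣ) : L) := by simp [A]
      have hne : w.valuation L (algebraMap M L a) ≠ w.valuation L (algebraMap M L b * t) := by
        rw [hA, hB, val_eq, val_eq]
        intro h
        rw [WithZero.exp_inj, ord_mul, ht] at h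
        obtain ⟨l, hl⟩ := key A
        omega
      have := Valuation.map_add_of_distinct_val _ hne
      rw [← hab] at this
      rw [this, hB] at hy
      exact absurd ((le_max_right _ _).trans hy) (not_le.2 h1)
  refine ⟨a, hc, ?_⟩
  rw [← val_le_map w]
  have : algebraMap M L a = y - (y - algebraMap M L a) := by ring
  rw [this]
  exact (Valuation.map_sub _ _ _).trans (max_le hy hc.le)

lemma ram_conj (w : Pr L) (h : ee M w = 2) (y : L) (hy : w.valuation L y ≤ 1) :
    w.valuation L (Q.s y - y) < 1 := by
  obtain ⟨c, hc, _⟩ := Q.ram_approx w h y hy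
  have h1 : w.valuation L (Q.s y - algebraMap M L c) < 1 := by
    rw [← Q.ram_sg w h, val_sg] at hc
    simpa using hc
  have : Q.s y - y = (Q.s y - algebraMap M L c) - (y - algebraMap M L c) := by ring
  rw [this]
  exact lt_of_le_of_lt (Valuation.map_sub _ _ _) (max_lt h1 hc)

end Quad

def SqMod (v : Pr M) (x : M) : Prop := ∃ c : M, v.valuation M (x - c ^ 2) < 1

/-- odd prime -/
def OddP (v : Pr M) : Prop := v.valuation M (2 : M) = 1

lemma val_two_le (v : Pr M) : v.valuation M (2 : M) ≤ 1 := by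
  have := v.valuation_le_one (K := M) 2
  exact this

lemma oddP_iff (v : Pr M) : OddP v ↔ ¬ v.valuation M (2 : M) < 1 := by
  unfold OddP; rw [not_lt]
  exact ⟨fun h => h.ge, fun h => le_antisymm (val_two_le v) h⟩

lemma oddP_map (w : Pr L) : OddP w ↔ OddP (un M w) := by
  rw [oddP_iff, oddP_iff, ← val_lt_map w, show algebraMap M L 2 = 2 from map_ofNat (algebraMap M L) 2]

lemma int_rep (v : Pr M) (x : M) (h : v.valuation M x ≤ 1) : ∃ a : 𝓞 M, v.valuation M (x - a) < 1 := by
  obtain ⟨a, ha⟩ := v.exists_valuation_sub_lt_of_integer h 1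
  exact ⟨a, by rw [Valuation.map_sub_swap]; exact ha⟩

namespace Quad
variable (Q : Quad M L)
include Q

lemma ram_norm (w : Pr L) (h : ee M w = 2) (x : Lˣ) (hx : ord w x = 0) : SqMod (un M w) (N M L x : Mˣ) := by
  have hx1 := (val_eq_one_iff w x).2 hx
  obtain ⟨c, hc, hc1⟩ := Q.ram_approx w h x hx1.le
  refine ⟨c, ?_⟩
  rw [← val_lt_map w]
  have h1 : w.valuation L (Q.s x - algebraMap M L c) < 1 := by
    rw [← Q.ram_sg w h, val_sg] at hc
    simpa using hc
  have e : algebraMap M L (((N M L x : Mˣ) : M) - c ^ 2) = (x - algebraMap M L c) * Q.s x + algebraMap M L c * (Q.s x - algebraMap M L c) := by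
    rw [map_sub, map_pow]
    have := congrArg Units.val (Q.i_N x)
    simp only [Units.coe_map, Units.val_mul, MonoidHom.coe_coe] at this
    change algebraMap M L (Algebra.norm M (x : L)) - _ = _
    rw [Q.norm_eq]; ring
  have h2 : w.valuation L (Q.s x) ≤ 1 := by rw [← val_sg, Q.ram_sg w h]; exact hx1.le
  rw [e]
  refine lt_of_le_of_lt (Valuation.map_add _ _ _) (max_lt ?_ ?_)
  · rw [map_mul]; exact mul_lt_one_of_nonneg_of_lt_one_left zero_le hc h2
  · rw [map_mul]; exact mul_lt_one_of_nonneg_of_lt_one_right ((val_le_map w c).2 hc1) zero_le h1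

/-- Kummer: odd -/
lemma kummer_odd (b : Lˣ) (hb : Q.S b = -b) (x : Mˣ) (hx : b ^ 2 = i M L x) (w : Pr L) (ho : OddP w)
    (hev : Even (ord (un M w) x)) : ee M w = 1 := by
  rcases Q.ee_le w with h | h
  · exact h
  exfalso
  obtain ⟨k, hk⟩ : ∃ k, ord w b = 2 * k := by
    obtain ⟨k, hk⟩ := hev
    have := congrArg (ord w) hx
    rw [ord_map, ord_pow, h, hk] at this
    exact ⟨k, by push_cast at this; omega⟩
  obtain ⟨t, ht⟩ := exists_unif (un M w)
  set y : Lˣ := b * i M L (t ^ (-k)) with hy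
  have hy0 : ord w y = 0 := by
    rw [hy, ord_mul, ord_map, ord_zpow, ht, h, hk]; push_cast; ring
  have hys : Q.S y = -y := by rw [hy, map_mul, S_i, hb]; ext; simp
  have h1 := Q.ram_conj w h y ((val_eq_one_iff w y).2 hy0).le
  have h2 : Q.s y = -y := congrArg Units.val hys
  rw [h2, show -(y : L) - y = -(2 * y) by ring, Valuation.map_neg, map_mul, ho, one_mul, (val_eq_one_iff w y).2 hy0] at h1
  exact lt_irrefl _ h1

/-- Kummer: primary elements -/
lemma kummer_prim (b : Lˣ) (hb : Q.S b = -b) (x xi : M) (hx : (b : L) ^ 2 = algebraMap M L x) (w : Pr L)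
    (hxi : (un M w).valuation M ((x - xi ^ 2) / 4) ≤ 1) (hxi' : (un M w).valuation M xi ≤ 1) (h0 : ord w b = 0) : ee M w = 1 := by
  rcases Q.ee_le w with h | h
  · exact h
  exfalso
  have hs : Q.s (b : L) = -b := congrArg Units.val hb
  set X := algebraMap M L xi with hX
  have hX1 : w.valuation L X ≤ 1 := (val_le_map w xi).2 hxi'
  set y : L := (X + b) / 2 with hy
  have e : y * (y - X) = algebraMap M L ((x - xi ^ 2) / 4) := by
    rw [map_div₀, map_sub, map_pow, ← hx, hy, ← hX, map_ofNat]; ring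
  have hyi : w.valuation L y ≤ 1 := by
    by_contra! hc
    have h1 : w.valuation L (y - X) = w.valuation L y :=
      Valuation.map_sub_eq_of_lt_left _ (lt_of_le_of_lt hX1 hc)
    have h2 := (val_le_map w _).2 hxi
    rw [← e, map_mul, h1] at h2
    exact absurd h2 (not_le.2 (one_lt_mul_of_lt_of_le hc hc.le))
  have h1 := Q.ram_conj w h y hyi
  have h2 : Q.s y - y = - b := by
    rw [hy, map_div₀, map_add, hs, hX, s_map, map_ofNat]; ring
  rw [h2, Valuation.map_neg, (val_eq_one_iff w b).2 h0] at h1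
  exact lt_irrefl _ h1

lemma ram_of_odd (b : Lˣ) (x : Mˣ) (hx : b ^ 2 = i M L x) (w : Pr L) (ho : Odd (ord (un M w) x)) : ee M w = 2 := by
  have := congrArg (ord w) hx
  rw [ord_map, ord_pow] at this
  rcases Q.ee_le w with h | h
  · rw [h] at this; obtain ⟨k, hk⟩ := ho; rw [hk] at this; push_cast at this; omega
  · exact h

lemma split_of_sq (b : Lˣ) (hb : Q.S b = -b) (x : M) (hx : (b : L) ^ 2 = algebraMap M L x) (w : Pr L) (ho : OddP w)
    (h0 : ord w b = 0) (hs : SqMod (un M w) x) : sg Q.s w ≠ w := by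
  intro h
  obtain ⟨c, hc⟩ := hs
  have hb1 := (val_eq_one_iff w b).2 h0
  have hsb : Q.s (b : L) = -b := congrArg Units.val hb
  rw [← val_lt_map w, map_sub, map_pow, ← hx, sq_sub_sq, map_mul] at hc
  have key : ∀ z : L, w.valuation L (Q.s z) = w.valuation L z := by intro z; rw [← val_sg, h]
  have k1 := key (b + algebraMap M L c)
  rw [map_add, hsb, s_map, show -(b:L) + algebraMap M L c = -(b - algebraMap M L c) by ring, Valuation.map_neg] at k1
  rw [k1] at hc
  have h1 : w.valuation L (b + algebraMap M L c) < 1 := by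
    by_contra! hh
    exact absurd hc (not_lt.2 (one_le_mul hh hh))
  have h2 : w.valuation L ((b + algebraMap M L c) + (b - algebraMap M L c)) < 1 :=
    lt_of_le_of_lt (Valuation.map_add _ _ _) (max_lt h1 (k1 ▸ h1))
  rw [show (b + algebraMap M L c) + (b - algebraMap M L c) = 2 * b by ring, map_mul, ho, hb1] at h2
  simp at h2

end Quad

end
end Sch


set_option linter.all false

namespace Sch
open IsDedekindDomain nonZeroDivisors

section
variable {M L : Type*} [Field M] [NumberField M] [Field L] [NumberField L] [Algebra M L]

lemma int_unit_val (v : Pr M) (a : 𝓞 M) : v.valuation M (a : M) < 1 ↔ Ideal.Quotient.mk v.asIdeal a = 0 := by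
  rw [Ideal.Quotient.eq_zero_iff_mem]; exact v.valuation_lt_one_iff_mem a

lemma sqmod_congr {v : Pr M} {x y : M} (h : v.valuation M (x - y) < 1) (hx : SqMod v x) : SqMod v y := by
  obtain ⟨c, hc⟩ := hx
  refine ⟨c, ?_⟩
  rw [show y - c ^ 2 = (x - c ^ 2) - (x - y) by ring]
  exact lt_of_le_of_lt (Valuation.map_sub _ _ _) (max_lt hc h)

lemma sqmod_int_iff (v : Pr M) (a : 𝓞 M) : SqMod v (a : M) ↔ IsSquare (Ideal.Quotient.mk v.asIdeal a) := by
  constructor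
  · rintro ⟨c, hc⟩
    have hc1 : v.valuation M c ≤ 1 := by
      by_contra! h
      have h1 : (1 : WithZero (Multiplicative ℤ)) < v.valuation M (c ^ 2) := by
        rw [map_pow]; exact one_lt_pow₀ h two_ne_zero
      have h2 : v.valuation M (a : M) ≤ 1 := v.valuation_le_one a
      have h3 := Valuation.map_sub_eq_of_lt_right (v := v.valuation M) (x := (a : M)) (y := c ^ 2) (lt_of_le_of_lt h2 h1)
      rw [h3] at hc; exact absurd hc (not_lt.2 h1.le)
    obtain ⟨b, hb⟩ := int_rep v c hc1
    refine ⟨Ideal.Quotient.mk v.asIdeal b, ?_⟩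
    rw [← map_mul, ← sub_eq_zero, ← map_sub, ← int_unit_val]
    push_cast
    rw [show (a : M) - b * b = (a - c ^ 2) + (c - b) * (c + b) by ring]
    refine lt_of_le_of_lt (Valuation.map_add _ _ _) (max_lt hc ?_)
    rw [map_mul]
    refine mul_lt_one_of_nonneg_of_lt_one_left zero_le hb ?_
    exact (Valuation.map_add _ _ _).trans (max_le hc1 (v.valuation_le_one b))
  · rintro ⟨c, hc⟩
    obtain ⟨b, rfl⟩ := Ideal.Quotient.mk_surjective c
    refine ⟨b, ?_⟩
    rw [← map_mul, ← sub_eq_zero, ← map_sub, ← int_unit_val] at hc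
    push_cast at hc
    rwa [pow_two]

lemma fin_quot (v : Pr M) : Finite (𝓞 M ⧸ v.asIdeal) := Ideal.finiteQuotientOfFreeOfNeBot v.asIdeal v.ne_bot

lemma sqmod_mul_iff (v : Pr M) (x y : Mˣ) (hx : ord v x = 0) (hy : ord v y = 0) :
    SqMod v ((x * y : Mˣ) : M) ↔ (SqMod v (x : M) ↔ SqMod v (y : M)) := by
  have hx1 := (val_eq_one_iff v x).2 hx
  have hy1 := (val_eq_one_iff v y).2 hy
  obtain ⟨a, ha⟩ := int_rep v x hx1.le
  obtain ⟨b, hb⟩ := int_rep v y hy1.le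
  have hab : v.valuation M (((x * y : Mˣ) : M) - ((a * b : 𝓞 M) : M)) < 1 := by
    push_cast
    rw [show (x : M) * y - a * b = (x - a) * y + a * (y - b) by ring]
    refine lt_of_le_of_lt (Valuation.map_add _ _ _) (max_lt ?_ ?_)
    · rw [map_mul, hy1, mul_one]; exact ha
    · rw [map_mul]; exact mul_lt_one_of_nonneg_of_lt_one_right (v.valuation_le_one a) zero_le hb
  have cg : ∀ {x y : M}, v.valuation M (x - y) < 1 → (SqMod v x ↔ SqMod v y) := by
    intro x y h
    exact ⟨sqmod_congr h, sqmod_congr (by rwa [Valuation.map_sub_swap])⟩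
  have ne0 : ∀ (z : Mˣ) (c : 𝓞 M), v.valuation M (z : M) = 1 → v.valuation M ((z : M) - c) < 1 → Ideal.Quotient.mk v.asIdeal c ≠ 0 := by
    intro z c hz hc h0
    rw [← int_unit_val] at h0
    have : (z : M) = (z - c) + c := by ring
    rw [this] at hz
    exact absurd hz (lt_of_le_of_lt (Valuation.map_add _ _ _) (max_lt hc h0)).ne
  rw [cg hab, cg ha, cg hb, sqmod_int_iff, sqmod_int_iff, sqmod_int_iff, map_mul]
  haveI := fin_quot v
  haveI : v.asIdeal.IsMaximal := v.isPrime.isMaximal v.ne_bot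
  letI := Ideal.Quotient.field v.asIdeal
  letI := Fintype.ofFinite (𝓞 M ⧸ v.asIdeal)
  have h1 := quadraticChar_one_iff_isSquare (F := 𝓞 M ⧸ v.asIdeal) (ne0 x a hx1 ha)
  have h2 := quadraticChar_one_iff_isSquare (F := 𝓞 M ⧸ v.asIdeal) (ne0 y b hy1 hb)
  have h3 := quadraticChar_one_iff_isSquare (F := 𝓞 M ⧸ v.asIdeal) (mul_ne_zero (ne0 x a hx1 ha) (ne0 y b hy1 hb))
  rw [← h1, ← h2]
  refine h3.symm.trans ?_
  rw [map_mul]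
  rcases quadraticChar_dichotomy (ne0 x a hx1 ha) with e | e <;> rcases quadraticChar_dichotomy (ne0 y b hy1 hb) with e' | e' <;>
    rw [e, e'] <;> norm_num

lemma sqmod_sq (v : Pr M) (x : M) : SqMod v (x ^ 2) := ⟨x, by simp⟩

lemma sqmod_one (v : Pr M) : SqMod v (1 : M) := by simpa using sqmod_sq v (1 : M)

lemma sqmod_mul_sq (v : Pr M) (x y : Mˣ) (hx : ord v x = 0) (hy : ord v y = 0) :
    SqMod v ((x * y ^ 2 : Mˣ) : M) ↔ SqMod v (x : M) := by
  rw [sqmod_mul_iff v x (y ^ 2) hx (by simp [hy])]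
  have : SqMod v ((y ^ 2 : Mˣ) : M) := by push_cast; exact sqmod_sq v y
  exact ⟨fun h => h.2 this, fun h => iff_of_true h this⟩

/-- residue characters kernel -/
def SQ (v : Pr M) : Subgroup Mˣ where
  carrier := {x | ord v x = 0 ∧ SqMod v (x : M)}
  mul_mem' := by
    rintro a b ⟨ha, ha'⟩ ⟨hb, hb'⟩
    exact ⟨by simp [ha, hb], (sqmod_mul_iff v a b ha hb).2 (iff_of_true ha' hb')⟩
  one_mem' := ⟨by simp, by simpa using sqmod_one v⟩
  inv_mem' := by
    rintro a ⟨ha, ha'⟩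
    refine ⟨by simp [ha], ?_⟩
    have := sqmod_mul_iff v a⁻¹ a (by simp [ha]) ha
    rw [inv_mul_cancel] at this
    exact (this.1 (by simpa using sqmod_one v)).2 ha'

lemma mem_SQ {v : Pr M} {x : Mˣ} : x ∈ SQ v ↔ ord v x = 0 ∧ SqMod v (x : M) := Iff.rfl

lemma sqmod_map (w : Pr L) (x : M) (h : SqMod (un M w) x) : SqMod w (algebraMap M L x) := by
  obtain ⟨c, hc⟩ := h
  exact ⟨algebraMap M L c, by rw [← map_pow, ← map_sub, val_lt_map]; exact hc⟩

lemma Quad.sqmod_sg (Q : Quad M L) (w : Pr L) (x : L) : SqMod (sg Q.s w) x ↔ SqMod w (Q.s x) := by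
  constructor
  · rintro ⟨c, hc⟩; exact ⟨Q.s c, by rw [← map_pow, ← map_sub, ← val_sg]; exact hc⟩
  · rintro ⟨c, hc⟩; exact ⟨Q.s c, by rw [val_sg, map_sub, map_pow, Q.ss]; exact hc⟩

lemma quadRes_iff (v : Pr M) (hodd : Odd (Ideal.absNorm v.asIdeal)) (a : 𝓞 M) (ha : a ∉ v.asIdeal) :
    a ^ ((Ideal.absNorm v.asIdeal - 1) / 2) - 1 ∈ v.asIdeal ↔ SqMod v (a : M) := by
  haveI := fin_quot v
  haveI : v.asIdeal.IsMaximal := v.isPrime.isMaximal v.ne_bot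
  letI := Ideal.Quotient.field v.asIdeal
  letI := Fintype.ofFinite (𝓞 M ⧸ v.asIdeal)
  have hcard : Fintype.card (𝓞 M ⧸ v.asIdeal) = Ideal.absNorm v.asIdeal := by
    rw [← Nat.card_eq_fintype_card]; rfl
  have hch : ringChar (𝓞 M ⧸ v.asIdeal) ≠ 2 := by
    intro h
    have := FiniteField.even_card_iff_char_two.1 h
    rw [hcard] at this
    obtain ⟨k, hk⟩ := hodd; omega
  have h0 : Ideal.Quotient.mk v.asIdeal a ≠ 0 := by rwa [Ne, Ideal.Quotient.eq_zero_iff_mem]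
  rw [sqmod_int_iff, ← Ideal.Quotient.eq_zero_iff_mem, map_sub, map_pow, map_one, sub_eq_zero]
  have := FiniteField.isSquare_iff (F := 𝓞 M ⧸ v.asIdeal) hch h0
  rw [hcard] at this
  rw [show (Ideal.absNorm v.asIdeal - 1) / 2 = Ideal.absNorm v.asIdeal / 2 by obtain ⟨k, hk⟩ := hodd; omega]
  exact this.symm

lemma oddP_of_norm (v : Pr M) (hodd : Odd (Ideal.absNorm v.asIdeal)) : OddP v := by
  rw [oddP_iff]
  have : ((2 : 𝓞 M) : M) = 2 := rfl
  rw [← this, int_unit_val]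
  haveI := fin_quot v
  haveI : v.asIdeal.IsMaximal := v.isPrime.isMaximal v.ne_bot
  letI := Ideal.Quotient.field v.asIdeal
  letI := Fintype.ofFinite (𝓞 M ⧸ v.asIdeal)
  have hcard : Fintype.card (𝓞 M ⧸ v.asIdeal) = Ideal.absNorm v.asIdeal := by
    rw [← Nat.card_eq_fintype_card]; rfl
  intro h
  haveI : CharP (𝓞 M ⧸ v.asIdeal) 2 := CharTwo.of_one_ne_zero_of_two_eq_zero one_ne_zero (by rw [← h, map_ofNat])
  have := FiniteField.even_card_iff_char_two.1 (ringChar.eq (𝓞 M ⧸ v.asIdeal) 2)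
  rw [hcard] at this
  obtain ⟨k, hk⟩ := hodd; omega

end

/-! ranks -/
section
open Module
variable {K : Type*} [Field K] [NumberField K]

lemma rk_congr {A B : Type*} [CommGroup A] [CommGroup B] (f : A ≃* B) : rk A = rk B :=
  LinearEquiv.finrank_eq (f.toAdditive.toIntLinearEquiv)

noncomputable def unitsEquiv : (𝓞 K)ˣ ≃* AS (∅ : Set (Pr K)) :=
  MulEquiv.ofBijective (MonoidHom.codRestrict (Units.map (algebraMap (𝓞 K) K : 𝓞 K →* K)) (AS (∅ : Set (Pr K)))
    (fun e => mem_AS_empty.2 (fun v => ord_unit e _ rfl v))) (by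
    constructor
    · intro a b h
      have h1 := congrArg (fun z : AS (∅ : Set (Pr K)) => ((z : Kˣ) : K)) h
      ext; exact h1
    · rintro ⟨x, hx⟩
      obtain ⟨e, he⟩ := exists_unit x (mem_AS_empty.1 hx)
      exact ⟨e, by apply Subtype.ext; ext; exact he⟩)

lemma unitsEquiv_val (e : (𝓞 K)ˣ) : (((unitsEquiv e : AS (∅ : Set (Pr K))) : Kˣ) : K) = ((e : 𝓞 K) : K) := rfl

instance : Module.Finite ℤ (Additive (AS (∅ : Set (Pr K)))) :=
  fin_of_inj (unitsEquiv (K := K)).symm.toMonoidHom (unitsEquiv (K := K)).symm.injective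

lemma rk_units : rk (AS (∅ : Set (Pr K))) = Units.rank K := by
  rw [← rk_congr (unitsEquiv (K := K))]; exact Units.finrank_eq K

lemma fin_ext {A B : Type*} [CommGroup A] [CommGroup B] (f : A →* B) [Module.Finite ℤ (Additive B)]
    [Module.Finite ℤ (Additive f.ker)] : Module.Finite ℤ (Additive A) := by
  let g := f.toAdditive.toIntLinearMap
  haveI : Module.Finite ℤ (LinearMap.ker g) := by assumption
  haveI : Module.Finite ℤ (Additive A ⧸ LinearMap.ker g) :=
    Module.Finite.equiv g.quotKerEquivRange.symm
  exact Module.Finite.of_submodule_quotient (LinearMap.ker g)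

/-- order vector -/
noncomputable def ordV (X : Subgroup Kˣ) (T : Finset (Pr K)) : X →* Multiplicative (T → ℤ) where
  toFun x := Multiplicative.ofAdd (fun v => ord v.1 x.1)
  map_one' := by ext v; simp
  map_mul' x y := by ext v; simp

lemma rank_lemma (X : Subgroup Kˣ) (T : Finset (Pr K)) (h1 : AS ∅ ≤ X) (h2 : X ≤ AS (T : Set (Pr K)))
    (h3 : ∀ q ∈ T, ∃ x ∈ X, ord q x ≠ 0 ∧ ∀ v, v ≠ q → ord v x = 0) :
    Module.Finite ℤ (Additive X) ∧ rk X = Units.rank K + T.card := by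
  let f := ordV X T
  have hk : ∀ x, x ∈ f.ker ↔ x.1 ∈ AS (∅ : Set (Pr K)) := by
    intro x
    rw [MonoidHom.mem_ker, mem_AS_empty]
    constructor
    · intro h v
      by_cases hv : v ∈ T
      · exact congrFun (congrArg Multiplicative.toAdd h) ⟨v, hv⟩
      · exact h2 x.2 v (by simpa using hv)
    · intro h
      apply Multiplicative.toAdd.injective
      funext v; exact h v.1
  let e : f.ker ≃* AS (∅ : Set (Pr K)) :=
    ⟨⟨fun x => ⟨x.1.1, (hk _).1 x.2⟩, fun x => ⟨⟨x.1, h1 x.2⟩, (hk _).2 x.2⟩, fun x => rfl, fun x => rfl⟩, fun x y => rfl⟩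
  haveI : Module.Finite ℤ (Additive f.ker) := fin_of_inj e.toMonoidHom e.injective
  haveI : Module.Finite ℤ (Additive (Multiplicative (T → ℤ))) := (inferInstance : Module.Finite ℤ (T → ℤ))
  haveI hf : Module.Finite ℤ (Additive X) := fin_ext f
  refine ⟨hf, ?_⟩
  rw [← rk_ker_add f, rk_congr e, rk_units, add_comm]
  congr 1
  have hT : rk (Multiplicative (T → ℤ)) = T.card := by
    change finrank ℤ (T → ℤ) = _
    simp
  apply le_antisymm
  · rw [← hT]; exact rk_le_of_inj f.range.subtype Subtype.val_injective
  · rw [← hT]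
    choose! κ k1 k2 k3 using h3
    let g : Multiplicative (T → ℤ) →* X :=
      { toFun := fun z => ∏ q : T, (⟨κ q.1, k1 q.1 q.2⟩ : X) ^ (z.toAdd q)
        map_one' := by simp
        map_mul' := by intro x y; simp [zpow_add, Finset.prod_mul_distrib] }
    have hg : ∀ z (v : T), ord v.1 (g z).1 = z.toAdd v * ord v.1 (κ v.1) := by
      intro z v
      have e1 : (g z).1 = ∏ q : T, (κ q.1) ^ (z.toAdd q) := by
        change ((∏ q : T, (⟨κ q.1, k1 q.1 q.2⟩ : X) ^ (z.toAdd q) : X) : Kˣ) = _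
        rw [Subgroup.val_finset_prod]; rfl
      have e2 : ∀ (F : T → Kˣ) (s : Finset T), ord v.1 (∏ q ∈ s, F q) = ∑ q ∈ s, ord v.1 (F q) := by
        intro F s
        induction s using Finset.induction_on with
        | empty => simp
        | insert a s ha ih => rw [Finset.prod_insert ha, Finset.sum_insert ha, ord_mul, ih]
      rw [e1, e2, Finset.sum_eq_single v]
      · simp
      · intro q _ hq
        rw [ord_zpow, k3 q.1 q.2 v.1 (fun h => hq (Subtype.ext h.symm)), mul_zero]
      · simp
    refine rk_le_of_inj (f.rangeRestrict.comp g) ?_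
    rw [injective_iff_map_eq_one]
    intro z hz
    have h5 : f (g z) = 1 := congrArg Subtype.val hz
    apply Multiplicative.toAdd.injective
    funext v
    have h6 : ord v.1 (g z).1 = 0 := congrFun (congrArg Multiplicative.toAdd h5) v
    rw [hg] at h6
    exact (mul_eq_zero.1 h6).resolve_right (k2 v.1 v.2)

lemma neg_one_mem_AS : (-1 : Kˣ) ∈ AS (∅ : Set (Pr K)) := by
  rw [mem_AS_empty]; intro v; rw [ord_neg, ord_one]

lemma card_two_torsion (X : Subgroup Kˣ) (h1 : AS ∅ ≤ X) : Nat.card (sq2 X).ker = 2 := by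
  have hm : (-1 : Kˣ) ∈ X := h1 neg_one_mem_AS
  rw [Nat.card_eq_two_iff]
  refine ⟨1, ⟨⟨-1, hm⟩, by rw [MonoidHom.mem_ker]; apply Subtype.ext; simp⟩, ?_, ?_⟩
  · intro h
    have h2 : ((1 : Kˣ) : K) = ((-1 : Kˣ) : K) := congrArg (fun z : (sq2 X).ker => ((z.1.1 : Kˣ) : K)) h
    rw [Units.val_neg, Units.val_one, self_eq_neg] at h2
    exact one_ne_zero h2
  · rw [Set.eq_univ_iff_forall]
    rintro ⟨⟨x, hx⟩, h⟩
    have h' : x ^ 2 = 1 := congrArg Subtype.val (MonoidHom.mem_ker.1 h)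
    have h2 : (x : K) ^ 2 = 1 := by have := congrArg Units.val h'; simpa using this
    rcases (sq_eq_sq_iff_eq_or_eq_neg (a := (x : K)) (b := 1)).1 (by rw [h2]; simp) with h | h
    · left; apply Subtype.ext; apply Subtype.ext; ext; exact h
    · right; apply Subtype.ext; apply Subtype.ext; ext; simpa using h

lemma sqIndex_X (X : Subgroup Kˣ) (T : Finset (Pr K)) (h1 : AS ∅ ≤ X) (h2 : X ≤ AS (T : Set (Pr K)))
    (h3 : ∀ q ∈ T, ∃ x ∈ X, ord q x ≠ 0 ∧ ∀ v, v ≠ q → ord v x = 0) :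
    (sq2 X).range.index = 2 ^ (Fintype.card (InfinitePlace K) + T.card) := by
  obtain ⟨h4, h5⟩ := rank_lemma X T h1 h2 h3
  rw [sqIndex, card_two_torsion X h1, h5, ← pow_succ]
  congr 1
  have : 0 < Fintype.card (InfinitePlace K) := Fintype.card_pos
  unfold Units.rank; omega

lemma AS_rank (T : Finset (Pr K)) : Module.Finite ℤ (Additive (AS (T : Set (Pr K)))) ∧
    rk (AS (T : Set (Pr K))) = Units.rank K + T.card := by
  refine rank_lemma _ T (fun x hx v _ => mem_AS_empty.1 hx v) le_rfl ?_
  intro q hq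
  obtain ⟨p, h1, h2⟩ := gen_lemma q
  refine ⟨p, fun v hv => h2 v (by rintro rfl; exact hv hq), ?_, h2⟩
  rw [h1]; exact_mod_cast classNumber_pos'.ne'

end
end Sch


set_option linter.all false

namespace Sch
open IsDedekindDomain nonZeroDivisors

section
variable {M L : Type*} [Field M] [NumberField M] [Field L] [NumberField L] [Algebra M L]

namespace Quad
variable (Q : Quad M L)
include Q

/-- primes above -/
lemma above_fin (S : Finset (Pr M)) (hS : ∀ w : Pr L, un M w ∈ S → sg Q.s w ≠ w) :
    ∃ T : Finset (Pr L), (T : Set (Pr L)) = {w | un M w ∈ S} ∧ T.card = 2 * S.card := by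
  choose f hf using un_surj (M := M) (L := L)
  have finj : Function.Injective f := fun a b h => by rw [← hf a, ← hf b, h]
  have sinj : Function.Injective (fun v => sg Q.s (f v)) := fun a b h => by
    rw [← hf a, ← hf b, ← Q.un_sg (f a), ← Q.un_sg (f b)]; exact congrArg (un M) h
  refine ⟨S.image f ∪ S.image (fun v => sg Q.s (f v)), ?_, ?_⟩
  · ext w
    simp only [Finset.coe_union, Finset.coe_image, Set.mem_union, Set.mem_image, Finset.mem_coe, Set.mem_setOf_eq]
    constructor
    · rintro (⟨v, hv, rfl⟩ | ⟨v, hv, rfl⟩)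
      · rwa [hf]
      · rwa [un_sg, hf]
    · intro h
      rcases Q.same_un (f (un M w)) w (hf _) with h1 | h1
      · left; exact ⟨_, h, h1.symm⟩
      · right; exact ⟨_, h, h1.symm⟩
  · rw [Finset.card_union_of_disjoint, Finset.card_image_of_injective _ finj, Finset.card_image_of_injective _ sinj, two_mul]
    rw [Finset.disjoint_left]
    intro w h1 h2
    obtain ⟨v, hv, rfl⟩ := Finset.mem_image.1 h1
    obtain ⟨v', hv', h3⟩ := Finset.mem_image.1 h2
    have : v' = v := by rw [← hf v, ← h3, un_sg, hf]
    subst this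
    exact hS (f v') (by rwa [hf]) h3

/-- S-units upstairs -/
def AL (_Q : Quad M L) (S : Set (Pr M)) : Subgroup Lˣ := AS {w | un M w ∈ S}

/-- x / sx -/
def D : Lˣ →* Lˣ := ⟨⟨fun x => x / Q.S x, by simp⟩, fun x y => by
  show (x * y) / Q.S (x * y) = x / Q.S x * (y / Q.S y)
  rw [map_mul, mul_div_mul_comm]⟩

lemma D_apply (x : Lˣ) : Q.D x = x / Q.S x := rfl

def G (S : Set (Pr M)) : Subgroup Lˣ := (Q.AL S).comap Q.D

lemma mem_G {S : Set (Pr M)} {x : Lˣ} : x ∈ Q.G S ↔ x / Q.S x ∈ Q.AL S := Iff.rfl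

lemma S_mem {S : Set (Pr M)} {x : Lˣ} (hx : x ∈ Q.AL S) : Q.S x ∈ Q.AL S := by
  intro w hw
  rw [← Q.ord_sg]
  exact hx _ (by simpa [un_sg] using hw)

lemma i_mem {S : Set (Pr M)} {x : Mˣ} : i M L x ∈ Q.AL S ↔ x ∈ AS S := by
  constructor
  · intro h v hv
    obtain ⟨w, rfl⟩ := un_surj (L := L) v
    have := h w hv
    rw [ord_map] at this
    exact (mul_eq_zero.1 this).resolve_left (by exact_mod_cast (ee_pos M w).ne')
  · intro h w hw
    rw [ord_map, h _ hw, mul_zero]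

lemma N_mem {S : Set (Pr M)} {x : Lˣ} (hx : x ∈ Q.AL S) : N M L x ∈ AS S := by
  rw [← Q.i_mem, i_N]; exact mul_mem hx (Q.S_mem hx)

/-- parity map -/
noncomputable def ph (_Q : Quad M L) (T : Finset (Pr L)) : Lˣ →* Multiplicative (T → ZMod 2) where
  toFun x := Multiplicative.ofAdd (fun v => ((ord v.1 x : ℤ) : ZMod 2))
  map_one' := by ext v; simp
  map_mul' x y := by ext v; simp

lemma ph_eq (T : Finset (Pr L)) (x : Lˣ) (v : T) : (Q.ph T x).toAdd v = ((ord v.1 x : ℤ) : ZMod 2) := rfl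

omit Q in
lemma zmod_two_even (n : ℤ) : ((n : ℤ) : ZMod 2) = 0 ↔ Even n := by
  rw [ZMod.intCast_zmod_eq_zero_iff_dvd n 2, even_iff_two_dvd]; rfl

lemma ph_ker (T : Finset (Pr L)) (x : Lˣ) : x ∈ (Q.ph T).ker ↔ ∀ w ∈ T, Even (ord w x) := by
  rw [MonoidHom.mem_ker]
  constructor
  · intro h w hw
    have := congrFun (congrArg Multiplicative.toAdd h) ⟨w, hw⟩
    rw [ph_eq] at this
    exact (zmod_two_even _).1 this
  · intro h
    apply Multiplicative.toAdd.injective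
    funext w
    rw [ph_eq]; exact (zmod_two_even _).2 (h w.1 w.2)

lemma D_ker : Q.D.ker = (i M L).range := by
  ext x
  rw [MonoidHom.mem_ker, D_apply, div_eq_one, MonoidHom.mem_range]
  constructor
  · intro h; exact Q.fixU x h.symm
  · rintro ⟨y, rfl⟩; rw [S_i]

lemma ordN_of_G {x : Lˣ} (w : Pr L) (h : ord w (x / Q.S x) = 0) :
    (ee M w : ℤ) * ord (un M w) (N M L x) = 2 * ord w x := by
  rw [← ord_map, i_N, ord_mul]
  rw [ord_div] at h; linarith

lemma ph_ker_G (ho : Odd (classNumber M)) (S : Set (Pr M)) (hS : ∀ w : Pr L, un M w ∈ S → sg Q.s w ≠ w)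
    (T : Finset (Pr L)) (hT : ∀ w, w ∈ T ↔ ee M w = 2) :
    (Q.ph T).ker ⊓ Q.G S = Q.AL S ⊔ Q.D.ker := by
  apply le_antisymm
  · rintro x ⟨hx, hG⟩
    have hx' := (Q.ph_ker T x).1 hx
    obtain ⟨u, hu, b, hb⟩ := sq_lemma ho S (N M L x) (by
      intro v hv
      obtain ⟨w, rfl⟩ := un_surj (L := L) v
      have := Q.ordN_of_G w (hG w hv)
      rcases Q.ee_le w with h | h
      · rw [h] at this; exact ⟨ord w x, by push_cast at this; linarith⟩
      · obtain ⟨k, hk⟩ := hx' w ((hT w).2 h)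
        rw [h, hk] at this; exact ⟨k, by push_cast at this; linarith⟩)
    have key : (x / i M L b) ^ 2 = (x / Q.S x) * i M L u := by
      have h1 := Q.i_N x
      rw [hb, map_mul, map_pow] at h1
      have h2 : i M L u = x * Q.S x / (i M L b) ^ 2 := by rw [← h1, mul_div_cancel_right]
      rw [h2]; ext; push_cast; field_simp
    have hm : (x / i M L b) ∈ Q.AL S := by
      intro w hw
      have h1 := (Q.AL S).mul_mem hG (Q.i_mem.2 hu) w hw
      change ord w ((x / Q.S x) * i M L u) = 0 at h1
      rw [← key, ord_pow] at h1
      push_cast at h1; linarith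
    have : x = (x / i M L b) * i M L b := by rw [div_mul_cancel]
    rw [this]
    exact Subgroup.mul_mem_sup hm (by rw [D_ker]; exact ⟨b, rfl⟩)
  · rw [sup_le_iff]
    constructor
    · intro x hx
      refine ⟨(Q.ph_ker T x).2 ?_, ?_⟩
      · intro w hw
        rw [hx w ?_]; · exact Even.zero
        intro hs
        have := Q.ee_split w (hS w hs)
        rw [hT] at hw; omega
      · exact div_mem hx (Q.S_mem hx)
    · rw [D_ker]
      rintro _ ⟨y, rfl⟩
      refine ⟨(Q.ph_ker T _).2 ?_, ?_⟩
      · intro w hw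
        rw [ord_map, (hT w).1 hw]; exact ⟨ord (un M w) y, by push_cast; ring⟩
      · change i M L y / Q.S (i M L y) ∈ Q.AL S
        rw [S_i, div_self']; exact one_mem _

/-- Herbrand for S-units -/
theorem hq (hinf : Fintype.card (InfinitePlace L) = 2 * Fintype.card (InfinitePlace M))
    (S : Finset (Pr M)) (hS : ∀ w : Pr L, un M w ∈ S → sg Q.s w ≠ w) :
    (Q.AL S ⊔ Q.D.ker).relIndex (Q.G S) = 2 * ((Q.AL S).map (N M L)).relIndex (AS (S : Set (Pr M))) ∧
    ((Q.AL S).map (N M L)).relIndex (AS (S : Set (Pr M))) ≠ 0 := by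
  obtain ⟨T, hT, hc⟩ := Q.above_fin S hS
  set A := Q.AL S with hA
  have hAT : A = AS (T : Set (Pr L)) := by rw [hA, AL, hT]; rfl
  obtain ⟨f1, r1⟩ := AS_rank T
  rw [← hAT] at f1 r1
  obtain ⟨f2, r2⟩ := AS_rank S
  let s : A →* A := (Q.S.comp A.subtype).codRestrict A (fun x => Q.S_mem x.2)
  have hs : ∀ a : A, ((s a : A) : Lˣ) = Q.S a := fun a => rfl
  let P : A →* A := MonoidHom.id A * s
  let R : A →* A := MonoidHom.id A / s
  have hP : ∀ a, P a = a * s a := fun a => rfl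
  have hR : ∀ a, R a = a / s a := fun a => rfl
  obtain ⟨e1, e2, e3⟩ := herbrand s (fun a => by apply Subtype.ext; rw [hs, hs, SS]) P R hP hR
  have mR : R.ker.map A.subtype = (AS (S : Set (Pr M))).map (i M L) := by
    ext x
    constructor
    · rintro ⟨a, ha, rfl⟩
      have h1 : R a = 1 := ha
      rw [hR, div_eq_one] at h1
      obtain ⟨y, hy⟩ := Q.fixU (a : Lˣ) (congrArg Subtype.val h1).symm
      exact ⟨y, Q.i_mem.1 (hy ▸ a.2), hy⟩
    · rintro ⟨y, hy, rfl⟩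
      refine ⟨⟨i M L y, Q.i_mem.2 hy⟩, ?_, rfl⟩
      change R _ = 1
      rw [hR, div_eq_one]; apply Subtype.ext; rw [hs, S_i]
  have mP : P.ker.map A.subtype = (Q.G S).map Q.D := by
    ext x
    constructor
    · rintro ⟨a, ha, rfl⟩
      have h1 : P a = 1 := ha
      rw [hP] at h1
      obtain ⟨b, hb⟩ := Q.h90 a (congrArg Subtype.val h1)
      refine ⟨b, ?_, hb.symm⟩
      change b / Q.S b ∈ A
      rw [← hb]; exact a.2
    · rintro ⟨b, hb, rfl⟩
      refine ⟨⟨Q.D b, hb⟩, ?_, rfl⟩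
      change P _ = 1
      rw [hP]; apply Subtype.ext
      change (b / Q.S b) * Q.S (b / Q.S b) = 1
      rw [map_div, SS, div_mul_div_cancel, div_self']
  have rP : P.range.map A.subtype = (A.map (N M L)).map (i M L) := by
    ext x
    constructor
    · rintro ⟨_, ⟨a, rfl⟩, rfl⟩
      exact ⟨_, ⟨a, a.2, rfl⟩, Q.i_N a⟩
    · rintro ⟨_, ⟨a, ha, rfl⟩, rfl⟩
      exact ⟨_, ⟨⟨a, ha⟩, rfl⟩, (Q.i_N a).symm⟩
  have rR : R.range.map A.subtype = A.map Q.D := by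
    ext x
    constructor
    · rintro ⟨_, ⟨a, rfl⟩, rfl⟩
      exact ⟨a, a.2, rfl⟩
    · rintro ⟨a, ha, rfl⟩
      exact ⟨_, ⟨⟨a, ha⟩, rfl⟩, rfl⟩
  have k0 : A.subtype.ker = ⊥ := (MonoidHom.ker_eq_bot_iff _).2 Subtype.val_injective
  have k1 : (i M L).ker = ⊥ := (MonoidHom.ker_eq_bot_iff _).2 i_inj
  have i1 : P.range.relIndex R.ker = (A.map (N M L)).relIndex (AS (S : Set (Pr M))) := by
    have h1 := Subgroup.relIndex_map_map A.subtype P.range R.ker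
    have h2 := Subgroup.relIndex_map_map (i M L) (A.map (N M L)) (AS (S : Set (Pr M)))
    rw [k0, sup_bot_eq, sup_bot_eq] at h1
    rw [k1, sup_bot_eq, sup_bot_eq] at h2
    rw [← h1, ← h2, mR, rP]
  have i2 : R.range.relIndex P.ker = (A ⊔ Q.D.ker).relIndex (Q.G S) := by
    have h1 := Subgroup.relIndex_map_map A.subtype R.range P.ker
    rw [k0, sup_bot_eq, sup_bot_eq] at h1
    have h2 := Subgroup.relIndex_map_map Q.D A (Q.G S)
    rw [sup_eq_left.2 (show Q.D.ker ≤ Q.G S from fun x hx => by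
      change Q.D x ∈ A
      rw [MonoidHom.mem_ker.1 hx]; exact one_mem _)] at h2
    rw [← h1, rR, mP, h2]
  have r3 : rk R.ker = rk (AS (S : Set (Pr M))) := by
    refine rk_congr ((R.ker.equivMapOfInjective A.subtype Subtype.val_injective).trans
      ((MulEquiv.subgroupCongr mR).trans ((AS (S : Set (Pr M))).equivMapOfInjective (i M L) i_inj).symm))
  rw [i1, i2] at e1
  rw [i1] at e3
  refine ⟨?_, e3⟩
  have p1 : 0 < Fintype.card (InfinitePlace L) := Fintype.card_pos
  have p2 : 0 < Fintype.card (InfinitePlace M) := Fintype.card_pos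
  have : rk P.ker = rk R.ker + 1 := by
    rw [r1, r3, r2, hc] at e2
    rw [r3, r2]
    unfold Units.rank at *
    omega
  rw [this, pow_succ, mul_comm _ 2, ← mul_assoc, mul_comm _ 2] at e1
  exact Nat.eq_of_mul_eq_mul_right (by positivity) e1

/-- the genus formula -/
theorem genus (ho : Odd (classNumber M)) (hinf : Fintype.card (InfinitePlace L) = 2 * Fintype.card (InfinitePlace M))
    (S : Finset (Pr M)) (hS : ∀ w : Pr L, un M w ∈ S → sg Q.s w ≠ w)
    (T : Finset (Pr L)) (hT : ∀ w, w ∈ T ↔ ee M w = 2) :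
    2 * ((Q.AL S).map (N M L)).relIndex (AS (S : Set (Pr M))) = Nat.card ((Q.G S).map (Q.ph T)) ∧
    ((Q.AL S).map (N M L)).relIndex (AS (S : Set (Pr M))) ≠ 0 ∧
    2 * ((Q.AL S).map (N M L)).relIndex (AS (S : Set (Pr M))) ≤ 2 ^ T.card := by
  obtain ⟨h1, h2⟩ := Q.hq hinf S hS
  have h3 : 2 * ((Q.AL S).map (N M L)).relIndex (AS (S : Set (Pr M))) = Nat.card ((Q.G S).map (Q.ph T)) := by
    rw [← h1, ← Q.ph_ker_G ho S hS T hT, Subgroup.inf_relIndex_right, Subgroup.relIndex_ker]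
  refine ⟨h3, h2, ?_⟩
  have hc : Nat.card (Multiplicative (T → ZMod 2)) = 2 ^ T.card := by
    change Nat.card (T → ZMod 2) = _
    simp
  rw [h3, ← hc]
  haveI : Finite (Multiplicative (T → ZMod 2)) := inferInstanceAs (Finite (T → ZMod 2))
  exact Nat.card_le_card_of_injective _ Subtype.val_injective

/-- symbols -/
lemma chi_exists (S : Set (Pr M)) (T : Finset (Pr L)) (hd : ∀ w ∈ T, un M w ∉ S) :
    ∃ χ : AS S →* Multiplicative (T → ZMod 2), ∀ u (w : T), (χ u).toAdd w = 0 ↔ SqMod (un M w.1) ((u : Mˣ) : M) := by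
  refine ⟨⟨⟨fun u => Multiplicative.ofAdd (fun w => if SqMod (un M w.1) ((u : Mˣ) : M) then 0 else 1), ?_⟩, ?_⟩, ?_⟩
  · ext w; simp [sqmod_one]
  · intro x y
    apply Multiplicative.toAdd.injective
    funext w
    have h := sqmod_mul_iff (un M w.1) x.1 y.1 (x.2 _ (hd _ w.2)) (y.2 _ (hd _ w.2))
    change (if SqMod (un M w.1) ((x.1 * y.1 : Mˣ) : M) then (0 : ZMod 2) else 1) = (if SqMod (un M w.1) ((x : Mˣ) : M) then 0 else 1) + (if SqMod (un M w.1) ((y : Mˣ) : M) then 0 else 1)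
    rw [if_congr h rfl rfl]
    by_cases a : SqMod (un M w.1) ((x : Mˣ) : M) <;> by_cases b : SqMod (un M w.1) ((y : Mˣ) : M) <;> simp [a, b] <;> rfl
  · intro u w
    change (if SqMod (un M w.1) ((u : Mˣ) : M) then (0 : ZMod 2) else 1) = 0 ↔ _
    split_ifs with h <;> simp [h]

theorem no_surj (ho : Odd (classNumber M)) (hinf : Fintype.card (InfinitePlace L) = 2 * Fintype.card (InfinitePlace M))
    (S : Finset (Pr M)) (hS : ∀ w : Pr L, un M w ∈ S → sg Q.s w ≠ w)
    (T : Finset (Pr L)) (hT : ∀ w, w ∈ T ↔ ee M w = 2)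
    (hsurj : ∀ f : Pr M → Prop, ∃ u ∈ AS (S : Set (Pr M)), ∀ w ∈ T, (SqMod (un M w) (u : M) ↔ f (un M w))) : False := by
  have hd : ∀ w ∈ T, un M w ∉ (S : Set (Pr M)) := by
    intro w hw hs
    have := Q.ee_split w (hS w hs)
    rw [hT] at hw; omega
  obtain ⟨χ, hχ⟩ := Q.chi_exists S T hd
  obtain ⟨_, h2, h3⟩ := Q.genus ho hinf S hS T hT
  have hs : Function.Surjective χ := by
    intro z
    obtain ⟨u, hu, h⟩ := hsurj (fun v => ∃ w : T, un M w.1 = v ∧ z.toAdd w = 0)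
    refine ⟨⟨u, hu⟩, ?_⟩
    apply Multiplicative.toAdd.injective
    funext w
    have h1 := (hχ ⟨u, hu⟩ w).trans (h w.1 w.2)
    have h4 : (∃ w' : T, un M w'.1 = un M w.1 ∧ z.toAdd w' = 0) ↔ z.toAdd w = 0 := by
      constructor
      · rintro ⟨w', h5, h6⟩
        have : w' = w := by
          rcases Q.same_un w.1 w'.1 h5.symm with h7 | h7
          · exact Subtype.ext h7
          · rw [Q.ram_sg w.1 ((hT _).1 w.2)] at h7; exact Subtype.ext h7
        rwa [← this]
      · intro h; exact ⟨w, rfl, h⟩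
    rw [h4] at h1
    have two : ∀ a b : ZMod 2, (a = 0 ↔ b = 0) → a = b := by decide
    exact two _ _ h1
  have hidx : χ.ker.index = 2 ^ T.card := by
    rw [Subgroup.index_ker, MonoidHom.range_eq_top.2 hs]
    rw [Subgroup.card_top]
    change Nat.card (T → ZMod 2) = _
    simp
  have hle : ((Q.AL S).map (N M L)).subgroupOf (AS (S : Set (Pr M))) ≤ χ.ker := by
    rintro ⟨u, hu⟩ ⟨x, hx, hxu⟩
    have hxu' : N M L x = u := hxu
    rw [MonoidHom.mem_ker]
    apply Multiplicative.toAdd.injective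
    funext w
    refine (hχ _ w).2 ?_
    change SqMod (un M w.1) (u : M)
    rw [← hxu']
    exact Q.ram_norm w.1 ((hT _).1 w.2) x (hx _ (hd _ w.2))
  have hdvd := Subgroup.index_dvd_of_le hle
  rw [hidx] at hdvd
  have h5 := Nat.le_of_dvd (Nat.pos_of_ne_zero h2) hdvd
  change 2 ^ T.card ≤ ((Q.AL S).map (N M L)).relIndex (AS (S : Set (Pr M))) at h5
  omega

end Quad
end
end Sch


set_option linter.all false

namespace Sch
open IsDedekindDomain nonZeroDivisors

section
variable {M L : Type*} [Field M] [NumberField M] [Field L] [NumberField L] [Algebra M L]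

namespace Quad
variable (Q : Quad M L)
include Q

lemma AL_empty : Q.AL ((∅ : Finset (Pr M)) : Set (Pr M)) = AS ∅ := by
  ext x; simp [AL, mem_AS]

lemma mem_G0 {x : Lˣ} : x ∈ Q.G ((∅ : Finset (Pr M)) : Set (Pr M)) ↔ x / Q.S x ∈ AS (∅ : Set (Pr L)) := by
  rw [mem_G, AL_empty]

/-- unit norm index -/
noncomputable def idx (_Q : Quad M L) : ℕ := ((AS (∅ : Set (Pr L))).map (N M L)).relIndex (AS (∅ : Set (Pr M)))

def Full (T : Finset (Pr L)) : Prop :=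
  ∀ f : Pr L → Prop, ∃ γ : Lˣ, γ / Q.S γ ∈ AS (∅ : Set (Pr L)) ∧ ∀ w ∈ T, (Even (ord w γ) ↔ f w)

lemma genus0 (ho : Odd (classNumber M)) (hinf : Fintype.card (InfinitePlace L) = 2 * Fintype.card (InfinitePlace M))
    (T : Finset (Pr L)) (hT : ∀ w, w ∈ T ↔ ee M w = 2) :
    Q.idx ≠ 0 ∧ 2 * Q.idx ≤ 2 ^ T.card ∧ (2 * Q.idx = 2 ^ T.card ↔ Q.Full T) := by
  obtain ⟨h1, h2, h3⟩ := Q.genus ho hinf ∅ (by simp) T hT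
  rw [AL_empty, Finset.coe_empty] at h2 h3
  rw [AL_empty] at h1
  rw [Finset.coe_empty] at h1
  refine ⟨h2, h3, ?_⟩
  change 2 * Q.idx = _ at h1
  rw [h1]
  haveI : Finite (Multiplicative (T → ZMod 2)) := inferInstanceAs (Finite (T → ZMod 2))
  have hc : Nat.card (Multiplicative (T → ZMod 2)) = 2 ^ T.card := by
    change Nat.card (T → ZMod 2) = _
    simp
  have two : ∀ a b : ZMod 2, (a = 0 ↔ b = 0) → a = b := by decide
  constructor
  · intro h f
    have := Subgroup.eq_top_of_card_eq _ (h.trans hc.symm)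
    have hm : (Multiplicative.ofAdd (fun w : T => if f w.1 then (0 : ZMod 2) else 1)) ∈ (Q.G ∅).map (Q.ph T) := by
      rw [this]; trivial
    obtain ⟨γ, hγ, hγ'⟩ := hm
    refine ⟨γ, Q.mem_G0.1 (by simpa using hγ), fun w hw => ?_⟩
    have h5 := congrFun (congrArg Multiplicative.toAdd hγ') ⟨w, hw⟩
    rw [ph_eq] at h5
    rw [← zmod_two_even, h5]
    change (if f w then (0 : ZMod 2) else 1) = 0 ↔ f w
    split_ifs with h6 <;> simp [h6]
  · intro hF
    have : (Q.G ∅).map (Q.ph T) = ⊤ := by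
      rw [eq_top_iff]
      intro z _
      obtain ⟨γ, hγ, hγ'⟩ := hF (fun w => ∀ hw : w ∈ T, z.toAdd ⟨w, hw⟩ = 0)
      refine ⟨γ, by simpa using Q.mem_G0.2 hγ, ?_⟩
      apply Multiplicative.toAdd.injective
      funext w
      apply two
      rw [ph_eq, zmod_two_even, hγ' w.1 w.2]
      exact ⟨fun h => h w.2, fun h _ => h⟩
    rw [this, Subgroup.card_top, hc]

lemma unram_even (hinf : Fintype.card (InfinitePlace L) = 2 * Fintype.card (InfinitePlace M))
    (hT : ∀ w : Pr L, ee M w = 1) : ¬ Odd (classNumber M) := by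
  intro ho
  obtain ⟨h1, h2, _⟩ := Q.genus0 ho hinf ∅ (by simp [hT])
  simp at h2; omega

lemma V_N {x : Lˣ} (hx : Vev x) : Vev (N M L x) := by
  intro v
  obtain ⟨w, rfl⟩ := un_surj (L := L) v
  rcases Q.ee_le w with h | h
  · have h1 : ord w (i M L (N M L x)) = ord w x + ord (sg Q.s w) x := by rw [i_N, ord_mul, ord_sg]
    rw [ord_map, h] at h1
    push_cast at h1
    rw [one_mul] at h1
    rw [h1]
    exact (hx w).add (hx _)
  · have h1 : ord w (i M L (N M L x)) = ord w x + ord (sg Q.s w) x := by rw [i_N, ord_mul, ord_sg]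
    rw [ord_map, h, Q.ram_sg w h] at h1
    have : ord (un M w) (N M L x) = ord w x := by push_cast at h1; linarith
    rw [this]; exact hx w

lemma lemG (ho : Odd (classNumber M)) (T : Finset (Pr L)) (hT : ∀ w, w ∈ T ↔ ee M w = 2)
    (hF : Q.Full T) (x : Lˣ) (hx : Vev x) (η : Lˣ) (hη : η ∈ AS (∅ : Set (Pr L))) (c : Mˣ)
    (hN : N M L x = N M L η * c ^ 2) : x ∈ E2 L := by
  obtain ⟨b, hb⟩ := Q.h90 (x / (η * i M L c)) (by
    rw [← Q.i_N, map_div, map_mul, Q.N_i, hN, div_self', map_one])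
  have hNb := Q.i_N b
  set m := c / N M L b with hm
  have e1 : x = η * i M L m * b ^ 2 := by
    rw [hm, map_div, hNb]
    rw [div_eq_iff_eq_mul] at hb
    rw [hb]; ext; push_cast; field_simp
  have hm1 : ∀ w : Pr L, ee M w = 1 → Even (ord (un M w) m) := by
    intro w hw
    have h1 := congrArg (ord w) e1
    rw [ord_mul, ord_mul, ord_map, hw, mem_AS_empty.1 hη w, ord_pow] at h1
    obtain ⟨r, hr⟩ := hx w
    exact ⟨r - ord w b, by push_cast at h1; linarith⟩
  obtain ⟨γ, hγ, hγT⟩ := hF (fun w => Even (ord (un M w) m))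
  have hV : Vev (m * N M L γ) := by
    intro v
    obtain ⟨w, rfl⟩ := un_surj (L := L) v
    have h1 := Q.ordN_of_G w (mem_AS_empty.1 hγ w)
    rw [ord_mul]
    rcases Q.ee_le w with h | h
    · refine (hm1 w h).add ?_
      rw [h] at h1; exact ⟨ord w γ, by push_cast at h1; linarith⟩
    · rw [h] at h1
      have : ord (un M w) (N M L γ) = ord w γ := by push_cast at h1; linarith
      rw [this, Int.even_add]
      exact (hγT w ((hT w).2 h)).symm
  obtain ⟨e, he, y, hy⟩ := mem_E2.1 (V_E2_of_odd ho _ hV)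
  have he' : i M L e ∈ AS (∅ : Set (Pr L)) := by
    have := (Q.i_mem (S := ((∅ : Finset (Pr M)) : Set (Pr M)))).2 (by simpa using he)
    rwa [AL_empty] at this
  refine mem_E2.2 ⟨η * i M L e * (γ / Q.S γ), mul_mem (mul_mem hη he') hγ, i M L y * b / γ, ?_⟩
  have h3 := congrArg (i M L) hy
  rw [map_mul, Q.i_N, map_mul, map_pow] at h3
  have h4 : i M L m = i M L e * (i M L y) ^ 2 / (γ * Q.S γ) := by rw [← h3, mul_div_cancel_right]
  rw [e1, h4]; ext; push_cast; field_simp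

lemma U3 (ho : Odd (classNumber M)) (hinf : Fintype.card (InfinitePlace L) = 2 * Fintype.card (InfinitePlace M))
    (T : Finset (Pr L)) (hT : ∀ w, w ∈ T ↔ ee M w = 2) (hc : T.card = 1) : Odd (classNumber L) := by
  obtain ⟨h1, h2, h3⟩ := Q.genus0 ho hinf T hT
  rw [hc] at h2 h3
  have h4 : Q.idx = 1 := by omega
  have hF := h3.1 (by rw [h4]; norm_num)
  apply odd_of_V
  intro x hx
  obtain ⟨e, he, y, hy⟩ := mem_E2.1 (V_E2_of_odd ho _ (Q.V_N hx))
  have h5 := Subgroup.relIndex_eq_one.1 h4 he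
  obtain ⟨η, hη, rfl⟩ := h5
  exact Q.lemG ho T hT hF x hx η hη y hy

lemma U4 (ho : Odd (classNumber M)) (hinf : Fintype.card (InfinitePlace L) = 2 * Fintype.card (InfinitePlace M))
    (T : Finset (Pr L)) (hT : ∀ w, w ∈ T ↔ ee M w = 2) (hc : T.card = 2) (w : Pr L) (hw : w ∈ T)
    (ε : Mˣ) (hε : ε ∈ AS (∅ : Set (Pr M))) (hns : ¬ SqMod (un M w) (ε : M)) : Odd (classNumber L) := by
  obtain ⟨h1, h2, h3⟩ := Q.genus0 ho hinf T hT
  rw [hc] at h2 h3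
  have hle : (AS (∅ : Set (Pr L))).map (N M L) ≤ SQ (un M w) ⊓ AS (∅ : Set (Pr M)) := by
    rintro _ ⟨x, hx, rfl⟩
    have h0 : N M L x ∈ AS (∅ : Set (Pr M)) := by
      have := Q.N_mem (S := ((∅ : Finset (Pr M)) : Set (Pr M))) (x := x) (by rwa [AL_empty])
      simpa using this
    exact ⟨mem_SQ.2 ⟨mem_AS_empty.1 h0 _, Q.ram_norm w ((hT w).1 hw) x (mem_AS_empty.1 hx w)⟩, h0⟩
  have h5 := Subgroup.relIndex_mul_relIndex _ _ _ hle (inf_le_right : SQ (un M w) ⊓ AS (∅ : Set (Pr M)) ≤ AS ∅)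
  have h6 : (SQ (un M w) ⊓ AS (∅ : Set (Pr M))).relIndex (AS ∅) ≠ 1 := by
    intro h
    exact hns (mem_SQ.1 (Subgroup.relIndex_eq_one.1 h hε).1).2
  change _ = Q.idx at h5
  have h4 : Q.idx ≤ 2 := by omega
  have h7 : ((AS (∅ : Set (Pr L))).map (N M L)).relIndex (SQ (un M w) ⊓ AS (∅ : Set (Pr M))) = 1 ∧ Q.idx = 2 := by
    generalize ((AS (∅ : Set (Pr L))).map (N M L)).relIndex (SQ (un M w) ⊓ AS (∅ : Set (Pr M))) = a at *
    generalize (SQ (un M w) ⊓ AS (∅ : Set (Pr M))).relIndex (AS ∅) = b at *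
    have : a ≠ 0 := by rintro rfl; simp at h5; exact h1 h5.symm
    have : b ≠ 0 := by rintro rfl; simp at h5; exact h1 h5.symm
    have hb : 2 ≤ b := by omega
    have : a * 2 ≤ a * b := Nat.mul_le_mul_left _ hb
    have : a = 1 := by omega
    subst this
    omega
  have hF := h3.1 (by rw [h7.2]; norm_num)
  apply odd_of_V
  intro x hx
  obtain ⟨e, he, y, hy⟩ := mem_E2.1 (V_E2_of_odd ho _ (Q.V_N hx))
  have hes : SqMod (un M w) (e : M) := by
    obtain ⟨c, hc⟩ := exists_unif w
    obtain ⟨j, hj⟩ := hx w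
    have hx' : ord w (x / (c ^ j) ^ 2) = 0 := by
      rw [ord_div, ord_pow, ord_zpow, hc, hj]; push_cast; ring
    have hr := Q.ram_norm w ((hT w).1 hw) _ hx'
    have h8 : ord (un M w) (N M L (x / (c ^ j) ^ 2)) = 0 := by
      have : ord w (i M L (N M L (x / (c ^ j) ^ 2))) = 0 := by
        rw [i_N, ord_mul, ← ord_sg, Q.ram_sg w ((hT w).1 hw), hx']; rfl
      rw [ord_map, (hT w).1 hw] at this
      push_cast at this; linarith
    have h9 : N M L (x / (c ^ j) ^ 2) = e * (y / N M L (c ^ j)) ^ 2 := by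
      rw [map_div, hy, map_pow]; ext; push_cast; field_simp
    rw [h9] at hr h8
    rw [ord_mul, mem_AS_empty.1 he, ord_pow] at h8
    exact (sqmod_mul_sq _ _ _ (mem_AS_empty.1 he _) (by push_cast at h8; linarith)).1 hr
  obtain ⟨η, hη, rfl⟩ := Subgroup.relIndex_eq_one.1 h7.1 ⟨mem_SQ.2 ⟨mem_AS_empty.1 he _, hes⟩, he⟩
  exact Q.lemG ho T hT hF x hx η hη y hy

/-- the hypothesis of not_four_dvd -/
lemma U6 (ho : Odd (classNumber M)) (T : Finset (Pr L)) (hT : ∀ w, w ∈ T ↔ ee M w = 2)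
    (hF : Q.Full T) (hi : Q.idx = 2) (x y : Lˣ) (hx : Vev x) (hy : Vev y) (hx' : x ∉ E2 L) (hy' : y ∉ E2 L) :
    x * y ∈ E2 L := by
  obtain ⟨e, he, c, hc⟩ := mem_E2.1 (V_E2_of_odd ho _ (Q.V_N hx))
  obtain ⟨f, hf, d, hd⟩ := mem_E2.1 (V_E2_of_odd ho _ (Q.V_N hy))
  have h1 : e ∉ (AS (∅ : Set (Pr L))).map (N M L) := by
    rintro ⟨η, hη, rfl⟩
    exact hx' (Q.lemG ho T hT hF x hx η hη c hc)
  have h2 : f ∉ (AS (∅ : Set (Pr L))).map (N M L) := by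
    rintro ⟨η, hη, rfl⟩
    exact hy' (Q.lemG ho T hT hF y hy η hη d hd)
  have h3 := (Subgroup.mul_mem_iff_of_index_two (H := ((AS (∅ : Set (Pr L))).map (N M L)).subgroupOf (AS (∅ : Set (Pr M)))) hi (a := ⟨e, he⟩) (b := ⟨f, hf⟩))
  simp only [Subgroup.mem_subgroupOf, h1, h2] at h3
  obtain ⟨η, hη, h⟩ := h3.2 trivial
  have h' : N M L η = e * f := h
  refine Q.lemG ho T hT hF (x * y) (fun v => by rw [ord_mul]; exact (hx v).add (hy v)) η hη (c * d) ?_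
  rw [map_mul, hc, hd, h']; ext; push_cast; ring

lemma iV {m : Mˣ} : m ∈ E2 M → i M L m ∈ E2 L := by
  intro h
  obtain ⟨e, he, y, rfl⟩ := mem_E2.1 h
  rw [map_mul, map_pow]
  refine mul_mem (unit_mem_E2 ?_) (sq_mem_E2 _)
  have := (Q.i_mem (S := ((∅ : Finset (Pr M)) : Set (Pr M)))).2 (by simpa using he)
  rwa [AL_empty] at this

lemma unit_of_i {m : Mˣ} (h : i M L m ∈ AS (∅ : Set (Pr L))) : m ∈ AS (∅ : Set (Pr M)) := by
  have := (Q.i_mem (S := ((∅ : Finset (Pr M)) : Set (Pr M))) (x := m)).1 (by rwa [AL_empty])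
  simpa using this

theorem U1b (hinf : Fintype.card (InfinitePlace L) = 2 * Fintype.card (InfinitePlace M))
    (hT : ∀ w : Pr L, ee M w = 1) {g : ℕ} (hg : Odd g) (hM : classNumber M = 2 * g) : Odd (classNumber L) := by
  obtain ⟨h1, h2⟩ := Q.hq hinf ∅ (by simp)
  rw [AL_empty] at h1 h2
  set H : Subgroup Lˣ := AS ∅ ⊔ Q.D.ker with hH
  set G0 := Q.G ((∅ : Finset (Pr M)) : Set (Pr M)) with hG0
  have ordN : ∀ x ∈ G0, ∀ w : Pr L, ord (un M w) (N M L x) = 2 * ord w x := by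
    intro x hx w
    have := Q.ordN_of_G w (mem_AS_empty.1 (Q.mem_G0.1 hx) w)
    rw [hT] at this; push_cast at this; linarith
  have VN : ∀ x ∈ G0, Vev (N M L x) := by
    intro x hx v
    obtain ⟨w, rfl⟩ := un_surj (L := L) v
    rw [ordN x hx]; exact even_two_mul _
  have HN : ∀ x ∈ G0, N M L x ∈ E2 M → x ∈ H := by
    intro x hx h
    obtain ⟨e, he, b, hb⟩ := mem_E2.1 h
    have key : x / i M L b ∈ AS (∅ : Set (Pr L)) := by
      rw [mem_AS_empty]
      intro w
      have := ordN x hx w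
      rw [hb, ord_mul, mem_AS_empty.1 he, ord_pow] at this
      rw [ord_div, ord_map, hT]; push_cast at *; linarith
    have : x = (x / i M L b) * i M L b := by rw [div_mul_cancel]
    rw [this]
    exact Subgroup.mul_mem_sup key (by rw [D_ker]; exact ⟨b, rfl⟩)
  have HE : ∀ x ∈ H, N M L x ∈ E2 M := by
    intro x hx
    obtain ⟨a, ha, b, hb, rfl⟩ := Subgroup.mem_sup.1 hx
    rw [D_ker] at hb
    obtain ⟨c, rfl⟩ := hb
    rw [map_mul, Q.N_i]
    refine mul_mem (unit_mem_E2 ?_) (sq_mem_E2 _)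
    have := Q.N_mem (S := ((∅ : Finset (Pr M)) : Set (Pr M))) (x := a) (by rwa [AL_empty])
    simpa using this
  have hex : ∃ a ∈ G0, a ∉ H := by
    by_contra hcon
    push Not at hcon
    have : H.relIndex G0 = 1 := Subgroup.relIndex_eq_one.2 hcon
    omega
  obtain ⟨a, ha, haH⟩ := hex
  have hNa : N M L a ∉ E2 M := fun h => haH (HN a ha h)
  have h3 : H.relIndex G0 = 2 := by
    refine Subgroup.index_eq_two_iff.2 ⟨⟨a, ha⟩, ?_⟩
    rintro ⟨b, hb⟩
    simp only [Subgroup.mem_subgroupOf]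
    change Xor' (b * a ∈ H) (b ∈ H)
    by_cases hbH : b ∈ H
    · right
      exact ⟨hbH, fun h => haH ((Subgroup.mul_mem_cancel_left _ hbH).1 h)⟩
    · left
      refine ⟨HN _ (mul_mem hb ha) ?_, hbH⟩
      rw [map_mul]
      exact unique_two hg hM _ _ (VN b hb) (VN a ha) (fun h => hbH (HN b hb h)) hNa
  have h4 : Q.idx = 1 := by
    have : 2 = 2 * Q.idx := by
      rw [h3] at h1; simpa [idx] using h1
    omega
  have VE : ∀ x : Mˣ, Vev x → i M L x ∈ E2 L := by
    intro x hx
    by_cases h : x ∈ E2 M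
    · exact Q.iV h
    · have h5 := Q.iV (unique_two hg hM x _ hx (VN a ha) h hNa)
      rw [map_mul, i_N] at h5
      have h6 : i M L x = (i M L x * (a * Q.S a)) * (a / Q.S a) * (a⁻¹) ^ 2 := by
        ext; push_cast; field_simp
      rw [h6]
      exact mul_mem (mul_mem h5 (unit_mem_E2 (Q.mem_G0.1 ha))) (sq_mem_E2 _)
  apply odd_of_V
  intro x hx
  obtain ⟨e, he, α, hα⟩ := mem_E2.1 (VE _ (Q.V_N hx))
  rw [i_N] at hα
  have ordα : ∀ w, 2 * ord w α = ord w x + ord w (Q.S x) := by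
    intro w
    have := congrArg (ord w) hα
    rw [ord_mul, ord_mul, mem_AS_empty.1 he, ord_pow] at this
    push_cast at this; linarith
  have ordSα : ∀ w, ord w (Q.S α) = ord w α := by
    intro w
    have h5 := ordα w
    have h6 := ordα (sg Q.s w)
    rw [ord_sg, ord_sg, ord_sg, SS] at h6
    linarith
  have hu : N M L (α / x) ∈ AS (∅ : Set (Pr M)) := by
    apply Q.unit_of_i
    rw [mem_AS_empty]
    intro w
    rw [i_N, map_div, ord_mul, ord_div, ord_div, ordSα]
    have := ordα w
    linarith
  obtain ⟨η, hη, hη'⟩ := Subgroup.relIndex_eq_one.1 h4 hu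
  obtain ⟨β, hβ⟩ := Q.h90 (α / x / η) (by rw [← i_N, map_div, hη', div_self', map_one])
  set y := x * β ^ 2 with hy
  have ordβ : ∀ w, ord w β - ord w (Q.S β) = ord w α - ord w x := by
    intro w
    have := congrArg (ord w) hβ
    rw [ord_div, ord_div, ord_div, mem_AS_empty.1 hη] at this
    linarith
  have hyG : y ∈ G0 := by
    rw [hG0, mem_G0, mem_AS_empty]
    intro w
    rw [hy, map_mul, map_pow, ord_div, ord_mul, ord_mul, ord_pow, ord_pow]
    have := ordβ w
    have := ordα w
    push_cast; linarith
  have hyV : ∀ w, Even (ord w y) := by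
    intro w; rw [hy, ord_mul, ord_pow]
    exact (hx w).add (by push_cast; exact even_two_mul _)
  set n := N M L y
  have h4n : ∀ v, 4 ∣ ord v n := by
    intro v
    obtain ⟨w, rfl⟩ := un_surj (L := L) v
    rw [ordN y hyG]
    obtain ⟨r, hr⟩ := hyV w
    exact ⟨r, by rw [hr]; ring⟩
  obtain ⟨b, hb⟩ := div_lemma (K := M) (Finsupp.ofSupportFinite (fun v => ord v n / 4)
    ((ord_finite n).subset (fun v hv => by
      simp only [Function.mem_support] at hv
      intro h0
      apply hv
      rw [h0]; rfl)))
  have hb' : ∀ v, 4 * ord v b = 2 * g * ord v n := by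
    intro v
    rw [hb v, hM]
    change 4 * (((2 * g : ℕ) : ℤ) * (ord v n / 4)) = _
    have := Int.ediv_mul_cancel (h4n v)
    push_cast
    calc (4 : ℤ) * (2 * g * (ord v n / 4)) = 2 * g * (ord v n / 4 * 4) := by ring
      _ = _ := by rw [this]
  have hbV : Vev b := by
    intro v
    rw [hb v, hM]
    push_cast
    exact ⟨g * (ord v n / 4), by
      change 2 * (g : ℤ) * (ord v n / 4) = _
      ring⟩
  have hyE : y ^ g ∈ E2 L := by
    have h5 : y ^ g / i M L b ∈ AS (∅ : Set (Pr L)) := by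
      rw [mem_AS_empty]
      intro w
      rw [ord_div, ord_pow, ord_map, hT]
      have h6 := hb' (un M w)
      have h7 : ord (un M w) n = 2 * ord w y := ordN y hyG w
      rw [h7] at h6
      push_cast; linarith
    have h6 : y ^ g = (y ^ g / i M L b) * i M L b := by rw [div_mul_cancel]
    rw [h6]; exact mul_mem (unit_mem_E2 h5) (VE b hbV)
  have hyE' := E2_of_odd_pow hg hyE
  have : x = y * (β⁻¹) ^ 2 := by rw [hy]; ext; push_cast; field_simp
  rw [this]; exact mul_mem hyE' (sq_mem_E2 _)

end Quad
end
end Sch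


set_option linter.all false

namespace Sch
open IsDedekindDomain nonZeroDivisors Filter Topology

lemma anal {α β : Type*} (w : α → ℕ) (w2 : β → ℕ) (hw : ∀ a, 1 ≤ w a)
    (hf : ∀ y : ℝ, {a | (w a : ℝ) ≤ y}.Finite) (hf2 : ∀ y : ℝ, {a | (w2 a : ℝ) ≤ y}.Finite)
    {ρ ρ2 : ℝ} (hρ : 0 < ρ)
    (h : Tendsto (fun y : ℝ => ({a | (w a : ℝ) ≤ y}.ncard : ℝ) / y) atTop (𝓝 ρ))
    (h2 : Tendsto (fun y : ℝ => ({a | (w2 a : ℝ) ≤ y}.ncard : ℝ) / y) atTop (𝓝 ρ2))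
    (J : α × α → β) (hJ : Function.Injective J) (hJw : ∀ a b, w2 (J (a, b)) ≤ w a * w b) : False := by
  have hw0 : ∀ a, (0 : ℝ) < w a := fun a => by exact_mod_cast (hw a)
  have step : ∀ (A : Finset α) (y : ℝ), ∑ a ∈ A, ({b | (w b : ℝ) ≤ y / w a}.ncard) ≤ {b | (w2 b : ℝ) ≤ y}.ncard := by
    intro A y
    set X := A.sigma (fun a => (hf (y / w a)).toFinset) with hX
    have hc : X.card = ∑ a ∈ A, ({b | (w b : ℝ) ≤ y / w a}.ncard) := by
      rw [hX, Finset.card_sigma]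
      exact Finset.sum_congr rfl (fun a _ => (Set.ncard_eq_toFinset_card _ _).symm)
    rw [← hc, Set.ncard_eq_toFinset_card _ (hf2 y)]
    refine Finset.card_le_card_of_injOn (fun p => J (p.1, p.2)) ?_ ?_
    · rintro ⟨a, b⟩ hp
      simp only [hX, Finset.coe_sigma, Set.mem_sigma_iff, Finset.mem_coe, Set.Finite.mem_toFinset, Set.mem_setOf_eq] at hp ⊢
      have h3 : ((w2 (J (a, b)) : ℕ) : ℝ) ≤ w a * w b := by exact_mod_cast hJw a b
      have h4 := (le_div_iff₀ (hw0 a)).1 hp.2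
      linarith
    · rintro ⟨a, b⟩ _ ⟨c, d⟩ _ he
      have := hJ he
      simp only [Prod.mk.injEq] at this
      obtain ⟨rfl, rfl⟩ := this
      rfl
  have bound : ∀ A : Finset α, ∑ a ∈ A, (w a : ℝ)⁻¹ ≤ ρ2 / ρ := by
    intro A
    have t1 : Tendsto (fun y : ℝ => ∑ a ∈ A, ({b | (w b : ℝ) ≤ y / w a}.ncard : ℝ) / y) atTop
        (𝓝 (∑ a ∈ A, ρ * (w a : ℝ)⁻¹)) := by
      apply tendsto_finsetSum
      intro a _
      have t2 := (h.comp (tendsto_id.atTop_div_const (hw0 a))).mul_const ((w a : ℝ)⁻¹)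
      refine t2.congr ?_
      intro y
      simp only [Function.comp, id]
      have := (hw0 a).ne'
      have g : ∀ c : ℝ, c / (y / w a) * (w a : ℝ)⁻¹ = c / y := by intro c; field_simp
      exact g _
    have := le_of_tendsto_of_tendsto t1 h2 (by
      filter_upwards [eventually_gt_atTop 0] with y hy
      rw [← Finset.sum_div]
      gcongr
      exact_mod_cast step A y)
    rw [← Finset.mul_sum] at this
    rw [le_div_iff₀ hρ]; linarith
  have hs : Summable (fun a => (w a : ℝ)⁻¹) :=
    summable_of_sum_le (fun a => by positivity) bound
  obtain ⟨A0, hA0⟩ := summable_iff_vanishing_norm.1 hs (ρ / 2) (by positivity)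
  have key : ∀ᶠ y : ℝ in atTop, ({a | (w a : ℝ) ≤ y}.ncard : ℝ) / y ≤ ρ / 2 + A0.card / y := by
    filter_upwards [eventually_gt_atTop 0] with y hy
    have h3 := hA0 ((hf y).toFinset \ A0) Finset.sdiff_disjoint
    rw [Real.norm_of_nonneg (Finset.sum_nonneg (fun a _ => by positivity))] at h3
    have h4 : ((((hf y).toFinset \ A0).card : ℕ) : ℝ) * y⁻¹ ≤ ∑ a ∈ (hf y).toFinset \ A0, (w a : ℝ)⁻¹ := by
      rw [← nsmul_eq_mul]
      apply Finset.card_nsmul_le_sum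
      intro a ha
      simp only [Finset.mem_sdiff, Set.Finite.mem_toFinset, Set.mem_setOf_eq] at ha
      exact inv_anti₀ (hw0 a) ha.1
    have h5 : ({a | (w a : ℝ) ≤ y}.ncard : ℝ) ≤ ((hf y).toFinset \ A0).card + A0.card := by
      rw [Set.ncard_eq_toFinset_card _ (hf y)]
      have := Finset.card_le_card_sdiff_add_card (s := (hf y).toFinset) (t := A0)
      exact_mod_cast this
    calc ({a | (w a : ℝ) ≤ y}.ncard : ℝ) / y ≤ ((((hf y).toFinset \ A0).card : ℕ) + A0.card) / y := by gcongr
      _ = (((hf y).toFinset \ A0).card : ℕ) * y⁻¹ + A0.card / y := by ring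
      _ ≤ _ := by linarith
  have t3 : Tendsto (fun y : ℝ => ρ / 2 + A0.card / y) atTop (𝓝 (ρ / 2 + 0)) :=
    tendsto_const_nhds.add (tendsto_const_nhds.div_atTop tendsto_id)
  have := le_of_tendsto_of_tendsto h t3 key
  linarith

section
variable {P : Type*} (ν : P → ℕ)

def nm (m : Multiset P) : ℕ := (m.map ν).prod

lemma nm_cons (p : P) (m : Multiset P) : nm ν (p ::ₘ m) = ν p * nm ν m := by simp [nm]
lemma nm_add (m n : Multiset P) : nm ν (m + n) = nm ν m * nm ν n := by simp [nm]
lemma nm_map {P' : Type*} (f : P' → P) (m : Multiset P') : nm ν (m.map f) = nm (ν ∘ f) m := by simp [nm]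
lemma one_le_nm (hν : ∀ p, 2 ≤ ν p) (m : Multiset P) : 1 ≤ nm ν m := by
  induction m using Multiset.induction with
  | empty => simp [nm]
  | cons p m ih => rw [nm_cons]; have := hν p; nlinarith
lemma nm_mono {ν ν' : P → ℕ} (h : ∀ p, ν p ≤ ν' p) (m : Multiset P) : nm ν m ≤ nm ν' m := by
  induction m using Multiset.induction with
  | empty => simp [nm]
  | cons p m ih => rw [nm_cons, nm_cons]; exact Nat.mul_le_mul (h p) ih

lemma good_density (hν : ∀ p, 2 ≤ ν p) (hf : ∀ y : ℝ, {m : Multiset P | (nm ν m : ℝ) ≤ y}.Finite) {ρ : ℝ} (hρ : 0 < ρ)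
    (h : Tendsto (fun y : ℝ => ({m : Multiset P | (nm ν m : ℝ) ≤ y}.ncard : ℝ) / y) atTop (𝓝 ρ)) (S : Finset P) :
    ∃ ρ' > 0, Tendsto (fun y : ℝ => ({m : Multiset P | (nm ν m : ℝ) ≤ y ∧ ∀ p ∈ S, p ∉ m}.ncard : ℝ) / y) atTop (𝓝 ρ') := by
  induction S using Finset.induction with
  | empty => exact ⟨ρ, hρ, by simpa using h⟩
  | insert p S hp ih =>
    obtain ⟨ρ', hρ', h'⟩ := ih
    have hp2 : (2 : ℝ) ≤ ν p := by exact_mod_cast hν p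
    have hp0 : (0 : ℝ) < ν p := by linarith
    refine ⟨ρ' - ρ' * (ν p : ℝ)⁻¹, ?_, ?_⟩
    · have : (ν p : ℝ)⁻¹ < 1 := inv_lt_one_of_one_lt₀ (by linarith)
      nlinarith
    have key : ∀ y : ℝ, {m : Multiset P | (nm ν m : ℝ) ≤ y ∧ ∀ q ∈ S, q ∉ m}.ncard =
        {m : Multiset P | (nm ν m : ℝ) ≤ y ∧ ∀ q ∈ insert p S, q ∉ m}.ncard +
        {m : Multiset P | (nm ν m : ℝ) ≤ y / ν p ∧ ∀ q ∈ S, q ∉ m}.ncard := by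
      intro y
      have inj : Function.Injective (fun m : Multiset P => p ::ₘ m) := fun a b hab => (Multiset.cons_inj_right p).1 hab
      rw [← Set.ncard_image_of_injective {m : Multiset P | (nm ν m : ℝ) ≤ y / ν p ∧ ∀ q ∈ S, q ∉ m} inj]
      rw [← Set.ncard_union_eq ?_ ((hf y).subset (fun m hm => hm.1)) (((hf (y / ν p)).subset (fun m hm => hm.1)).image _)]
      · congr 1
        ext m
        simp only [Set.mem_setOf_eq, Set.mem_union, Set.mem_image, Finset.mem_insert, forall_eq_or_imp]
        constructor
        · rintro ⟨h1, h2⟩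
          by_cases hm : p ∈ m
          · right
            obtain ⟨n, rfl⟩ := Multiset.exists_cons_of_mem hm
            refine ⟨n, ⟨?_, fun q hq hqn => h2 q hq (Multiset.mem_cons_of_mem hqn)⟩, rfl⟩
            rw [nm_cons] at h1
            rw [le_div_iff₀ hp0]; push_cast at h1; linarith
          · left; exact ⟨h1, hm, h2⟩
        · rintro (⟨h1, h2, h3⟩ | ⟨n, ⟨h1, h2⟩, rfl⟩)
          · exact ⟨h1, h3⟩
          · rw [le_div_iff₀ hp0] at h1
            refine ⟨by rw [nm_cons]; push_cast; linarith, ?_⟩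
            intro q hq hqn
            rcases Multiset.mem_cons.1 hqn with h5 | h5
            · exact hp (h5 ▸ hq)
            · exact h2 q hq h5
      · rw [Set.disjoint_left]
        rintro m ⟨_, h2⟩ ⟨n, _, rfl⟩
        exact h2 p (Finset.mem_insert_self _ _) (Multiset.mem_cons_self _ _)
    have t2 := (h'.comp (tendsto_id.atTop_div_const hp0)).mul_const ((ν p : ℝ)⁻¹)
    refine (h'.sub t2).congr ?_
    intro y
    simp only [Function.comp, id]
    rw [key y]
    push_cast
    have := hp0.ne'
    have g : ∀ c d : ℝ, (c + d) / y - d / (y / ν p) * (ν p : ℝ)⁻¹ = c / y := by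
      intro c d
      have : d / (y / ν p) * (ν p : ℝ)⁻¹ = d / y := by field_simp
      rw [this]; ring
    exact g _ _

lemma no_double (hν : ∀ p, 2 ≤ ν p) (hf : ∀ y : ℝ, {m : Multiset P | (nm ν m : ℝ) ≤ y}.Finite) {ρ : ℝ} (hρ : 0 < ρ)
    (h : Tendsto (fun y : ℝ => ({m : Multiset P | (nm ν m : ℝ) ≤ y}.ncard : ℝ) / y) atTop (𝓝 ρ)) (S : Finset P)
    {P2 : Type*} (ν2 : P2 → ℕ) (hf2 : ∀ y : ℝ, {m : Multiset P2 | (nm ν2 m : ℝ) ≤ y}.Finite) {ρ2 : ℝ}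
    (h2 : Tendsto (fun y : ℝ => ({m : Multiset P2 | (nm ν2 m : ℝ) ≤ y}.ncard : ℝ) / y) atTop (𝓝 ρ2))
    (J : {p // p ∉ S} ⊕ {p // p ∉ S} → P2) (hJ : Function.Injective J)
    (hl : ∀ p, ν2 (J (.inl p)) ≤ ν p.1) (hr : ∀ p, ν2 (J (.inr p)) ≤ ν p.1) : False := by
  obtain ⟨ρ', hρ', h'⟩ := good_density ν hν hf hρ h S
  have e : ∀ y : ℝ, {m : Multiset {p // p ∉ S} | (nm (ν ∘ Subtype.val) m : ℝ) ≤ y}.ncard =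
      {m : Multiset P | (nm ν m : ℝ) ≤ y ∧ ∀ p ∈ S, p ∉ m}.ncard := by
    intro y
    rw [← Set.ncard_image_of_injective _ (Multiset.map_injective (Subtype.val_injective (p := fun p => p ∉ S)))]
    congr 1
    ext m
    simp only [Set.mem_image, Set.mem_setOf_eq]
    constructor
    · rintro ⟨n, hn, rfl⟩
      refine ⟨by rwa [nm_map], fun p hp hpn => ?_⟩
      obtain ⟨q, _, rfl⟩ := Multiset.mem_map.1 hpn
      exact q.2 hp
    · rintro ⟨h1, h2⟩
      lift m to Multiset {p // p ∉ S} using (fun p hp hpS => h2 p hpS hp)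
      exact ⟨m, by rwa [nm_map] at h1, rfl⟩
  refine anal (nm (ν ∘ (Subtype.val : {p // p ∉ S} → P))) (nm ν2) (one_le_nm _ (fun p => hν p.1)) ?_ hf2 hρ'
    (by simpa only [e] using h') h2 (fun p => (p.1.map Sum.inl + p.2.map Sum.inr).map J) ?_ ?_
  · intro y
    apply Set.Finite.of_finite_image _ (Multiset.map_injective (Subtype.val_injective (p := fun p => p ∉ S))).injOn
    refine (hf y).subset ?_
    rintro _ ⟨n, hn, rfl⟩
    change (nm ν _ : ℝ) ≤ y
    rw [nm_map]; exact hn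
  · rintro ⟨a, b⟩ ⟨c, d⟩ hab
    have h3 := Multiset.map_injective hJ hab
    simp only at h3
    have cl : ∀ p, Multiset.count p a = Multiset.count p c := by
      intro p
      have h4 := congrArg (Multiset.count (Sum.inl p)) h3
      rw [Multiset.count_add, Multiset.count_add, Multiset.count_map_eq_count' _ _ Sum.inl_injective,
        Multiset.count_map_eq_count' _ _ Sum.inl_injective, Multiset.count_eq_zero_of_notMem (s := b.map Sum.inr) (by simp),
        Multiset.count_eq_zero_of_notMem (s := d.map Sum.inr) (by simp)] at h4
      exact h4
    have cr : ∀ p, Multiset.count p b = Multiset.count p d := by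
      intro p
      have h4 := congrArg (Multiset.count (Sum.inr p)) h3
      rw [Multiset.count_add, Multiset.count_add, Multiset.count_map_eq_count' _ b Sum.inr_injective,
        Multiset.count_map_eq_count' _ d Sum.inr_injective, Multiset.count_eq_zero_of_notMem (s := a.map Sum.inl) (by simp),
        Multiset.count_eq_zero_of_notMem (s := c.map Sum.inl) (by simp), zero_add, zero_add] at h4
      exact h4
    rw [Multiset.ext.2 cl, Multiset.ext.2 cr]
  · intro a b
    simp only
    rw [Multiset.map_add, nm_add, Multiset.map_map, Multiset.map_map, nm_map, nm_map]
    exact Nat.mul_le_mul (nm_mono hl a) (nm_mono hr b)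
end

section
variable (K : Type*) [Field K] [NumberField K]

noncomputable def nu (p : Pr K) : ℕ := Ideal.absNorm p.asIdeal

lemma nu_two (p : Pr K) : 2 ≤ nu K p := by
  have h0 : Ideal.absNorm p.asIdeal ≠ 0 := by
    rw [Ne, Ideal.absNorm_eq_zero_iff]; exact p.ne_bot
  have h1 : Ideal.absNorm p.asIdeal ≠ 1 := by
    rw [Ne, Ideal.absNorm_eq_one_iff]; exact p.isPrime.ne_top
  unfold nu; omega

noncomputable def mI (m : Multiset (Pr K)) : Ideal (𝓞 K) := (m.map (fun p => p.asIdeal)).prod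

lemma mI_norm (m : Multiset (Pr K)) : Ideal.absNorm (mI K m) = nm (nu K) m := by
  unfold mI nm
  rw [map_multiset_prod, Multiset.map_map]; rfl

lemma mI_inj : Function.Injective (mI K) := by
  intro m n h
  have key : ∀ m : Multiset (Pr K), UniqueFactorizationMonoid.normalizedFactors (mI K m) = m.map (fun p => p.asIdeal) := by
    intro m
    apply UniqueFactorizationMonoid.normalizedFactors_prod_of_prime
    intro I hI
    obtain ⟨p, _, rfl⟩ := Multiset.mem_map.1 hI
    exact p.prime
  have h1 := key m
  rw [h, key n] at h1
  exact Multiset.map_injective (fun a b hab => HeightOneSpectrum.ext hab) h1.symm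

lemma mI_ne (m : Multiset (Pr K)) : mI K m ∈ (Ideal (𝓞 K))⁰ := by
  rw [mem_nonZeroDivisors_iff_ne_zero]
  intro h
  have h1 := mI_norm K m
  rw [h] at h1
  have := one_le_nm (nu K) (nu_two K) m
  simp at h1; omega

lemma mI_surj (I : Ideal (𝓞 K)) (hI : I ≠ 0) : ∃ m, mI K m = I := by
  induction I using UniqueFactorizationMonoid.induction_on_prime with
  | h₁ => exact absurd rfl hI
  | h₂ I hu => exact ⟨0, by rw [isUnit_iff_eq_one.1 hu]; rfl⟩
  | h₃ I p hI0 hp ih =>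
    obtain ⟨m, hm⟩ := ih hI0
    exact ⟨⟨p, Ideal.isPrime_of_prime hp, hp.ne_zero⟩ ::ₘ m, by
      rw [mI, Multiset.map_cons, Multiset.prod_cons, ← hm]; rfl⟩

lemma mI_fin (y : ℝ) : {m : Multiset (Pr K) | (nm (nu K) m : ℝ) ≤ y}.Finite := by
  apply Set.Finite.of_finite_image _ (mI_inj K).injOn
  refine (Ideal.finite_setOfPred_absNorm_le (S := 𝓞 K) ⌊y⌋₊).subset ?_
  rintro _ ⟨m, hm, rfl⟩
  change Ideal.absNorm _ ≤ _
  rw [mI_norm]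
  exact Nat.le_floor hm

lemma mI_lim : ∃ ρ > 0, Tendsto (fun y : ℝ => ({m : Multiset (Pr K) | (nm (nu K) m : ℝ) ≤ y}.ncard : ℝ) / y) atTop (𝓝 ρ) := by
  refine ⟨_, dedekindZeta_residue_pos K, ?_⟩
  rw [dedekindZeta_residue_def]
  refine (Ideal.tendsto_norm_le_div_atTop₀ K).congr ?_
  intro y
  congr 2
  change _ = Nat.card {m : Multiset (Pr K) // (nm (nu K) m : ℝ) ≤ y}
  symm
  refine Nat.card_congr (Equiv.ofBijective (fun m => ⟨⟨mI K m.1, mI_ne K _⟩, by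
    change (Ideal.absNorm (mI K m.1) : ℝ) ≤ y
    rw [mI_norm]; exact m.2⟩) ⟨?_, ?_⟩)
  · rintro ⟨a, ha⟩ ⟨b, hb⟩ hab
    simp only [Subtype.mk.injEq] at hab
    exact Subtype.ext (mI_inj K hab)
  · rintro ⟨⟨I, hI⟩, h⟩
    obtain ⟨m, rfl⟩ := mI_surj K I (mem_nonZeroDivisors_iff_ne_zero.1 hI)
    exact ⟨⟨m, by rw [← mI_norm]; exact h⟩, rfl⟩
end

lemma split_norm {M L : Type*} [Field M] [NumberField M] [Field L] [NumberField L] [Algebra M L] (Q : Quad M L)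
    (w : Pr L) (h : sg Q.s w ≠ w) : nu L w ≤ nu M (un M w) := by
  have h1 : (un M w).asIdeal.map (algebraMap (𝓞 M) (𝓞 L)) ≤ w.asIdeal := Ideal.map_le_iff_le_comap.2 le_rfl
  have h2 : (un M w).asIdeal.map (algebraMap (𝓞 M) (𝓞 L)) ≤ (sg Q.s w).asIdeal := by
    rw [← Q.un_sg w]; exact Ideal.map_le_iff_le_comap.2 le_rfl
  have hc : IsCoprime w.asIdeal (sg Q.s w).asIdeal := by
    rw [Ideal.isCoprime_iff_sup_eq]
    refine (w.isPrime.isMaximal w.ne_bot).coprime_of_ne ((sg Q.s w).isPrime.isMaximal (sg Q.s w).ne_bot) ?_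
    intro hh; exact h (HeightOneSpectrum.ext hh.symm)
  have h3 : w.asIdeal * (sg Q.s w).asIdeal ∣ (un M w).asIdeal.map (algebraMap (𝓞 M) (𝓞 L)) :=
    hc.mul_dvd (Ideal.dvd_iff_le.2 h1) (Ideal.dvd_iff_le.2 h2)
  have h4 := map_dvd (Ideal.absNorm (S := 𝓞 L)) h3
  rw [map_mul, Ideal.absNorm_algebraMap] at h4
  have hfr : Module.finrank (𝓞 M) (𝓞 L) = 2 := by
    rw [← Q.deg]
    exact (Algebra.IsAlgebraic.finrank_of_isFractionRing (𝓞 M) M (𝓞 L) L).symm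
  have h5 : Ideal.absNorm (sg Q.s w).asIdeal = Ideal.absNorm w.asIdeal := by
    have e := Ideal.quotientEquiv (sg Q.s w).asIdeal w.asIdeal (RingOfIntegers.mapRingEquiv (Q.s : L ≃+* L)) (by
      ext a
      refine Iff.trans ?_ (Ideal.mem_map_iff_of_surjective ((RingOfIntegers.mapRingEquiv (Q.s : L ≃+* L)) : 𝓞 L →+* 𝓞 L) (RingEquiv.surjective _)).symm
      constructor
      · intro ha
        obtain ⟨b, rfl⟩ := (RingOfIntegers.mapRingEquiv (Q.s : L ≃+* L)).surjective a
        exact ⟨b, (mem_sg Q.s w b).2 ha, rfl⟩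
      · rintro ⟨b, hb, rfl⟩
        exact (mem_sg Q.s w b).1 hb)
    rw [Ideal.absNorm_apply, Ideal.absNorm_apply, Submodule.cardQuot_apply, Submodule.cardQuot_apply]
    exact Nat.card_congr e.toEquiv
  rw [hfr, h5, ← sq] at h4
  have h6 := Nat.le_of_dvd (by have := nu_two M (un M w); unfold nu at this; positivity) h4
  exact (Nat.pow_le_pow_iff_left (by norm_num)).1 h6

lemma exists_sqrt_ext.{u} {K : Type u} [Field K] [NumberField K] (x : K) (hx : ¬ IsSquare x) :
    ∃ (N : Type u) (_ : Field N) (_ : NumberField N) (_ : Algebra K N) (b : N), b ^ 2 = algebraMap K N x ∧ Module.finrank K N = 2 := by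
  have hirr : Irreducible (Polynomial.X ^ 2 - Polynomial.C x) := by
    rw [Polynomial.irreducible_iff_roots_eq_zero_of_degree_le_three (by rw [Polynomial.natDegree_X_pow_sub_C]) (by rw [Polynomial.natDegree_X_pow_sub_C]; norm_num)]
    rw [Multiset.eq_zero_iff_forall_notMem]
    intro a ha
    rw [Polynomial.mem_roots (Polynomial.X_pow_sub_C_ne_zero (by norm_num) x)] at ha
    simp [sub_eq_zero] at ha
    exact hx ⟨a, by rw [← ha, sq]⟩
  haveI : Fact (Irreducible (Polynomial.X ^ 2 - Polynomial.C x)) := ⟨hirr⟩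
  have hne := Polynomial.X_pow_sub_C_ne_zero (n := 2) (by norm_num) x
  have hfr : Module.finrank K (AdjoinRoot (Polynomial.X ^ 2 - Polynomial.C x)) = 2 := by
    rw [(AdjoinRoot.powerBasis hne).finrank, AdjoinRoot.powerBasis_dim, Polynomial.natDegree_X_pow_sub_C]
  haveI : CharZero (AdjoinRoot (Polynomial.X ^ 2 - Polynomial.C x)) := charZero_of_injective_algebraMap (algebraMap K _).injective
  haveI : FiniteDimensional K (AdjoinRoot (Polynomial.X ^ 2 - Polynomial.C x)) := Module.finite_of_finrank_eq_succ hfr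
  haveI : FiniteDimensional ℚ (AdjoinRoot (Polynomial.X ^ 2 - Polynomial.C x)) := FiniteDimensional.trans ℚ K _
  refine ⟨AdjoinRoot (Polynomial.X ^ 2 - Polynomial.C x), inferInstance, ⟨⟩, inferInstance, AdjoinRoot.root _, ?_, hfr⟩
  have := AdjoinRoot.eval₂_root (Polynomial.X ^ 2 - Polynomial.C x)
  simp [sub_eq_zero] at this
  exact this

theorem exists_inert {K : Type*} [Field K] [NumberField K] (u : Kˣ) (hu : ¬ IsSquare (u : K)) (B : Finset (Pr K)) :
    ∃ w ∉ B, OddP w ∧ ord w u = 0 ∧ ¬ SqMod w (u : K) := by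
  by_contra hcon
  push Not at hcon
  obtain ⟨N, _, _, _, b, hb, hfr⟩ := exists_sqrt_ext (u : K) hu
  obtain ⟨Q⟩ := quad_exists K N hfr
  have hb0 : b ≠ 0 := by rintro rfl; simp at hb; exact u.ne_zero ((map_eq_zero _).1 hb.symm)
  have hsb : Q.S (Units.mk0 b hb0) = - Units.mk0 b hb0 := by
    ext; exact Q.s_sqrt b u hb hu
  have f1 := ord_finite u
  have f2 := ord_finite (Units.mk0 (2 : K) two_ne_zero)
  set S : Finset (Pr K) := B ∪ f1.toFinset ∪ f2.toFinset with hS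
  have hgood : ∀ w : Pr N, un K w ∉ S → sg Q.s w ≠ w := by
    intro w hw
    simp only [hS, Finset.mem_union, Set.Finite.mem_toFinset, not_or, Set.mem_setOf_eq, not_not] at hw
    obtain ⟨⟨h1, h2⟩, h3⟩ := hw
    have ho : OddP (un K w) := (val_eq_one_iff (un K w) (Units.mk0 (2 : K) two_ne_zero)).2 h3
    refine Q.split_of_sq (Units.mk0 b hb0) hsb u hb w ((oddP_map w).2 ho) ?_ (hcon _ h1 ho h2)
    have h4 : (Units.mk0 b hb0) ^ 2 = Quad.i K N u := by ext; exact hb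
    have h5 := congrArg (ord w) h4
    rw [ord_pow, ord_map, h2] at h5
    push_cast at h5; linarith
  choose f hf using un_surj (M := K) (L := N)
  obtain ⟨ρ, hρ, hl⟩ := mI_lim K
  obtain ⟨ρ2, _, hl2⟩ := mI_lim N
  refine no_double (nu K) (nu_two K) (mI_fin K) hρ hl S (nu N) (mI_fin N) hl2
    (Sum.elim (fun p => f p.1) (fun p => sg Q.s (f p.1))) ?_ ?_ ?_
  · rintro (p | p) (q | q) h
    · simp only [Sum.elim_inl] at h
      congr 1; apply Subtype.ext; rw [← hf p.1, h, hf]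
    · simp only [Sum.elim_inl, Sum.elim_inr] at h
      exfalso
      have h1 : p.1 = q.1 := by rw [← hf p.1, h, Q.un_sg, hf]
      rw [h1] at h
      exact hgood (f q.1) (by rw [hf]; exact q.2) h.symm
    · simp only [Sum.elim_inl, Sum.elim_inr] at h
      exfalso
      have h1 : p.1 = q.1 := by rw [← hf q.1, ← h, Q.un_sg, hf]
      rw [h1] at h
      exact hgood (f q.1) (by rw [hf]; exact q.2) h
    · simp only [Sum.elim_inr] at h
      congr 1; apply Subtype.ext; rw [← hf p.1, ← Q.un_sg (f p.1), h, Q.un_sg, hf]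
  · intro p
    simp only [Sum.elim_inl]
    have := split_norm Q (f p.1) (hgood _ (by rw [hf]; exact p.2))
    rwa [hf] at this
  · intro p
    simp only [Sum.elim_inr]
    have := split_norm Q (sg Q.s (f p.1)) (hgood _ (by rw [Q.un_sg, hf]; exact p.2))
    rwa [Q.un_sg, hf] at this

end Sch


set_option linter.all false

namespace Sch
open IsDedekindDomain nonZeroDivisors

section
variable {M L : Type*} [Field M] [NumberField M] [Field L] [NumberField L] [Algebra M L]

lemma Quad.inf_card (Q : Quad M L) (H : ∀ φ : M →+* ℝ, ∃ ψ : L →+* ℝ, ψ.comp (algebraMap M L) = φ) :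
    Fintype.card (InfinitePlace L) = 2 * Fintype.card (InfinitePlace M) := by
  haveI : Algebra.IsQuadraticExtension M L := ⟨Q.deg⟩
  haveI : IsUnramifiedAtInfinitePlaces M L := by
    refine ⟨fun w => ?_⟩
    by_contra hw
    rw [InfinitePlace.not_isUnramified_iff] at hw
    obtain ⟨hc, hr⟩ := hw
    obtain ⟨ψ, hψ⟩ := H (InfinitePlace.embedding_of_isReal hr)
    set w' : InfinitePlace L := InfinitePlace.mk (Complex.ofRealHom.comp ψ) with hw'
    have hre : w'.IsReal := ⟨_, by rw [ComplexEmbedding.isReal_iff]; ext x; simp [ComplexEmbedding.conjugate], rfl⟩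
    have heq : w'.comap (algebraMap M L) = w.comap (algebraMap M L) := by
      rw [hw', InfinitePlace.comap_mk]
      conv_rhs => rw [← InfinitePlace.mk_embedding (w.comap (algebraMap M L))]
      congr 1
      ext x
      rw [← InfinitePlace.embedding_of_isReal_apply hr, ← hψ]; rfl
    obtain ⟨σ, hσ⟩ := InfinitePlace.exists_smul_eq_of_comap_eq heq
    rw [← hσ, InfinitePlace.isComplex_smul_iff] at hc
    exact InfinitePlace.not_isReal_iff_isComplex.2 hc hre
  rw [IsUnramifiedAtInfinitePlaces.card_infinitePlace (k := M) (K := L), Q.deg, mul_comm]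

lemma Quad.inf_pos (Q : Quad M L) (b : L) (x : M) (hb : b ^ 2 = algebraMap M L x) (hx : ∀ φ : M →+* ℝ, 0 < φ x)
    (hns : ¬ IsSquare x) :
    ∀ φ : M →+* ℝ, ∃ ψ : L →+* ℝ, ψ.comp (algebraMap M L) = φ := by
  intro φ
  letI : Algebra M ℂ := (Complex.ofRealHom.comp φ).toAlgebra
  haveI : Algebra.IsQuadraticExtension M L := ⟨Q.deg⟩
  let ψ : L →ₐ[M] ℂ := IsAlgClosed.lift
  have hψ : ∀ y, ψ (algebraMap M L y) = (φ y : ℂ) := fun y => ψ.commutes y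
  have hc : ∀ y, (starRingEnd ℂ) (ψ y) = ψ y := by
    intro y
    obtain ⟨a, c, rfl⟩ := Q.decomp b (by rintro y rfl; exact hns ⟨y, by rw [← map_pow] at hb; rw [← (algebraMap M L).injective hb, sq]⟩) y
    have h1 : ψ b ^ 2 = (φ x : ℂ) := by rw [← map_pow, hb, hψ]
    have h2 : ψ b ^ 2 = ((Real.sqrt (φ x) : ℝ) : ℂ) ^ 2 := by
      rw [h1]; norm_cast; rw [Real.sq_sqrt (hx φ).le]
    have h3 : (starRingEnd ℂ) (ψ b) = ψ b := by
      rcases sq_eq_sq_iff_eq_or_eq_neg.1 h2 with h | h <;> rw [h] <;> simp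
    rw [map_add, map_mul, map_add, map_mul, h3, hψ, hψ]; simp
  have hr : ComplexEmbedding.IsReal (ψ : L →+* ℂ) := by
    rw [ComplexEmbedding.isReal_iff]; ext y; exact hc y
  refine ⟨hr.embedding, ?_⟩
  ext y
  have := ComplexEmbedding.IsReal.coe_embedding_apply hr (algebraMap M L y)
  apply Complex.ofReal_injective
  rw [RingHom.comp_apply, this]; exact hψ y
end

section
variable {K : Type*} [Field K] [NumberField K]

lemma four_units : Nat.card ((𝓞 K ⧸ Ideal.span {(4 : 𝓞 K)})ˣ ⧸ (sq2 (𝓞 K ⧸ Ideal.span {(4 : 𝓞 K)})ˣ).range) ≤ 2 ^ Module.finrank ℚ K := by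
  set R := 𝓞 K ⧸ Ideal.span {(4 : 𝓞 K)}
  haveI : Finite R := Ideal.finiteQuotientOfFreeOfNeBot _ (by simp)
  haveI : Finite (𝓞 K ⧸ Ideal.span {(2 : 𝓞 K)}) := Ideal.finiteQuotientOfFreeOfNeBot _ (by simp)
  have h2 : Nat.card (𝓞 K ⧸ Ideal.span {(2 : 𝓞 K)}) = 2 ^ Module.finrank ℚ K := by
    have := Ideal.absNorm_span_natCast (S := 𝓞 K) 2
    rw [Ideal.absNorm_apply, Submodule.cardQuot_apply, RingOfIntegers.rank] at this
    exact_mod_cast this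
  have h3 : Nat.card (Rˣ ⧸ (sq2 Rˣ).range) = Nat.card (sq2 Rˣ).ker := by
    have e1 := Subgroup.card_mul_index (sq2 Rˣ).range
    have e2 := Subgroup.card_mul_index (sq2 Rˣ).ker
    rw [Subgroup.index_ker] at e2
    have : 0 < Nat.card (sq2 Rˣ).range := Nat.card_pos
    change (sq2 Rˣ).range.index = _
    refine Nat.eq_of_mul_eq_mul_left this ?_
    rw [e1, mul_comm, e2]
  rw [h3, ← h2]
  have key : ∀ t : (sq2 Rˣ).ker, ∃ y : 𝓞 K, ((t : Rˣ) : R) = Ideal.Quotient.mk _ (1 + 2 * y) := by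
    rintro ⟨t, ht⟩
    obtain ⟨z, hz⟩ := Ideal.Quotient.mk_surjective (t : R)
    have h1 : Ideal.Quotient.mk (Ideal.span {(4 : 𝓞 K)}) (z ^ 2) = Ideal.Quotient.mk _ 1 := by
      rw [map_pow, hz, map_one]
      have : t ^ 2 = 1 := ht
      rw [← Units.val_pow_eq_pow_val, this, Units.val_one]
    rw [Ideal.Quotient.eq, Ideal.mem_span_singleton] at h1
    obtain ⟨c, hc⟩ := h1
    have hcK : ((z : K)) ^ 2 - 1 = 4 * c := by
      have := congrArg (algebraMap (𝓞 K) K) hc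
      simpa [map_ofNat] using this
    have hint : IsIntegral ℤ (((z : K) - 1) / 2) := by
      refine isIntegral_trans (R := ℤ) (A := 𝓞 K) _ ?_
      refine ⟨Polynomial.X ^ 2 + (Polynomial.X - Polynomial.C c), ?_, ?_⟩
      · apply Polynomial.monic_X_pow_add
        rw [Polynomial.degree_X_sub_C]; norm_num
      · simp
        linear_combination hcK / 4
    obtain ⟨y, hy⟩ : ∃ y : 𝓞 K, (y : K) = ((z : K) - 1) / 2 := ⟨⟨_, hint⟩, rfl⟩
    refine ⟨y, ?_⟩
    rw [← hz]; congr 1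
    apply RingOfIntegers.ext
    have : algebraMap (𝓞 K) K (1 + 2 * y) = 1 + 2 * (y : K) := by
      rw [map_add, map_mul, map_one, map_ofNat]
    refine Eq.trans ?_ this.symm
    rw [hy]; ring
  choose f hf using key
  refine Nat.card_le_card_of_injective (fun t => Ideal.Quotient.mk (Ideal.span {(2 : 𝓞 K)}) (f t)) ?_
  intro t t' h
  simp only at h
  rw [Ideal.Quotient.eq, Ideal.mem_span_singleton] at h
  apply Subtype.ext; apply Units.ext
  rw [hf, hf, Ideal.Quotient.eq, Ideal.mem_span_singleton]
  obtain ⟨c, hc⟩ := h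
  exact ⟨c, by linear_combination 2 * hc⟩

lemma int_mul (X : Subgroup Kˣ) (Q : Finset (Pr K)) (hX : X ≤ AS (Q : Set (Pr K))) (κ : Pr K → Kˣ)
    (h1 : ∀ q ∈ Q, κ q ∈ X) (h2 : ∀ q ∈ Q, 0 < ord q (κ q)) (h3 : ∀ q ∈ Q, ∀ v, v ≠ q → ord v (κ q) = 0)
    (x : Kˣ) (hx : x ∈ X) : ∃ C ∈ X, ∀ v, 0 ≤ ord v (x * C ^ 2) := by
  have hprod : ∀ v (s : Finset (Pr K)) (n : Pr K → ℕ), ord v (∏ q ∈ s, κ q ^ n q) = ∑ q ∈ s, n q * ord v (κ q) := by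
    intro v s n
    induction s using Finset.induction_on with
    | empty => simp
    | insert a s ha ih => rw [Finset.prod_insert ha, Finset.sum_insert ha, ord_mul, ih, ord_pow]
  refine ⟨∏ q ∈ Q, κ q ^ (ord q x).natAbs, Subgroup.prod_mem _ fun q hq => X.pow_mem (h1 q hq) _, ?_⟩
  intro v
  rw [ord_mul, ord_pow, hprod]
  by_cases hv : v ∈ Q
  · rw [Finset.sum_eq_single v (fun q hq hne => by rw [h3 q hq v hne.symm, mul_zero]) (fun h => absurd hv h)]
    have a1 := h2 v hv
    have a2 : ((ord v x).natAbs : ℤ) ≤ (ord v x).natAbs * ord v (κ v) := by nlinarith [Int.natCast_nonneg (ord v x).natAbs]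
    push_cast at *
    have := neg_abs_le (ord v x)
    have := abs_nonneg (ord v x)
    linarith
  · rw [hX hx v hv, Finset.sum_eq_zero (fun q hq => by rw [h3 q hq v (fun h => hv (h ▸ hq)), mul_zero])]
    simp

lemma prim_lemma (X : Subgroup Kˣ) (Q : Finset (Pr K)) (hX : X ≤ AS (Q : Set (Pr K))) (hodd : ∀ q ∈ Q, OddP q)
    (hk : ∀ q ∈ Q, ∃ x ∈ X, 0 < ord q x ∧ ∀ v, v ≠ q → ord v x = 0)
    (hcard : 2 ^ (2 * Fintype.card (InfinitePlace K)) < (sq2 X).range.index) :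
    ∃ x ∈ X, (∀ y ∈ X, x ≠ y ^ 2) ∧ (∀ φ : K →+* ℝ, 0 < φ (x : K)) ∧
      ∃ a ξ : 𝓞 K, (a : K) = x ∧ (4 : 𝓞 K) ∣ a - ξ ^ 2 := by
  choose! κ hκ1 hκ2 hκ3 using hk
  have hrep : ∀ c : X ⧸ (sq2 X).range, ∃ a : 𝓞 K, ∃ x : X, (a : K) = ((x : Kˣ) : K) ∧ (x : X ⧸ (sq2 X).range) = c := by
    intro c
    obtain ⟨x, rfl⟩ := QuotientGroup.mk_surjective c
    obtain ⟨C, hC, hnn⟩ := int_mul X Q hX κ hκ1 hκ2 hκ3 x x.2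
    obtain ⟨a, ha⟩ := exists_int _ hnn
    refine ⟨a, x * ⟨C, hC⟩ ^ 2, ha, ?_⟩
    rw [QuotientGroup.eq]
    exact ⟨⟨C, hC⟩⁻¹, by simp [sq2]⟩
  choose a x hax hxc using hrep
  have hunit : ∀ c, IsUnit (Ideal.Quotient.mk (Ideal.span {(4 : 𝓞 K)}) (a c)) := by
    intro c
    have htop : Ideal.span {a c} ⊔ Ideal.span {(4 : 𝓞 K)} = ⊤ := by
      by_contra hne
      obtain ⟨P, hP, hle⟩ := Ideal.exists_le_maximal _ hne
      have h4 : (4 : 𝓞 K) ∈ P := hle (Ideal.mem_sup_right (Ideal.mem_span_singleton_self _))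
      have h1 : a c ∈ P := hle (Ideal.mem_sup_left (Ideal.mem_span_singleton_self _))
      have h2 : (2 : 𝓞 K) ∈ P := hP.isPrime.mem_of_pow_mem 2 (by norm_num; exact h4)
      let v : Pr K := ⟨P, hP.isPrime, fun h => by rw [h] at h2; simp at h2⟩
      have h3 : 0 < ord v (x c : Kˣ) := (ord_int_pos_iff v _ _ (hax c)).2 h1
      have hv : v ∈ Q := by
        by_contra hv
        have := hX (x c).2 v hv
        omega
      have h5 := hodd v hv
      have : algebraMap (𝓞 K) K 2 = (2 : K) := map_ofNat _ 2
      unfold OddP at h5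
      rw [← this, HeightOneSpectrum.valuation_of_algebraMap] at h5
      exact absurd h5 (ne_of_lt ((v.intValuation_lt_one_iff_mem _).2 h2))
    rw [Ideal.eq_top_iff_one, Ideal.mem_span_singleton_sup] at htop
    obtain ⟨r, s, hs, hrs⟩ := htop
    refine IsUnit.of_mul_eq_one (Ideal.Quotient.mk _ r) ?_
    rw [mul_comm, ← map_mul, ← map_one (Ideal.Quotient.mk (Ideal.span {(4 : 𝓞 K)})), Ideal.Quotient.eq]
    rw [← hrs]
    simpa using hs
  choose u hu using hunit
  haveI : Finite (𝓞 K ⧸ Ideal.span {(4 : 𝓞 K)}) := Ideal.finiteQuotientOfFreeOfNeBot _ (by simp)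
  let g : X ⧸ (sq2 X).range → ({w : InfinitePlace K // w.IsReal} → Bool) × ((𝓞 K ⧸ Ideal.span {(4 : 𝓞 K)})ˣ ⧸ (sq2 (𝓞 K ⧸ Ideal.span {(4 : 𝓞 K)})ˣ).range) :=
    fun c => (fun w => decide (0 < InfinitePlace.embedding_of_isReal w.2 (a c : K)), (u c : _ ⧸ _))
  have hg : ¬ Function.Injective g := by
    intro hinj
    have h1 := Nat.card_le_card_of_injective g hinj
    rw [Nat.card_prod, Nat.card_fun, Nat.card_eq_fintype_card (α := Bool), Nat.card_eq_fintype_card (α := {w : InfinitePlace K // w.IsReal}), Fintype.card_bool] at h1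
    have h2 := four_units (K := K)
    have h3 := InfinitePlace.card_add_two_mul_card_eq_rank K
    have h4 := InfinitePlace.card_eq_nrRealPlaces_add_nrComplexPlaces K
    have h5 : (sq2 X).range.index ≤ 2 ^ (2 * Fintype.card (InfinitePlace K)) := by
      refine h1.trans ((Nat.mul_le_mul_left _ h2).trans ?_)
      rw [← pow_add]
      apply Nat.pow_le_pow_right (by norm_num)
      change InfinitePlace.nrRealPlaces K + _ ≤ _
      omega
    omega
  simp only [Function.Injective, not_forall] at hg
  obtain ⟨c, c', hcc, hne⟩ := hg
  simp only [g, Prod.mk.injEq] at hcc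
  obtain ⟨hs, hq⟩ := hcc
  refine ⟨x c * x c', X.mul_mem (x c).2 (x c').2, ?_, ?_, ?_⟩
  · intro y hy he
    apply hne
    rw [← hxc c, ← hxc c', QuotientGroup.eq]
    refine ⟨⟨y, hy⟩ * (x c)⁻¹, ?_⟩
    apply Subtype.ext
    simp only [sq2, powMonoidHom_apply]
    push_cast
    rw [mul_pow, ← he]
    ext; push_cast; field_simp
  · intro φ
    have hre : ComplexEmbedding.IsReal (Complex.ofRealHom.comp φ) := by
      rw [ComplexEmbedding.isReal_iff]; ext t; simp [ComplexEmbedding.conjugate]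
    have hw : (InfinitePlace.mk (Complex.ofRealHom.comp φ)).IsReal := ⟨_, hre, rfl⟩
    have he : ∀ t, InfinitePlace.embedding_of_isReal hw t = φ t := by
      intro t
      apply Complex.ofReal_injective
      rw [InfinitePlace.embedding_of_isReal_apply, InfinitePlace.embedding_mk_eq_of_isReal hre]; rfl
    have h1 := congrFun hs ⟨_, hw⟩
    simp only [he, decide_eq_decide] at h1
    rw [hax, hax] at h1
    have n1 : φ ((x c : Kˣ) : K) ≠ 0 := by simp
    have n2 : φ ((x c' : Kˣ) : K) ≠ 0 := by simp
    push_cast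
    rw [map_mul]
    rcases lt_or_gt_of_ne n1 with h | h
    · exact mul_pos_of_neg_of_neg h (lt_of_le_of_ne (not_lt.1 (fun h' => absurd (h1.2 h') (not_lt.2 h.le))) n2)
    · exact mul_pos h (h1.1 h)
  · rw [QuotientGroup.eq] at hq
    obtain ⟨t, ht⟩ := hq
    obtain ⟨z, hz⟩ := Ideal.Quotient.mk_surjective (t : 𝓞 K ⧸ Ideal.span {(4 : 𝓞 K)})
    refine ⟨a c * a c', a c * z, (map_mul (algebraMap (𝓞 K) K) _ _).trans ((congrArg₂ (· * ·) (hax c) (hax c')).trans (by push_cast; rfl)), ?_⟩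
    rw [← Ideal.mem_span_singleton, ← Ideal.Quotient.eq, map_mul, map_pow, map_mul, ← hu, ← hu, hz]
    have : u c' = u c * t ^ 2 := by
      simp only [sq2, powMonoidHom_apply] at ht; rw [ht]; simp
    rw [this]; push_cast; ring
end
end Sch


set_option linter.all false

namespace Sch
open IsDedekindDomain nonZeroDivisors

section
variable {M L : Type*} [Field M] [NumberField M] [Field L] [NumberField L] [Algebra M L]

lemma AS_index (S : Finset (Pr M)) : (sq2 (AS (S : Set (Pr M)))).range.index = 2 ^ (Fintype.card (InfinitePlace M) + S.card) := by
  refine sqIndex_X _ S (fun x hx v _ => mem_AS_empty.1 hx v) le_rfl ?_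
  intro q hq
  obtain ⟨p, hp, hp'⟩ := gen_lemma q
  refine ⟨p, fun v hv => hp' v (fun h => hv (h ▸ hq)), ?_, hp'⟩
  rw [hp]; have := classNumber_pos' (K := M); omega

lemma ord_of_sq {v : Pr M} {x y : Mˣ} (h : x = y ^ 2) (hx : ord v x = 0) : ord v y = 0 := by
  rw [h, ord_pow] at hx; simpa using hx

lemma Quad.exists_R (Q : Quad M L) (hoL : Odd (classNumber L)) (S₀ : Finset (Pr M)) (hS : ∀ w : Pr L, ee M w = 2 ↔ un M w ∈ S₀)
    (hc : S₀.card = 2) (d : Mˣ) (b : Lˣ) (hb : Q.S b = -b) (hbd : b ^ 2 = i M L d) (hd : d ∈ AS (S₀ : Set (Pr M))) :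
    ∀ n ≤ Fintype.card (InfinitePlace M) + 1, ∃ R : Finset (Pr M), R.card = n ∧
      (∀ q ∈ R, OddP q ∧ q ∉ S₀ ∧ ∃ κ : Mˣ, ord q κ = classNumber L ∧ (∀ v, v ≠ q → ord v κ = 0) ∧ ∀ v ∈ S₀, SqMod v (κ : M)) ∧
      ∀ f : Pr M → Prop, ∃ u ∈ AS (S₀ : Set (Pr M)), ∀ q ∈ R, (SqMod q (u : M) ↔ f q) := by
  intro n
  induction n with
  | zero => exact fun _ => ⟨∅, rfl, by simp, fun f => ⟨1, Subgroup.one_mem _, by simp⟩⟩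
  | succ n ih =>
    intro hn
    obtain ⟨R, hRc, hR, hsurj⟩ := ih (by omega)
    obtain ⟨u, huU, huR, hu1, hu2⟩ : ∃ u ∈ AS (S₀ : Set (Pr M)), (∀ q ∈ R, SqMod q (u : M)) ∧
        (∀ y ∈ AS (S₀ : Set (Pr M)), u ≠ y ^ 2) ∧ (∀ y ∈ AS (S₀ : Set (Pr M)), u ≠ d * y ^ 2) := by
      by_contra hcon
      push Not at hcon
      choose uf huf huf' using hsurj
      let g : (R → Bool) × Bool → (AS (S₀ : Set (Pr M))) ⧸ (sq2 (AS (S₀ : Set (Pr M)))).range := fun p =>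
        (((if p.2 then 1 else ⟨d, hd⟩) * ⟨_, huf (fun q => ∃ h : q ∈ R, p.1 ⟨q, h⟩ = true)⟩ : AS (S₀ : Set (Pr M))) : _ ⧸ _)
      have hg : Function.Surjective g := by
        intro c
        obtain ⟨x, rfl⟩ := QuotientGroup.mk_surjective c
        let p1 : R → Bool := fun q => decide (SqMod q.1 ((x : Mˣ) : M))
        set f : Pr M → Prop := (fun q => ∃ h : q ∈ R, p1 ⟨q, h⟩ = true) with hf
        have hz : (uf f)⁻¹ * x ∈ AS (S₀ : Set (Pr M)) := Subgroup.mul_mem _ (Subgroup.inv_mem _ (huf f)) x.2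
        have hzs : ∀ q ∈ R, SqMod q (((uf f)⁻¹ * x : Mˣ) : M) := by
          intro q hq
          have hq0 : q ∉ (S₀ : Set (Pr M)) := (hR q hq).2.1
          have h1 := huf' f q hq
          have h2 : SqMod q ((x : Mˣ) : M) ↔ f q := by simp [hf, p1, hq]
          have h0 : ord q (uf f) = 0 := huf f q hq0
          have h3 := (sqmod_mul_iff q (uf f) x h0 (x.2 q hq0)).2 (h1.trans h2.symm)
          have h4 := (sqmod_mul_sq q (uf f * x) (uf f)⁻¹ (by simp [h0]; exact x.2 q hq0) (by simp [h0])).2 h3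
          convert h4 using 2
          ext; push_cast; field_simp
        by_cases h1 : ∃ y ∈ AS (S₀ : Set (Pr M)), (uf f)⁻¹ * (x : Mˣ) = y ^ 2
        · obtain ⟨y, hy, hy'⟩ := h1
          refine ⟨(p1, true), ?_⟩
          simp only [g, if_true, one_mul]
          rw [QuotientGroup.eq]
          refine ⟨⟨y, hy⟩, ?_⟩
          apply Subtype.ext; simp only [sq2, powMonoidHom_apply]; push_cast; exact hy'.symm
        · push Not at h1
          obtain ⟨y, hy, hy'⟩ := hcon _ hz hzs h1
          refine ⟨(p1, false), ?_⟩
          simp only [g, Bool.false_eq_true, if_false]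
          rw [QuotientGroup.eq]
          refine ⟨⟨y, hy⟩, ?_⟩
          apply Subtype.ext; simp only [sq2, powMonoidHom_apply]; push_cast
          rw [mul_inv_rev, mul_right_comm, hy']; simp [mul_comm]
      have h1 := Nat.card_le_card_of_surjective g hg
      have h2 := AS_index S₀
      rw [Nat.card_prod, Nat.card_fun, Nat.card_eq_fintype_card (α := Bool), Nat.card_eq_fintype_card (α := R), Fintype.card_bool,
        Fintype.card_coe, hRc, ← pow_succ] at h1
      change (sq2 (AS (S₀ : Set (Pr M)))).range.index ≤ _ at h1
      rw [h2, hc] at h1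
      have := (Nat.pow_le_pow_iff_right (by norm_num : 1 < 2)).1 h1
      omega
    have hns : ¬ IsSquare ((i M L u : Lˣ) : L) := by
      rintro ⟨c, hcc⟩
      have hc0 : c ≠ 0 := by rintro rfl; simp at hcc
      obtain ⟨C, rfl⟩ : ∃ C : Lˣ, (C : L) = c := ⟨Units.mk0 c hc0, rfl⟩
      have hC : i M L u = C ^ 2 := by ext; rw [hcc]; push_cast; ring
      have h2 : Q.s (C : L) ^ 2 = (C : L) ^ 2 := by
        have := congrArg Q.S hC
        rw [Q.S_i, map_pow, hC] at this
        exact (congrArg Units.val this).symm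
      rcases sq_eq_sq_iff_eq_or_eq_neg.1 h2 with h | h
      · obtain ⟨y, rfl⟩ := Q.fixU C (Units.ext h)
        rw [← map_pow] at hC
        have := i_inj hC
        exact hu1 y (fun v hv => ord_of_sq this (huU v hv)) this
      · have h3 : Q.S (C / b) = C / b := by
          rw [map_div, hb, show Q.S C = - C from Units.ext h]; ext; push_cast; rw [neg_div_neg_eq]
        obtain ⟨y, hy⟩ := Q.fixU _ h3
        have : u = d * y ^ 2 := by
          apply i_inj (L := L)
          rw [map_mul, map_pow, hy, ← hbd, hC, ← mul_pow]; simp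
        refine hu2 y (fun v hv => ?_) this
        have h4 := huU v hv
        rw [this, ord_mul, ord_pow, hd v hv] at h4; simpa using h4
    obtain ⟨B, hB⟩ : ∃ B : Finset (Pr L), ∀ w, un M w ∈ R ∪ S₀ → w ∈ B := by
      choose f hf using un_surj (M := M) (L := L)
      refine ⟨(R ∪ S₀).image f ∪ (R ∪ S₀).image (fun v => sg Q.s (f v)), fun w hw => ?_⟩
      rw [Finset.mem_union, Finset.mem_image, Finset.mem_image]
      rcases Q.same_un (f (un M w)) w (hf _) with h | h
      · exact Or.inl ⟨_, hw, h.symm⟩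
      · exact Or.inr ⟨_, hw, h.symm⟩
    obtain ⟨w, hwB, hwo, hw0, hwn⟩ := exists_inert (i M L u) hns B
    set q := un M w with hq
    have hqRS : q ∉ R ∪ S₀ := fun h => hwB (hB w h)
    rw [Finset.mem_union, not_or] at hqRS
    obtain ⟨hqR, hqS⟩ := hqRS
    have hqo : OddP q := (oddP_map w).1 hwo
    have hqu : ord q u = 0 := huU q hqS
    have hqd : ord q d = 0 := hd q hqS
    have hwb : ord w b = 0 := by
      have := congrArg (ord w) hbd
      rw [ord_map, ord_pow, ← hq, hqd] at this; simpa using this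
    have hun : ¬ SqMod q (u : M) := fun h => hwn (sqmod_map w _ h)
    have hds : SqMod q (d : M) := by
      by_contra hdn
      apply hwn
      have h1 := (sqmod_mul_iff q u d hqu hqd).2 (iff_of_false hun hdn)
      have h2 := sqmod_map w _ h1
      rw [← sqmod_mul_sq w _ b hw0 hwb, hbd]
      exact (by simpa using h2)
    have hsplit : sg Q.s w ≠ w := Q.split_of_sq b hb d (by simpa using congrArg Units.val hbd) w hwo hwb hds
    obtain ⟨A, hA, hA'⟩ := gen_lemma w
    have hcl := classNumber_pos' (K := L)
    have hee1 : ee M w = 1 := Q.ee_split w hsplit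
    have hordN : ∀ w' : Pr L, (ee M w' : ℤ) * ord (un M w') (N M L A) = ord w' A + ord (sg Q.s w') A := by
      intro w'
      rw [← ord_map, Q.i_N, ord_mul, Q.ord_sg]
    refine ⟨insert q R, by rw [Finset.card_insert_of_notMem hqR, hRc], ?_, ?_⟩
    · intro q' hq'
      rcases Finset.mem_insert.1 hq' with rfl | hq'
      · refine ⟨hqo, hqS, N M L A, ?_, ?_, ?_⟩
        · have := hordN w
          rw [hee1, hA, hA' _ hsplit] at this
          rw [← hq] at this; push_cast at this; linarith
        · intro v hv
          obtain ⟨w', rfl⟩ := un_surj (L := L) v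
          have h1 : w' ≠ w := fun h => hv (by rw [h])
          have h2 : sg Q.s w' ≠ w := fun h => hv (by rw [← Q.un_sg w', h])
          have := hordN w'
          rw [hA' _ h1, hA' _ h2] at this
          have hp := ee_pos M w'
          rcases mul_eq_zero.1 (this.trans (add_zero 0)) with h | h
          · exfalso; norm_cast at h; omega
          · exact h
        · intro v hv
          obtain ⟨w', rfl⟩ := un_surj (L := L) v
          refine Q.ram_norm w' ((hS w').2 hv) A (hA' _ ?_)
          rintro rfl; exact hqS hv
      · exact hR q' hq'
    · intro f
      obtain ⟨u₁, hu₁, hu₁'⟩ := hsurj f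
      by_cases hcase : SqMod q (u₁ : M) ↔ f q
      · refine ⟨u₁, hu₁, fun q' hq' => ?_⟩
        rcases Finset.mem_insert.1 hq' with rfl | hq'
        · exact hcase
        · exact hu₁' q' hq'
      · refine ⟨u₁ * u, Subgroup.mul_mem _ hu₁ huU, fun q' hq' => ?_⟩
        rcases Finset.mem_insert.1 hq' with rfl | hq'
        · rw [sqmod_mul_iff q u₁ u (hu₁ q hqS) hqu]; tauto
        · have hq0 := (hR q' hq').2.1
          rw [sqmod_mul_iff q' u₁ u (hu₁ q' hq0) (huU q' hq0), ← hu₁' q' hq']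
          have := huR q' hq'
          tauto

theorem Quad.lemX (Q : Quad M L) (ho : Odd (classNumber M)) (hoL : Odd (classNumber L)) (S₀ : Finset (Pr M))
    (hS : ∀ w : Pr L, ee M w = 2 ↔ un M w ∈ S₀)
    (hc : S₀.card = 2) (d : Mˣ) (b : Lˣ) (hb : Q.S b = -b) (hbd : b ^ 2 = i M L d) (hd : d ∈ AS (S₀ : Set (Pr M)))
    (hSo : ∀ v ∈ S₀, OddP v)
    (hE : ∀ v ∈ S₀, ∀ e ∈ AS (∅ : Set (Pr M)), SqMod v (e : M)) : False := by
  obtain ⟨R, hRc, hR, hsurj⟩ := Q.exists_R hoL S₀ hS hc d b hb hbd hd _ le_rfl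
  set X : Subgroup Mˣ := AS (R : Set (Pr M)) ⊓ ⨅ v : S₀, SQ v.1 with hX
  have memX : ∀ x, x ∈ X ↔ x ∈ AS (R : Set (Pr M)) ∧ ∀ v ∈ S₀, SqMod v (x : M) := by
    intro x
    rw [hX, Subgroup.mem_inf, Subgroup.mem_iInf]
    constructor
    · rintro ⟨h1, h2⟩; exact ⟨h1, fun v hv => (mem_SQ.1 (h2 ⟨v, hv⟩)).2⟩
    · rintro ⟨h1, h2⟩; exact ⟨h1, fun v => mem_SQ.2 ⟨h1 v (fun h => (hR v h).2.1 v.2), h2 v v.2⟩⟩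
  have hXle : X ≤ AS (R : Set (Pr M)) := inf_le_left
  have hg := classNumber_pos' (K := L)
  have hκ' : ∀ q ∈ R, ∃ x ∈ X, ord q x = classNumber L ∧ ∀ v, v ≠ q → ord v x = 0 := by
    intro q hq
    obtain ⟨_, _, κ, h1, h2, h3⟩ := hR q hq
    exact ⟨κ, (memX κ).2 ⟨fun v hv => h2 v (fun h => hv (h ▸ hq)), h3⟩, h1, h2⟩
  have hκ : ∀ q ∈ R, ∃ x ∈ X, 0 < ord q x ∧ ∀ v, v ≠ q → ord v x = 0 := by
    intro q hq
    obtain ⟨x, h1, h2, h3⟩ := hκ' q hq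
    exact ⟨x, h1, by rw [h2]; exact_mod_cast hg, h3⟩
  have hEX : AS (∅ : Set (Pr M)) ≤ X := fun x hx => (memX x).2 ⟨fun v _ => mem_AS_empty.1 hx v, fun v hv => hE v hv x hx⟩
  have hidx := sqIndex_X X R hEX hXle
    (fun q hq => by obtain ⟨x, h1, h2, h3⟩ := hκ q hq; exact ⟨x, h1, h2.ne', h3⟩)
  obtain ⟨x, hxX, hxns, hpos, a, ξ, hax, h4⟩ := prim_lemma X R hXle (fun q hq => (hR q hq).1) hκ (by
    rw [hidx, hRc]; exact Nat.pow_lt_pow_right (by norm_num) (by omega))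
  have hsq : ¬ IsSquare (x : M) := by
    rintro ⟨y, hy⟩
    have hy0 : y ≠ 0 := by rintro rfl; simp at hy
    set Y : Mˣ := Units.mk0 y hy0
    have hY : x = Y ^ 2 := by ext; rw [hy, pow_two]; rfl
    have h1 : Y ∈ AS (R : Set (Pr M)) := fun v hv => ord_of_sq hY (hXle hxX v hv)
    choose! κ k1 k2 k3 using hκ'
    have hprod : ∀ v (s : Finset (Pr M)) (n : Pr M → ℤ), ord v (∏ q ∈ s, κ q ^ n q) = ∑ q ∈ s, n q * ord v (κ q) := by
      intro v s n
      induction s using Finset.induction_on with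
      | empty => simp
      | insert a s ha ih => rw [Finset.prod_insert ha, Finset.sum_insert ha, ord_mul, ih, ord_zpow]
    set C := ∏ q ∈ R, κ q ^ ord q Y with hC
    have hCX : C ∈ X := Subgroup.prod_mem _ fun q hq => X.zpow_mem (k1 q hq) _
    have hu : Y ^ classNumber L / C ∈ AS (∅ : Set (Pr M)) := by
      rw [mem_AS_empty]; intro v
      rw [ord_div, ord_pow, hC, hprod]
      by_cases hv : v ∈ R
      · rw [Finset.sum_eq_single v (fun q hq hne => by rw [k3 q hq v hne.symm, mul_zero]) (fun h => absurd hv h), k2 v hv]; ring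
      · rw [h1 v hv, Finset.sum_eq_zero (fun q hq => by rw [k3 q hq v (fun h => hv (h ▸ hq)), mul_zero])]; simp
    have hYg : Y ^ classNumber L ∈ X := by
      have := X.mul_mem (hEX hu) hCX
      rwa [div_mul_cancel] at this
    obtain ⟨n, hn⟩ := hoL
    refine hxns Y ?_ hY
    have : Y = Y ^ classNumber L / (x ^ n) := by rw [hn, hY, ← pow_mul, pow_succ]; simp
    rw [this]
    exact X.div_mem hYg (X.pow_mem hxX n)
  obtain ⟨B, _, _, _, β, hβ, hfr⟩ := exists_sqrt_ext (x : M) hsq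
  obtain ⟨P⟩ := quad_exists M B hfr
  have hβ0 : β ≠ 0 := by rintro rfl; simp at hβ; exact x.ne_zero ((map_eq_zero _).1 hβ.symm)
  set bb : Bˣ := Units.mk0 β hβ0
  have hbb : P.S bb = -bb := by ext; exact P.s_sqrt β x hβ hsq
  have hbx : bb ^ 2 = i M B x := by ext; exact hβ
  have hordb : ∀ w : Pr B, ord (un M w) x = 0 → ord w bb = 0 := by
    intro w hw
    have := congrArg (ord w) hbx
    rw [ord_map, ord_pow, hw] at this; simpa using this
  have hunr : ∀ w : Pr B, Even (ord (un M w) x) → ee M w = 1 := by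
    intro w hw
    by_cases hod : OddP w
    · exact P.kummer_odd bb hbb x hbx w hod hw
    · have h0 : ord (un M w) x = 0 := by
        by_contra hne
        apply hod
        rw [oddP_map (M := M)]
        by_contra hno
        exact hne (hXle hxX _ (fun h => hno (hR _ h).1))
      refine P.kummer_prim bb hbb x ξ hβ w ?_ ?_ (hordb w h0)
      · obtain ⟨c, hc⟩ := h4
        have : ((x : M) - (ξ : M) ^ 2) / 4 = (c : M) := by
          rw [← hax]
          have := congrArg (algebraMap (𝓞 M) M) hc
          rw [map_sub, map_mul, map_pow, map_ofNat] at this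
          rw [this]; field_simp
        rw [this]; exact HeightOneSpectrum.valuation_le_one _ _
      · exact HeightOneSpectrum.valuation_le_one _ _
  have hram : ∀ w : Pr B, ee M w = 2 → un M w ∈ R := by
    intro w hw
    by_contra h
    have h0 : ord (un M w) x = 0 := hXle hxX _ h
    have := hunr w (by rw [h0]; simp)
    omega
  obtain ⟨T, hT⟩ : ∃ T : Finset (Pr B), ∀ w, w ∈ T ↔ ee M w = 2 := by
    choose f hf using un_surj (M := M) (L := B)
    have hfin : Set.Finite {w : Pr B | ee M w = 2} := by
      refine Set.Finite.subset (R.image f ∪ R.image (fun v => sg P.s (f v))).finite_toSet (fun w hw => ?_)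
      rw [Finset.mem_coe, Finset.mem_union, Finset.mem_image, Finset.mem_image]
      rcases P.same_un (f (un M w)) w (hf _) with h | h
      · exact Or.inl ⟨_, hram w hw, h.symm⟩
      · exact Or.inr ⟨_, hram w hw, h.symm⟩
    exact ⟨hfin.toFinset, fun w => by simp⟩
  refine P.no_surj ho (P.inf_card (P.inf_pos β x hβ hpos hsq)) S₀ ?_ T hT ?_
  · intro w hw
    have h0 : ord (un M w) x = 0 := hXle hxX _ (fun h => (hR _ h).2.1 hw)
    exact P.split_of_sq bb hbb x hβ w ((oddP_map w).2 (hSo _ hw)) (hordb w h0) (((memX x).1 hxX).2 _ hw)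
  · intro f
    obtain ⟨u, hu, hu'⟩ := hsurj f
    exact ⟨u, hu, fun w hw => hu' _ (hram w ((hT w).1 hw))⟩
end
end Sch


set_option linter.all false

namespace Sch
open IsDedekindDomain nonZeroDivisors

section
variable {M L : Type*} [Field M] [NumberField M] [Field L] [NumberField L] [Algebra M L]

lemma Quad.unram_t (Q : Quad M L) (w : Pr L) (h : ee M w = 1) : ∃ t : 𝓞 L, w.valuation L (Q.s (t : L) - t) = 1 := by
  haveI : Algebra.IsQuadraticExtension M L := ⟨Q.deg⟩
  haveI := un_lo (M := M) w
  haveI := (un M w).isPrime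
  haveI := w.isPrime
  haveI := fin_quot (un M w)
  have h1 := Ideal.card_inertia_eq_ramificationIdxIn (G := L ≃ₐ[M] L) (un M w).asIdeal w.asIdeal
  rw [Ideal.ramificationIdxIn_eq_ramificationIdx (un M w).asIdeal w.asIdeal (L ≃ₐ[M] L)] at h1
  have h2 : w.asIdeal.ramificationIdx (𝓞 M) = 1 := by
    rw [← h]; unfold ee
    rw [Ideal.ramificationIdx'_eq_ramificationIdx]
    exact (un M w).ne_bot
  rw [h2] at h1
  have h3 : Q.s ∉ w.asIdeal.inertia (L ≃ₐ[M] L) := by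
    intro hs
    have h4 := Subgroup.eq_bot_of_card_eq _ h1
    rw [h4, Subgroup.mem_bot] at hs
    exact Q.ne hs
  rw [AddSubgroup.mem_inertia] at h3
  push Not at h3
  obtain ⟨t, ht⟩ := h3
  refine ⟨t, ?_⟩
  have h5 : algebraMap (𝓞 L) L (Q.s • t - t) = Q.s (t : L) - t := by
    rw [map_sub]; rfl
  rw [← h5]
  refine le_antisymm (w.valuation_le_one _) (not_lt.1 fun hlt => ht ?_)
  rw [HeightOneSpectrum.valuation_of_algebraMap] at hlt
  exact (w.intValuation_lt_one_iff_mem _).1 hlt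
end
end Sch


set_option linter.all false

namespace Sch
open IsDedekindDomain nonZeroDivisors

section
variable {M L : Type*} [Field M] [NumberField M] [Field L] [NumberField L] [Algebra M L]

/-- totally positive and a square modulo four -/
def Prim (c : Mˣ) : Prop := (∀ φ : M →+* ℝ, 0 < φ (c : M)) ∧ ∃ ξ m : 𝓞 M, (c : M) = (ξ : M) ^ 2 + 4 * (m : M)

lemma Prim.one : Prim (1 : Mˣ) := ⟨fun φ => by simp, 1, 0, by simp⟩

lemma Prim.mul {a b : Mˣ} (ha : Prim a) (hb : Prim b) : Prim (a * b) := by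
  obtain ⟨h1, ξ, m, h2⟩ := ha
  obtain ⟨h3, η, n, h4⟩ := hb
  refine ⟨fun φ => ?_, ξ * η, ξ ^ 2 * n + η ^ 2 * m + 4 * m * n, ?_⟩
  · rw [Units.val_mul, map_mul]; exact mul_pos (h1 φ) (h3 φ)
  · rw [Units.val_mul, h2, h4]; push_cast
    have h4' : (((4 : 𝓞 M) : 𝓞 M) : M) = 4 := map_ofNat (algebraMap (𝓞 M) M) 4
    first | (rw [h4']; ring) | (simp only [map_ofNat]; ring) | (erw [h4']; ring)

lemma Prim.map {a : Mˣ} (ha : Prim a) : Prim (Quad.i M L a) := by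
  obtain ⟨h1, ξ, m, h2⟩ := ha
  refine ⟨fun φ => h1 (φ.comp (algebraMap M L)), algebraMap (𝓞 M) (𝓞 L) ξ, algebraMap (𝓞 M) (𝓞 L) m, ?_⟩
  have h3 : ((Quad.i M L a : Lˣ) : L) = algebraMap M L (a : M) := rfl
  rw [h3, h2, map_add, map_mul, map_pow, map_ofNat]
  rfl

lemma Quad.unram_of_prim (Q : Quad M L) (b : Lˣ) (hb : Q.S b = -b) (x : Mˣ) (hx : b ^ 2 = Quad.i M L x)
    (hp : Prim x) (w : Pr L) (he : Even (ord (un M w) x)) (h2 : ¬ OddP (un M w) → ord (un M w) x = 0) : ee M w = 1 := by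
  by_cases ho : OddP (un M w)
  · exact Q.kummer_odd b hb x hx w ((oddP_map w).2 ho) he
  · obtain ⟨_, ξ, m, h⟩ := hp
    have hx' : (b : L) ^ 2 = algebraMap M L (x : M) := by
      have := congrArg Units.val hx
      rw [Units.val_pow_eq_pow_val] at this; exact this
    refine Q.kummer_prim b hb x ξ hx' w ?_ ((un M w).valuation_le_one ξ) ?_
    · have : ((x : M) - (ξ : M) ^ 2) / 4 = (m : M) := by rw [h]; field_simp; ring
      rw [this]; exact (un M w).valuation_le_one m
    · have h3 := ord_map (M := M) w x
      rw [h2 ho, ← hx, ord_pow] at h3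
      simp at h3; omega

lemma Quad.unit_sq (Q : Quad M L) (ho : Odd (classNumber M)) (H : ∀ φ : M →+* ℝ, ∃ ψ : L →+* ℝ, ψ.comp (algebraMap M L) = φ)
    (hun : ∀ w : Pr L, ¬ OddP (un M w) → ee M w = 1) (d : Lˣ) (hd : Q.S d = -d) (e c : Mˣ) (hec : d ^ 2 = Quad.i M L (e * c))
    (he : e ∈ AS (∅ : Set (Pr M))) (hc : Prim c) (hc2 : ∀ v, ¬ OddP v → ord v c = 0) : ∃ f : Mˣ, e = f ^ 2 := by
  by_contra hne
  have hns : ¬ IsSquare (e : M) := by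
    rintro ⟨f, hf⟩
    have hf0 : f ≠ 0 := by rintro rfl; simp at hf
    exact hne ⟨Units.mk0 f hf0, by ext; push_cast; rw [hf, sq]; rfl⟩
  rw [mem_AS_empty] at he
  have hd' : (d : L) ^ 2 = algebraMap M L ((e : M) * c) := by
    have := congrArg Units.val hec
    rw [Units.val_pow_eq_pow_val] at this; exact this
  obtain ⟨N, _, _, _, b, hb, hdeg⟩ := exists_sqrt_ext (e : M) hns
  obtain ⟨QN⟩ := quad_exists M N hdeg
  have hpos : ∀ φ : M →+* ℝ, 0 < φ (e : M) := by
    intro φ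
    obtain ⟨ψ, hψ⟩ := H φ
    have h1 : ψ (d : L) ^ 2 = φ (e : M) * φ (c : M) := by
      rw [← map_pow, hd', ← hψ, ← map_mul]; rfl
    have h2 := hc.1 φ
    have h3 : ψ (d : L) ≠ 0 := by simp
    have h4 : 0 < φ (e : M) * φ (c : M) := by rw [← h1]; positivity
    exact pos_of_mul_pos_left h4 h2.le
  have hb0 : b ≠ 0 := by rintro rfl; rw [zero_pow two_ne_zero] at hb; exact e.ne_zero ((map_eq_zero _).1 hb.symm)
  have hsb := QN.s_sqrt b e hb hns
  refine QN.unram_even (QN.inf_card (QN.inf_pos b e hb hpos hns)) (fun w' => ?_) ho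
  set v := un M w' with hv
  by_cases hodd : OddP v
  · refine QN.kummer_odd (Units.mk0 b hb0) (by ext; exact hsb) e (by ext; exact hb) w' ((oddP_map w').2 hodd) ?_
    rw [← hv, he v]; simp
  · obtain ⟨w, hw⟩ := un_surj (L := L) v
    obtain ⟨t, ht⟩ := Q.unram_t w (hun w (by rw [hw]; exact hodd))
    obtain ⟨_, ξ, m, hcm⟩ := hc
    have hsd : Q.s (d : L) = -d := by
      have := congrArg Units.val hd
      simpa using this
    obtain ⟨y, hy⟩ := Q.fix ((Q.s (t : L) - t) / d) (by rw [map_div₀, map_sub, Q.ss, hsd]; field_simp; ring)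
    have hy' : Q.s (t : L) - t = algebraMap M L y * d := by rw [hy]; field_simp
    have hy0 : y ≠ 0 := by
      rintro rfl
      rw [hy'] at ht; simp at ht
    -- trace and norm
    obtain ⟨T, hT⟩ := Q.fix ((t : L) + Q.s t) (by rw [map_add, Q.ss]; ring)
    have hN := Q.norm_eq (t : L)
    set n := Algebra.norm M (t : L) with hn
    have hst : ∀ w : Pr L, w.valuation L (Q.s (t : L)) ≤ 1 := fun w => w.valuation_le_one (Q.s • t : 𝓞 L)
    have hTv : v.valuation M T ≤ 1 := by
      rw [← hw, ← val_le_map w, hT]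
      exact (Valuation.map_add _ _ _).trans (max_le (w.valuation_le_one t) (hst w))
    have hnv : v.valuation M n ≤ 1 := by
      rw [← hw, ← val_le_map w, hN, map_mul]
      exact mul_le_one' (w.valuation_le_one t) (hst w)
    have hkey : y ^ 2 * ((e : M) * c) = T ^ 2 - 4 * n := by
      apply (algebraMap M L).injective
      rw [map_mul, ← hd', map_pow, ← mul_pow, ← hy', map_sub, map_pow, map_mul, hT, hN, map_ofNat]; ring
    have hcv : v.valuation M (c : M) = 1 := (val_eq_one_iff v c).2 (hc2 v hodd)
    have hdw : w.valuation L (d : L) = 1 := by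
      rw [val_eq_one_iff]
      have h3 := ord_map (M := M) w (e * c)
      rw [hw, ord_mul, he v, hc2 v hodd, ← hec, ord_pow] at h3
      simp at h3; omega
    have hyv : v.valuation M y = 1 := by
      rw [hy', map_mul, hdw, mul_one, val_map, hw] at ht
      exact (pow_eq_one_iff.1 ht).resolve_right (ee_pos M w).ne'
    have hb1 : b * algebraMap M N (y * c) ≠ 0 := mul_ne_zero hb0 (by simp [hy0])
    refine QN.kummer_prim (Units.mk0 _ hb1) ?_ (e * (y * c) ^ 2) (T * ξ) ?_ w' ?_ ?_ ?_
    · ext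
      show QN.s (b * algebraMap M N (y * c)) = -(b * algebraMap M N (y * c))
      rw [map_mul, QN.s_map, hsb]; ring
    · show (b * algebraMap M N (y * c)) ^ 2 = _
      rw [mul_pow, hb, ← map_pow, ← map_mul]
    · rw [← hv]
      have : ((e : M) * (y * c) ^ 2 - (T * (ξ : M)) ^ 2) / 4 = T ^ 2 * (m : M) - n * c := by
        have : (e : M) * (y * c) ^ 2 = (T ^ 2 - 4 * n) * c := by rw [← hkey]; ring
        rw [this, hcm]; field_simp; ring
      rw [this]
      refine (Valuation.map_sub _ _ _).trans (max_le ?_ ?_)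
      · rw [map_mul, map_pow]; exact mul_le_one' (pow_le_one' hTv 2) (v.valuation_le_one m)
      · rw [map_mul, hcv, mul_one]; exact hnv
    · rw [← hv, map_mul]; exact mul_le_one' hTv (v.valuation_le_one ξ)
    · rw [← val_eq_one_iff]
      show w'.valuation N (b * algebraMap M N (y * c)) = 1
      have h5 : w'.valuation N b = 1 := by
        have h6 := val_map w' (e : M)
        rw [← hb, map_pow, ← hv, (val_eq_one_iff v e).2 (he v), one_pow] at h6
        exact (pow_eq_one_iff.1 h6).resolve_right two_ne_zero
      rw [map_mul, h5, one_mul, val_map, ← hv, map_mul, hyv, hcv]; simp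

lemma decomp_S (v₁ v₂ : Pr M) (hne : v₁ ≠ v₂) (ho : Odd (classNumber M)) (p₁ p₂ : Mˣ)
    (h1 : ord v₁ p₁ = classNumber M) (h1' : ∀ v, v ≠ v₁ → ord v p₁ = 0)
    (h2 : ord v₂ p₂ = classNumber M) (h2' : ∀ v, v ≠ v₂ → ord v p₂ = 0) (u : Mˣ) (hu : u ∈ AS ({v₁, v₂} : Set (Pr M))) :
    ∃ e ∈ AS (∅ : Set (Pr M)), ∃ a b : ℕ, a < 2 ∧ b < 2 ∧ ∃ y : Mˣ, u = e * (p₁ ^ a * p₂ ^ b) * y ^ 2 := by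
  obtain ⟨g, hg⟩ := ho
  set α := ord v₁ u
  set β := ord v₂ u
  set e : Mˣ := u ^ (classNumber M) / (p₁ ^ α * p₂ ^ β) with he
  refine ⟨e, ?_, (α % 2).toNat, (β % 2).toNat, by omega, by omega, p₁ ^ (α / 2) * p₂ ^ (β / 2) * (u ^ g)⁻¹, ?_⟩
  · rw [mem_AS_empty]
    intro v
    rw [he, ord_div, ord_mul, ord_pow, ord_zpow, ord_zpow]
    by_cases hv1 : v = v₁
    · subst hv1; rw [h1, h2' _ hne]; ring
    by_cases hv2 : v = v₂
    · subst hv2; rw [h2, h1' _ hv1]; ring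
    rw [h1' v hv1, h2' v hv2, hu v (by simp [hv1, hv2])]; simp
  · have e1 : ∀ (p : Mˣ) (α : ℤ), p ^ α = p ^ (α % 2).toNat * (p ^ (α / 2)) ^ 2 := by
      intro p α
      rw [← zpow_natCast p, ← zpow_natCast (p ^ (α/2)), ← zpow_mul, ← zpow_add]
      congr 1
      have := Int.emod_nonneg α (two_ne_zero)
      rw [Int.toNat_of_nonneg this]; push_cast; omega
    have e2 : u ^ (classNumber M) = e * (p₁ ^ α * p₂ ^ β) := by rw [he]; simp
    rw [e1 p₁ α, e1 p₂ β, hg] at e2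
    have : u = u ^ (2 * g + 1) * ((u ^ g)⁻¹) ^ 2 := by
      rw [pow_succ, pow_mul', inv_pow]; simp [mul_comm]
    conv_lhs => rw [this, e2]
    ext; push_cast; ring

lemma Quad.step1 (Q : Quad M L) (ho : Odd (classNumber M)) (H : ∀ φ : M →+* ℝ, ∃ ψ : L →+* ℝ, ψ.comp (algebraMap M L) = φ)
    (v₁ v₂ : Pr M) (hne : v₁ ≠ v₂) (hr : ∀ w : Pr L, ee M w = 2 ↔ un M w = v₁ ∨ un M w = v₂) (o1 : OddP v₁) (o2 : OddP v₂)
    (p₁ p₂ : Mˣ) (hp1 : Prim p₁) (hp2 : Prim p₂)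
    (h1 : ord v₁ p₁ = classNumber M) (h1' : ∀ v, v ≠ v₁ → ord v p₁ = 0)
    (h2 : ord v₂ p₂ = classNumber M) (h2' : ∀ v, v ≠ v₂ → ord v p₂ = 0) : ∃ d : Lˣ, Q.S d = -d ∧ d ^ 2 = Quad.i M L (p₁ * p₂) := by
  obtain ⟨d₀, hd₀⟩ := Q.exists_anti
  obtain ⟨x, hx, hxn⟩ := Q.anti_sq d₀ hd₀
  have hS : ∀ v ∉ ({v₁, v₂} : Set (Pr M)), Even (ord v x) := by
    intro v hv
    by_contra hod
    rw [Int.not_even_iff_odd] at hod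
    obtain ⟨w, rfl⟩ := un_surj (L := L) v
    exact hv ((hr w).1 (Q.ram_of_odd d₀ x hx.symm w hod))
  obtain ⟨u, hu, z, rfl⟩ := sq_lemma ho _ x hS
  obtain ⟨e, he, a, b, ha, hb, y, rfl⟩ := decomp_S v₁ v₂ hne ho p₁ p₂ h1 h1' h2 h2' u hu
  have anti : ∀ (d : Lˣ) (z : Mˣ), Q.S d = -d → Q.S (d / Quad.i M L z) = -(d / Quad.i M L z) := by
    intro d z hd
    rw [map_div, hd, Q.S_i]; ext; push_cast; ring
  set c := p₁ ^ a * p₂ ^ b with hc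
  have hcP : Prim c := by
    rcases (by omega : a = 0 ∨ a = 1) with rfl | rfl <;> rcases (by omega : b = 0 ∨ b = 1) with rfl | rfl <;>
      simp [hc, Prim.one, hp1, hp2, hp1.mul hp2]
  have hcord : ∀ v, ord v c = a * ord v p₁ + b * ord v p₂ := by intro v; rw [hc, ord_mul, ord_pow, ord_pow]
  have hco : ∀ v, ¬ OddP v → ord v c = 0 := by
    intro v hv
    rw [hcord, h1' v (by rintro rfl; exact hv o1), h2' v (by rintro rfl; exact hv o2)]; simp
  set d₁ := d₀ / Quad.i M L (y * z) with hd₁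
  have hd1 : d₁ ^ 2 = Quad.i M L (e * c) := by
    rw [hd₁, div_pow, ← hx, ← map_pow, ← map_div]; congr 1
    ext; push_cast; field_simp
  obtain ⟨f, rfl⟩ := Q.unit_sq ho H (fun w hw => (Q.ee_le w).resolve_right fun h => hw (by
    rcases (hr w).1 h with h | h <;> rw [h] <;> assumption)) d₁ (anti _ _ hd₀) e c hd1 he hcP hco
  have hd2 : (d₁ / Quad.i M L f) ^ 2 = Quad.i M L c := by
    rw [div_pow, hd1, ← map_pow, ← map_div]; congr 1
    ext; push_cast; field_simp
  have hd2' := anti d₁ f (anti _ _ hd₀)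
  have hab : ∀ v, v = v₁ ∨ v = v₂ → OddP v → ¬ Even (ord v c) := by
    intro v hv hov hev
    obtain ⟨w, rfl⟩ := un_surj (L := L) v
    have := Q.kummer_odd _ hd2' c hd2 w ((oddP_map w).2 hov) hev
    have h3 := (hr w).2 hv
    omega
  have ha1 : a = 1 := by
    by_contra h
    have : a = 0 := by omega
    subst this
    apply hab v₁ (Or.inl rfl) o1
    rw [hcord, h2' _ hne]; simp
  have hb1 : b = 1 := by
    by_contra h
    have : b = 0 := by omega
    subst this
    apply hab v₂ (Or.inr rfl) o2
    rw [hcord, h1' _ hne.symm]; simp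
  refine ⟨_, hd2', ?_⟩
  rw [hd2, hc, ha1, hb1, pow_one, pow_one]
end
end Sch


set_option linter.all false

namespace Sch
open IsDedekindDomain nonZeroDivisors

section
variable {M L : Type*} [Field M] [NumberField M] [Field L] [NumberField L] [Algebra M L]

lemma sqU (x : Mˣ) : IsSquare (x : M) ↔ ∃ f : Mˣ, x = f ^ 2 := by
  constructor
  · rintro ⟨f, hf⟩
    have hf0 : f ≠ 0 := by rintro rfl; simp at hf
    exact ⟨Units.mk0 f hf0, by ext; push_cast; rw [hf, sq]; rfl⟩
  · rintro ⟨f, rfl⟩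
    exact ⟨f, by push_cast; ring⟩

lemma nonsq_of_ord (v : Pr M) (x : Mˣ) (h : Odd (ord v x)) : ¬ IsSquare (x : M) := by
  rw [sqU]; rintro ⟨f, rfl⟩
  rw [ord_pow] at h
  exact (Int.not_even_iff_odd.2 h) (by simp)

lemma Quad.S_sqrt (Q : Quad M L) (b : Lˣ) (x : Mˣ) (h : b ^ 2 = Quad.i M L x) (hx : ¬ IsSquare (x : M)) : Q.S b = -b := by
  ext
  have h' : (b : L) ^ 2 = algebraMap M L (x : M) := by
    have := congrArg Units.val h
    rw [Units.val_pow_eq_pow_val] at this; exact this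
  exact Q.s_sqrt b x h' hx

lemma Quad.nonsq_up (Q : Quad M L) (d : Lˣ) (hd : Q.S d = -d) (x y : Mˣ) (h : d ^ 2 = Quad.i M L (x * y))
    (hx : ¬ IsSquare (x : M)) (hy : ¬ IsSquare (y : M)) : ¬ IsSquare (Quad.i M L x : L) := by
  rw [sqU]; rintro ⟨f, hf⟩
  have h1 := Q.S_sqrt f x hf.symm hx
  obtain ⟨g, hg⟩ := Q.fixU (f * d) (by rw [map_mul, h1, hd]; ext; push_cast; ring)
  apply hy
  rw [sqU]
  refine ⟨g / x, ?_⟩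
  apply Quad.i_inj (L := L)
  have e1 : Quad.i M L x * (Quad.i M L x * Quad.i M L y) = Quad.i M L g ^ 2 := by
    rw [← map_mul, ← h, hg, hf]; ext; push_cast; ring
  rw [map_pow, map_div, div_pow, ← e1]; ext; push_cast; field_simp

lemma Quad.T_of_S (Q : Quad M L) (S₀ : Finset (Pr M)) (hS : ∀ w : Pr L, ee M w = 2 ↔ un M w ∈ S₀) :
    ∃ T : Finset (Pr L), (∀ w, w ∈ T ↔ ee M w = 2) ∧ T.card = S₀.card := by
  choose f hf using fun v : Pr M => un_surj (L := L) v
  refine ⟨S₀.image f, fun w => ?_, Finset.card_image_of_injective _ fun a b hab => by rw [← hf a, ← hf b, hab]⟩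
  rw [Finset.mem_image, hS]
  constructor
  · rintro ⟨v, hv, rfl⟩; rwa [hf]
  · intro hw
    refine ⟨_, hw, ?_⟩
    have h2 := (hS w).2 hw
    rcases Q.same_un w (f (un M w)) (hf _).symm with h | h
    · exact h
    · rw [h, Q.ram_sg w h2]

lemma Quad.norm_gen (Q : Quad M L) (h1 : ∀ w : Pr L, ee M w = 1) (w : Pr L) :
    ∃ γ : Mˣ, (sg Q.s w ≠ w → ord (un M w) γ = classNumber L) ∧ (sg Q.s w = w → ord (un M w) γ = 2 * classNumber L) ∧
      ∀ v, v ≠ un M w → ord v γ = 0 := by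
  obtain ⟨A, hA, hA'⟩ := gen_lemma w
  have key : ∀ w' : Pr L, ord (un M w') (Quad.N M L A) = ord w' A + ord (sg Q.s w') A := by
    intro w'
    have := ord_map (M := M) w' (Quad.N M L A)
    rw [h1, Q.i_N, ord_mul, ← Q.ord_sg] at this
    push_cast at this; linarith
  refine ⟨Quad.N M L A, fun h => ?_, fun h => ?_, fun v hv => ?_⟩
  · rw [key, hA, hA' _ h, add_zero]
  · rw [key, h, hA]; ring
  · obtain ⟨w', rfl⟩ := un_surj (L := L) v
    rw [key, hA' w' (by rintro rfl; exact hv rfl), hA' _ (by rintro h; apply hv; rw [← h, Q.un_sg]), add_zero]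
end

section
variable {F k K : Type*} [Field F] [NumberField F] [Field k] [NumberField k] [Field K] [NumberField K] [Algebra F k] [Algebra F K]

lemma Quad.embed (Q : Quad F k) (d : kˣ) (hd : Q.S d = -d) (x : Fˣ) (hx : d ^ 2 = Quad.i F k x) (b : K)
    (hb : b ^ 2 = algebraMap F K x) : Nonempty (k →ₐ[F] K) := by
  have hx' : (d : k) ^ 2 = algebraMap F k (x : F) := by
    have := congrArg Units.val hx
    rw [Units.val_pow_eq_pow_val] at this; exact this
  have hsd : Q.s (d : k) = -d := by
    have := congrArg Units.val hd
    simpa using this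
  have hnd : ∀ y : F, algebraMap F k y ≠ d := by
    intro y hy
    have := Q.s_map y
    rw [hy, hsd] at this
    exact d.ne_zero (self_eq_neg.1 this.symm)
  refine IntermediateField.nonempty_algHom_of_adjoin_splits (S := {(d : k)}) ?_ ?_
  · rintro s rfl
    refine ⟨Algebra.IsIntegral.isIntegral _, ?_⟩
    have hdvd : minpoly F (d : k) ∣ Polynomial.X ^ 2 - Polynomial.C (x : F) := minpoly.dvd _ _ (by simp [hx'])
    have h2 := Polynomial.map_dvd (algebraMap F K) hdvd
    refine Polynomial.Splits.of_dvd ?_ ?_ h2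
    · have : Polynomial.map (algebraMap F K) (Polynomial.X ^ 2 - Polynomial.C (x : F)) = (Polynomial.X - Polynomial.C b) * (Polynomial.X - Polynomial.C (-b)) := by
        simp only [Polynomial.map_sub, Polynomial.map_pow, Polynomial.map_X, Polynomial.map_C, ← hb, map_pow, map_neg]; ring
      rw [this]
      exact (Polynomial.Splits.X_sub_C _).mul (Polynomial.Splits.X_sub_C _)
    · exact Polynomial.map_ne_zero (Polynomial.X_pow_sub_C_ne_zero two_pos _)
  · rw [eq_top_iff]
    rintro y -
    obtain ⟨a, c, rfl⟩ := Q.decomp d hnd y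
    refine add_mem (IntermediateField.algebraMap_mem _ _) (mul_mem (IntermediateField.algebraMap_mem _ _) (IntermediateField.mem_adjoin_simple_self F _))
end
end Sch


set_option linter.all false

namespace Sch
open IsDedekindDomain nonZeroDivisors

/-- the data of two primary prime elements -/
structure Two (F : Type*) [Field F] [NumberField F] where
  ho : Odd (classNumber F)
  v₁ : Pr F
  v₂ : Pr F
  hne : v₁ ≠ v₂
  o1 : OddP v₁
  o2 : OddP v₂
  p₁ : Fˣ
  p₂ : Fˣ
  hp1 : Prim p₁
  hp2 : Prim p₂
  h1 : ord v₁ p₁ = classNumber F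
  h1' : ∀ v, v ≠ v₁ → ord v p₁ = 0
  h2 : ord v₂ p₂ = classNumber F
  h2' : ∀ v, v ≠ v₂ → ord v p₂ = 0

section
variable {F k K : Type*} [Field F] [NumberField F] [Field k] [NumberField k] [Field K] [NumberField K] [Algebra F k] [Algebra k K]

lemma Two.ns1 (D : Two F) : ¬ IsSquare (D.p₁ : F) := nonsq_of_ord D.v₁ _ (by rw [D.h1]; exact_mod_cast D.ho)
lemma Two.ns2 (D : Two F) : ¬ IsSquare (D.p₂ : F) := nonsq_of_ord D.v₂ _ (by rw [D.h2]; exact_mod_cast D.ho)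

lemma unram_K (D : Two F) (QK : Quad k K) (b₁ b₂ : Kˣ) (hb1 : b₁ ^ 2 = Quad.i k K (Quad.i F k D.p₁)) (hb2 : b₂ ^ 2 = Quad.i k K (Quad.i F k D.p₂))
    (a1 : QK.S b₁ = -b₁) (a2 : QK.S b₂ = -b₂) (w : Pr K) : ee k w = 1 := by
  by_cases h : un F (un k w) = D.v₁
  · have h0 : ord (un k w) (Quad.i F k D.p₂) = 0 := by rw [ord_map, h, D.h2' _ D.hne, mul_zero]
    exact QK.unram_of_prim b₂ a2 _ hb2 D.hp2.map w (by rw [h0]; simp) fun _ => h0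
  · have h0 : ord (un k w) (Quad.i F k D.p₁) = 0 := by rw [ord_map, D.h1' _ h, mul_zero]
    exact QK.unram_of_prim b₁ a1 _ hb1 D.hp1.map w (by rw [h0]; simp) fun _ => h0

lemma full_k (D : Two F) (Q : Quad F k) (QK : Quad k K) (d : kˣ) (hd : Q.S d = -d) (hdx : d ^ 2 = Quad.i F k (D.p₁ * D.p₂))
    (hr : ∀ w : Pr k, ee F w = 2 ↔ un F w = D.v₁ ∨ un F w = D.v₂) (b₂ : Kˣ) (hb2 : b₂ ^ 2 = Quad.i k K (Quad.i F k D.p₂))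
    (a2 : QK.S b₂ = -b₂) (hu : ∀ w : Pr K, ee k w = 1) (hs : SqMod D.v₁ (D.p₂ : F)) (hoK : Odd (classNumber K))
    (T : Finset (Pr k)) (hT : ∀ w, w ∈ T ↔ ee F w = 2) : Q.Full T := by
  obtain ⟨w₁, hw₁⟩ := un_surj (L := k) D.v₁
  obtain ⟨W, hW⟩ := un_surj (L := K) w₁
  have hr1 : ee F w₁ = 2 := (hr w₁).2 (Or.inl hw₁)
  have hsplit : sg QK.s W ≠ W := by
    have hb2' : (b₂ : K) ^ 2 = algebraMap k K ((Quad.i F k D.p₂ : kˣ) : k) := by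
      have := congrArg Units.val hb2
      rw [Units.val_pow_eq_pow_val] at this; exact this
    refine QK.split_of_sq b₂ a2 _ hb2' W ?_ ?_ ?_
    · rw [oddP_map (M := k), hW, oddP_map (M := F), hw₁]; exact D.o1
    · have := ord_map (M := k) W (Quad.i F k D.p₂)
      rw [← hb2, ord_pow, hW, ord_map, hw₁, D.h2' _ D.hne] at this
      simp at this; omega
    · rw [hW]
      exact sqmod_map (M := F) w₁ _ (by rw [hw₁]; exact hs)
  obtain ⟨γ, g1, _, g3⟩ := QK.norm_gen hu W
  have g1 := g1 hsplit
  rw [hW] at g1 g3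
  have hγ : γ / Q.S γ ∈ AS (∅ : Set (Pr k)) := by
    rw [mem_AS_empty]
    intro v
    rw [ord_div, ← Q.ord_sg]
    by_cases hv : v = w₁
    · subst hv; rw [Q.ram_sg v hr1, sub_self]
    · rw [g3 v hv, g3 (sg Q.s v) (fun h => hv (by rw [← Q.sg_sg v, h, Q.ram_sg w₁ hr1])), sub_self]
  have hdA : d / Q.S d ∈ AS (∅ : Set (Pr k)) := by
    rw [mem_AS_empty]; intro v; rw [hd, ord_div, ord_neg, sub_self]
  have hdo : ∀ w : Pr k, ee F w = 2 → ord w d = classNumber F := by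
    intro w hw
    have := ord_map (M := F) w (D.p₁ * D.p₂)
    rw [← hdx, ord_pow, ord_mul, hw] at this
    push_cast at this
    rcases (hr w).1 hw with h | h
    · rw [h, D.h1, D.h2' _ D.hne] at this; linarith
    · rw [h, D.h2, D.h1' _ D.hne.symm] at this; linarith
  have hdo' : ∀ w : Pr k, ee F w = 2 → ¬ Even (ord w d) := by
    intro w hw; rw [hdo w hw]; rw [Int.not_even_iff_odd]; exact_mod_cast D.ho
  have hγ1 : ¬ Even (ord w₁ γ) := by rw [g1, Int.not_even_iff_odd]; exact_mod_cast hoK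
  obtain ⟨w₂, hw₂⟩ := un_surj (L := k) D.v₂
  have hr2 : ee F w₂ = 2 := (hr w₂).2 (Or.inr hw₂)
  have h21 : w₂ ≠ w₁ := by rintro rfl; exact D.hne (hw₁.symm.trans hw₂)
  have hγ2 : Even (ord w₂ γ) := by rw [g3 w₂ h21]; simp
  have hTT : ∀ w ∈ T, w = w₁ ∨ w = w₂ := by
    intro w hw
    rcases (hr w).1 ((hT w).1 hw) with h | h
    · left; rcases Q.same_un w₁ w (hw₁.trans h.symm) with h' | h'
      · exact h'
      · rw [h', Q.ram_sg w₁ hr1]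
    · right; rcases Q.same_un w₂ w (hw₂.trans h.symm) with h' | h'
      · exact h'
      · rw [h', Q.ram_sg w₂ hr2]
  have mk : ∀ (f : Pr k → Prop) (γ : kˣ), γ / Q.S γ ∈ AS (∅ : Set (Pr k)) → (Even (ord w₁ γ) ↔ f w₁) → (Even (ord w₂ γ) ↔ f w₂) →
      ∃ γ : kˣ, γ / Q.S γ ∈ AS (∅ : Set (Pr k)) ∧ ∀ w ∈ T, (Even (ord w γ) ↔ f w) := by
    intro f γ h h1 h2
    refine ⟨γ, h, fun w hw => ?_⟩
    rcases hTT w hw with rfl | rfl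
    · exact h1
    · exact h2
  have e1 := hdo' w₁ hr1
  have e2 := hdo' w₂ hr2
  intro f
  by_cases f1 : f w₁ <;> by_cases f2 : f w₂
  · exact mk f 1 (by simp [one_mem]) (by simp [f1]) (by simp [f2])
  · refine mk f (d * γ) ?_ ?_ ?_
    · have := mul_mem hdA hγ
      rwa [div_mul_div_comm, ← map_mul] at this
    · rw [ord_mul, Int.even_add]; tauto
    · rw [ord_mul, Int.even_add]; tauto
  · exact mk f γ hγ (by tauto) (by tauto)
  · exact mk f d hdA (by tauto) (by tauto)

lemma caseK (D : Two F) (Q : Quad F k) (QK : Quad k K) (H : ∀ φ : F →+* ℝ, ∃ ψ : k →+* ℝ, ψ.comp (algebraMap F k) = φ)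
    (d : kˣ) (hd : Q.S d = -d) (hdx : d ^ 2 = Quad.i F k (D.p₁ * D.p₂))
    (hr : ∀ w : Pr k, ee F w = 2 ↔ un F w = D.v₁ ∨ un F w = D.v₂) (hs : SqMod D.v₁ (D.p₂ : F))
    (b₁ b₂ : Kˣ) (hb1 : b₁ ^ 2 = Quad.i k K (Quad.i F k D.p₁)) (hb2 : b₂ ^ 2 = Quad.i k K (Quad.i F k D.p₂)) :
    (Odd (classNumber K) → classNumber k % 4 = 2 ∧ Q.idx = 2) ∧ (¬ Odd (classNumber K) → classNumber k % 4 = 0) := by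
  have n1 := Q.nonsq_up d hd _ _ hdx D.ns1 D.ns2
  have n2 := Q.nonsq_up d hd _ _ (by rw [hdx, mul_comm]) D.ns2 D.ns1
  have a1 := QK.S_sqrt b₁ _ hb1 n1
  have a2 := QK.S_sqrt b₂ _ hb2 n2
  have hu := unram_K D QK b₁ b₂ hb1 hb2 a1 a2
  have hb1' : (b₁ : K) ^ 2 = algebraMap k K ((Quad.i F k D.p₁ : kˣ) : k) := by
    have := congrArg Units.val hb1
    rw [Units.val_pow_eq_pow_val] at this; exact this
  have hinf := QK.inf_card (QK.inf_pos b₁ _ hb1' (D.hp1.map (L := k)).1 n1)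
  have hev := QK.unram_even hinf hu
  rw [Nat.not_odd_iff_even] at hev
  constructor
  · intro hoK
    obtain ⟨T, hT, hTc⟩ := Q.T_of_S {D.v₁, D.v₂} (by intro w; rw [hr]; simp)
    rw [Finset.card_pair D.hne] at hTc
    have hF := full_k D Q QK d hd hdx hr b₂ hb2 a2 hu hs hoK T hT
    obtain ⟨_, _, hg⟩ := Q.genus0 D.ho (Q.inf_card H) T hT
    have hi := hg.2 hF
    rw [hTc] at hi
    have hi2 : Q.idx = 2 := by omega
    refine ⟨?_, hi2⟩
    have := not_four_dvd (K := k) (Q.U6 D.ho T hT hF hi2) ⟨classNumber K, hoK, fun v => by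
      obtain ⟨w, rfl⟩ := un_surj (L := K) v
      obtain ⟨γ, g1, g2, g3⟩ := QK.norm_gen hu w
      by_cases h : sg QK.s w = w
      · exact ⟨γ, g2 h, g3⟩
      · refine ⟨γ ^ 2, ?_, fun v hv => ?_⟩
        · rw [ord_pow, g1 h]; rfl
        · rw [ord_pow, g3 v hv]; simp⟩
    obtain ⟨r, hr⟩ := hev
    omega
  · intro hnK
    obtain ⟨r, hr⟩ := hev
    by_contra h4
    refine hnK (QK.U1b hinf hu (g := r) ?_ (by omega))
    rw [← Nat.not_even_iff_odd]; rintro ⟨s, hs⟩; omega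
end

section
variable {F k K : Type*} [Field F] [NumberField F] [Field k] [NumberField k] [Field K] [NumberField K] [Algebra F k] [Algebra k K]

lemma ns_k1 (D : Two F) (Q : Quad F k) (b : kˣ) (hb : b ^ 2 = Quad.i F k D.p₁) (P : Pr k) (hP : un F P = D.v₂) :
    ¬ IsSquare ((Quad.i F k D.p₂ : kˣ) : k) := by
  have ha := Q.S_sqrt b _ hb D.ns1
  refine nonsq_of_ord P _ ?_
  have h0 : ord (un F P) D.p₁ = 0 := by rw [hP, D.h1' _ D.hne.symm]
  have : ee F P = 1 := Q.unram_of_prim b ha _ hb D.hp1 P (by rw [h0]; simp) fun _ => h0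
  rw [ord_map, this, hP, D.h2]
  simpa using (by exact_mod_cast D.ho : Odd ((classNumber F : ℕ) : ℤ))

lemma caseK1 (D : Two F) (Q : Quad F k) (QK : Quad k K)
    (b : kˣ) (hb : b ^ 2 = Quad.i F k D.p₁) (hs : SqMod D.v₂ (D.p₁ : F))
    (b₂ : Kˣ) (hb2 : b₂ ^ 2 = Quad.i k K (Quad.i F k D.p₂)) (P : Pr k) (hP : un F P = D.v₂) :
    ((∃ e ∈ AS (∅ : Set (Pr k)), ¬ SqMod P (e : k)) → Odd (classNumber K)) ∧
    ((∀ e ∈ AS (∅ : Set (Pr k)), SqMod P (e : k)) → ¬ Odd (classNumber K)) := by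
  have ha := Q.S_sqrt b _ hb D.ns1
  have n2 := ns_k1 D Q b hb P hP
  have a2 := QK.S_sqrt b₂ _ hb2 n2
  have hbv : (b : k) ^ 2 = algebraMap F k (D.p₁ : F) := by
    have := congrArg Units.val hb
    rw [Units.val_pow_eq_pow_val] at this; exact this
  have hb2' : (b₂ : K) ^ 2 = algebraMap k K ((Quad.i F k D.p₂ : kˣ) : k) := by
    have := congrArg Units.val hb2
    rw [Units.val_pow_eq_pow_val] at this; exact this
  have hun : ∀ w : Pr k, un F w ≠ D.v₁ → ee F w = 1 := by
    intro w hw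
    have h0 : ord (un F w) D.p₁ = 0 := D.h1' _ hw
    exact Q.unram_of_prim b ha _ hb D.hp1 w (by rw [h0]; simp) fun _ => h0
  -- class number of k odd
  have hok : Odd (classNumber k) := by
    obtain ⟨T, hT, hTc⟩ := Q.T_of_S {D.v₁} (by
      intro w
      rw [Finset.mem_singleton]
      constructor
      · intro h; by_contra h'; have := hun w h'; omega
      · intro h; exact Q.ram_of_odd b _ hb w (by rw [h, D.h1]; exact_mod_cast D.ho))
    exact Q.U3 D.ho (Q.inf_card (Q.inf_pos b _ hbv D.hp1.1 D.ns1)) T hT (by rw [hTc]; simp)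
  have oP : OddP P := by rw [oddP_map (M := F), hP]; exact D.o2
  have hsplit : sg Q.s P ≠ P := by
    refine Q.split_of_sq b ha _ hbv P oP ?_ (by rw [hP]; exact hs)
    have := ord_map (M := F) P D.p₁
    rw [← hb, ord_pow, hP, D.h1' _ D.hne.symm] at this
    simp at this; omega
  set S₀ : Finset (Pr k) := {P, sg Q.s P} with hS0
  have hSm : ∀ v, v ∈ S₀ ↔ un F v = D.v₂ := by
    intro v
    rw [hS0, Finset.mem_insert, Finset.mem_singleton]
    constructor
    · rintro (rfl | rfl)
      · exact hP
      · rw [Q.un_sg, hP]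
    · intro h; exact Q.same_un P v (hP.trans h.symm)
  have hSc : S₀.card = 2 := Finset.card_pair hsplit.symm
  have hS : ∀ w : Pr K, ee k w = 2 ↔ un k w ∈ S₀ := by
    intro w
    rw [hSm]
    constructor
    · intro h; by_contra h'
      have h0 : ord (un k w) (Quad.i F k D.p₂) = 0 := by rw [ord_map, D.h2' _ h', mul_zero]
      have := QK.unram_of_prim b₂ a2 _ hb2 D.hp2.map w (by rw [h0]; simp) fun _ => h0
      omega
    · intro h
      refine QK.ram_of_odd b₂ _ hb2 w ?_
      rw [ord_map, hun _ (by rw [h]; exact D.hne.symm), h, D.h2]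
      simpa using (by exact_mod_cast D.ho : Odd ((classNumber F : ℕ) : ℤ))
  constructor
  · rintro ⟨e, he, hes⟩
    obtain ⟨T, hT, hTc⟩ := QK.T_of_S S₀ hS
    obtain ⟨w, hw⟩ := un_surj (L := K) P
    refine QK.U4 hok (QK.inf_card (QK.inf_pos b₂ _ hb2' (D.hp2.map (L := k)).1 n2)) T hT (hTc.trans hSc) w ?_ e he (by rw [hw]; exact hes)
    rw [hT, hS, hSm, hw, hP]
  · intro hall hoK
    refine QK.lemX hok hoK S₀ hS hSc _ b₂ a2 hb2 ?_ ?_ ?_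
    · rw [mem_AS]
      intro v hv
      rw [Finset.mem_coe, hSm] at hv
      rw [ord_map, D.h2' _ hv, mul_zero]
    · intro v hv
      rw [oddP_map (M := F), (hSm v).1 hv]; exact D.o2
    · intro v hv e he
      rw [hS0, Finset.mem_insert, Finset.mem_singleton] at hv
      rcases hv with rfl | rfl
      · exact hall e he
      · rw [Q.sqmod_sg]
        refine hall (Q.S e) ?_
        rw [mem_AS_empty] at he ⊢
        intro v; rw [← Q.ord_sg]; exact he _
end
end Sch


set_option linter.all false

namespace Sch
open IsDedekindDomain nonZeroDivisors

section
variable {F k k₁ : Type*} [Field F] [NumberField F] [Field k] [NumberField k] [Field k₁] [NumberField k₁] [Algebra F k] [Algebra F k₁]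

lemma main_abs (D : Two F) (Q : Quad F k) (Q₁ : Quad F k₁) (H : ∀ φ : F →+* ℝ, ∃ ψ : k →+* ℝ, ψ.comp (algebraMap F k) = φ)
    (hr : ∀ w : Pr k, ee F w = 2 ↔ un F w = D.v₁ ∨ un F w = D.v₂) (s1 : SqMod D.v₂ (D.p₁ : F)) (s2 : SqMod D.v₁ (D.p₂ : F))
    (b : k₁ˣ) (hb : b ^ 2 = Quad.i F k₁ D.p₁) (P : Pr k₁) (hP : un F P = D.v₂) :
    ((∃ e ∈ AS (∅ : Set (Pr k₁)), ¬ SqMod P (e : k₁)) → classNumber k % 4 = 2 ∧ Q.idx = 2) ∧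
    ((∀ e ∈ AS (∅ : Set (Pr k₁)), SqMod P (e : k₁)) → classNumber k % 4 = 0) := by
  obtain ⟨d, hd, hdx⟩ := Q.step1 D.ho H D.v₁ D.v₂ D.hne hr D.o1 D.o2 D.p₁ D.p₂ D.hp1 D.hp2 D.h1 D.h1' D.h2 D.h2'
  have hns := ns_k1 D Q₁ b hb P hP
  obtain ⟨K, _, _, _, c, hc, hdeg⟩ := exists_sqrt_ext _ hns
  letI : Algebra F K := ((algebraMap k₁ K).comp (algebraMap F k₁)).toAlgebra
  haveI : IsScalarTower F k₁ K := IsScalarTower.of_algebraMap_eq fun _ => rfl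
  have hbv : (b : k₁) ^ 2 = algebraMap F k₁ (D.p₁ : F) := by
    have := congrArg Units.val hb
    rw [Units.val_pow_eq_pow_val] at this; exact this
  have hc' : c ^ 2 = algebraMap F K (D.p₂ : F) := hc
  have hb' : (algebraMap k₁ K b) ^ 2 = algebraMap F K (D.p₁ : F) := by rw [← map_pow, hbv]; rfl
  obtain ⟨f⟩ := Q.embed (K := K) d hd _ hdx (algebraMap k₁ K b * c) (by rw [mul_pow, hb', hc', ← map_mul]; rfl)
  letI : Algebra k K := f.toRingHom.toAlgebra
  haveI : IsScalarTower F k K := IsScalarTower.of_algebraMap_eq fun x => (f.commutes x).symm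
  obtain ⟨Q2⟩ := quad_exists k₁ K hdeg
  have hdeg2 : Module.finrank k K = 2 := by
    have e1 := Module.finrank_mul_finrank F k K
    have e2 := Module.finrank_mul_finrank F k₁ K
    rw [Q.deg] at e1
    rw [Q₁.deg, hdeg] at e2
    omega
  obtain ⟨QK⟩ := quad_exists k K hdeg2
  have hc0 : c ≠ 0 := by
    rintro rfl
    rw [zero_pow two_ne_zero] at hc
    exact (Quad.i F k₁ D.p₂).ne_zero ((map_eq_zero _).1 hc.symm)
  have tw : ∀ x : F, algebraMap k K (algebraMap F k x) = algebraMap F K x := fun x => (IsScalarTower.algebraMap_apply F k K x).symm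
  obtain ⟨A1, A2⟩ := caseK D Q QK H d hd hdx hr s2 (Quad.i k₁ K b) (Units.mk0 c hc0)
    (by ext; exact hb'.trans (tw _).symm) (by ext; exact hc'.trans (tw _).symm)
  obtain ⟨B1, B2⟩ := caseK1 D Q₁ Q2 b hb s1 (Units.mk0 c hc0) (by ext; exact hc) P hP
  exact ⟨fun h => A1 (B1 h), fun h => A2 (B2 h)⟩

lemma idx_eq (Q : Quad F k) : (Units.map (RingOfIntegers.norm F : 𝓞 k →* 𝓞 F)).range.index = Q.idx := by
  have h : (AS (∅ : Set (Pr k))).map (Quad.N F k) = ((Units.map (RingOfIntegers.norm F : 𝓞 k →* 𝓞 F)).range.map (Units.map (algebraMap (𝓞 F) F : 𝓞 F →* F))) := by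
    ext x
    simp only [Subgroup.mem_map, MonoidHom.mem_range]
    constructor
    · rintro ⟨y, hy, rfl⟩
      obtain ⟨e, he⟩ := exists_unit y (mem_AS_empty.1 hy)
      refine ⟨_, ⟨e, rfl⟩, ?_⟩
      ext
      show Algebra.norm F ((e : 𝓞 k) : k) = Algebra.norm F (y : k)
      rw [he]
    · rintro ⟨_, ⟨e, rfl⟩, rfl⟩
      refine ⟨(unitsEquiv e : kˣ), (unitsEquiv e).2, ?_⟩
      ext
      show Algebra.norm F (((unitsEquiv e : AS (∅ : Set (Pr k))) : kˣ) : k) = Algebra.norm F ((e : 𝓞 k) : k)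
      rw [unitsEquiv_val]
  have h2 : AS (∅ : Set (Pr F)) = (⊤ : Subgroup (𝓞 F)ˣ).map (Units.map (algebraMap (𝓞 F) F : 𝓞 F →* F)) := by
    ext x
    simp only [Subgroup.mem_map]
    constructor
    · intro hx
      obtain ⟨e, he⟩ := exists_unit x (mem_AS_empty.1 hx)
      exact ⟨e, trivial, by ext; exact he⟩
    · rintro ⟨e, -, rfl⟩
      rw [mem_AS_empty]
      exact fun v => ord_unit e _ rfl v
  unfold Quad.idx
  rw [h, h2, Subgroup.relIndex_map_map, ← Subgroup.relIndex_top_right]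
  have hinj : (Units.map (algebraMap (𝓞 F) F : 𝓞 F →* F)).ker = ⊥ := by
    rw [MonoidHom.ker_eq_bot_iff]
    exact Units.map_injective (RingOfIntegers.coe_injective)
  rw [hinj]; simp

lemma ram_iff (v : Pr F) : (∃ 𝔓 : Ideal (𝓞 k), 𝔓.IsPrime ∧ 𝔓 ^ 2 ∣ Ideal.map (algebraMap (𝓞 F) (𝓞 k)) v.asIdeal) ↔
    ∃ w : Pr k, un F w = v ∧ ee F w ≠ 1 := by
  have hv0 : Ideal.map (algebraMap (𝓞 F) (𝓞 k)) v.asIdeal ≠ ⊥ := by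
    rw [Ne, Ideal.map_eq_bot_iff_of_injective (FaithfulSMul.algebraMap_injective _ _)]; exact v.ne_bot
  constructor
  · rintro ⟨P, hP, hd⟩
    have hP0 : P ≠ ⊥ := by
      rintro rfl
      rw [Ideal.dvd_iff_le] at hd
      apply hv0
      rw [eq_bot_iff]; refine hd.trans ?_
      simp [sq]
    set w : Pr k := ⟨P, hP, hP0⟩
    have hle : Ideal.map (algebraMap (𝓞 F) (𝓞 k)) v.asIdeal ≤ P := (Ideal.dvd_iff_le.1 hd).trans (Ideal.pow_le_self two_ne_zero)
    have hun : un F w = v := (pr_eq_of_le v (un F w) (Ideal.map_le_iff_le_comap.1 hle)).symm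
    refine ⟨w, hun, ?_⟩
    unfold ee
    rw [hun]
    exact (Ideal.ramificationIdx'_ne_one_iff hle).2 (Ideal.dvd_iff_le.1 hd)
  · rintro ⟨w, rfl, hw⟩
    refine ⟨w.asIdeal, w.isPrime, ?_⟩
    unfold ee at hw
    rw [Ideal.dvd_iff_le]
    exact (Ideal.ramificationIdx'_ne_one_iff (Ideal.map_le_iff_le_comap.2 le_rfl)).1 hw

lemma gen_ord (v : Pr F) (π : 𝓞 F) (h : v.asIdeal ^ classNumber F = Ideal.span {π}) :
    ∃ p : Fˣ, (p : F) = (π : F) ∧ ord v p = classNumber F ∧ ∀ v', v' ≠ v → ord v' p = 0 := by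
  have h0 : π ≠ 0 := by
    rintro rfl
    rw [Ideal.span_singleton_eq_bot.2 rfl] at h
    exact v.ne_bot (pow_eq_zero_iff (classNumber_pos' (K := F)).ne' |>.1 h)
  refine ⟨uI π h0, uI_val π h0, ?_, ?_⟩
  · have key : ∀ n : ℕ, π ∈ v.asIdeal ^ n ↔ (n : ℤ) ≤ ord v (uI π h0) := by
      intro n
      rw [← v.intValuation_le_pow_iff_mem, ← v.valuation_of_algebraMap (K := F)]
      have := val_eq v (uI π h0)
      rw [uI_val] at this
      rw [show v.valuation F (algebraMap (𝓞 F) F π) = _ from this, WithZero.exp_le_exp]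
      omega
    apply le_antisymm
    · by_contra hlt
      push Not at hlt
      have h1 := (key (classNumber F + 1)).2 (by push_cast; omega)
      have h2 : v.asIdeal ^ classNumber F ≤ v.asIdeal ^ (classNumber F + 1) := by
        rw [h, Ideal.span_singleton_le_iff_mem]; exact h1
      have h3 := Ideal.pow_right_strictAnti v.asIdeal v.ne_bot v.isPrime.ne_top (Nat.lt_succ_self (classNumber F))
      exact absurd h2 (not_le_of_gt h3)
    · rw [← key, h]; exact Ideal.mem_span_singleton_self π
  · intro v' hv'
    by_contra hne
    have h1 := ord_int_nonneg v' (uI π h0) π (uI_val π h0).symm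
    have h2 := (ord_int_pos_iff v' (uI π h0) π (uI_val π h0).symm).1 (by omega)
    have h3 : v.asIdeal ^ classNumber F ≤ v'.asIdeal := by rw [h, Ideal.span_singleton_le_iff_mem]; exact h2
    exact hv' (pr_eq_of_le v v' (v'.isPrime.le_of_pow_le h3)).symm
end
end Sch


set_option linter.all false

namespace Sch
open IsDedekindDomain nonZeroDivisors

section
variable {F : Type*} [Field F] [NumberField F]

lemma norm_of_oddP (v : Pr F) (h : OddP v) : Odd (Ideal.absNorm v.asIdeal) := by
  haveI := fin_quot v
  haveI : v.asIdeal.IsPrime := v.isPrime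
  by_contra hn
  rw [Nat.not_odd_iff_even, even_iff_two_dvd, Ideal.absNorm_apply, Submodule.cardQuot_apply] at hn
  haveI : Fact (Nat.Prime 2) := ⟨Nat.prime_two⟩
  obtain ⟨x, hx⟩ := exists_prime_addOrderOf_dvd_card' (G := 𝓞 F ⧸ v.asIdeal) 2 hn
  have h1 : (2 : 𝓞 F ⧸ v.asIdeal) * x = 0 := by
    have := addOrderOf_nsmul_eq_zero x
    rw [hx, two_nsmul] at this; rw [two_mul]; exact this
  have hx0 : x ≠ 0 := by rintro rfl; simp at hx
  have h2 := (mul_eq_zero.1 h1).resolve_right hx0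
  have h3 : (2 : 𝓞 F) ∈ v.asIdeal := by
    rw [← Ideal.Quotient.eq_zero_iff_mem]; exact h2
  rw [oddP_iff] at h
  apply h
  have : ((2 : 𝓞 F) : F) = 2 := rfl
  rw [← this]
  exact (v.valuation_lt_one_iff_mem 2).2 h3

lemma unit_all (v : Pr F) (h : Odd (Ideal.absNorm v.asIdeal)) :
    (∀ e ∈ AS (∅ : Set (Pr F)), SqMod v (e : F)) ↔ ∀ ε : (𝓞 F)ˣ, (ε : 𝓞 F) ^ ((Ideal.absNorm v.asIdeal - 1) / 2) - 1 ∈ v.asIdeal := by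
  have hu : ∀ ε : (𝓞 F)ˣ, (ε : 𝓞 F) ∉ v.asIdeal := fun ε hε => v.isPrime.ne_top (Ideal.eq_top_of_isUnit_mem _ hε ε.isUnit)
  constructor
  · intro H ε
    rw [quadRes_iff v h _ (hu ε)]
    exact H (unitsEquiv ε : Fˣ) (unitsEquiv ε).2
  · intro H e he
    obtain ⟨ε, hε⟩ := exists_unit e (mem_AS_empty.1 he)
    rw [← hε]
    exact (quadRes_iff v h _ (hu ε)).1 (H ε)

lemma prim_of (p : Fˣ) (π : 𝓞 F) (h : (p : F) = (π : F)) (h1 : ∀ φ : F →+* ℝ, 0 < φ (algebraMap (𝓞 F) F π)) (h2 : ∃ ξ : 𝓞 F, (4 : 𝓞 F) ∣ π - ξ ^ 2) :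
    Prim p := by
  refine ⟨fun φ => by rw [h]; exact h1 φ, ?_⟩
  obtain ⟨ξ, m, hm⟩ := h2
  refine ⟨ξ, m, ?_⟩
  rw [h, show π = ξ ^ 2 + 4 * m by rw [← hm]; ring]
  have h4' : (((4 : 𝓞 F) : 𝓞 F) : F) = 4 := map_ofNat (algebraMap (𝓞 F) F) 4
  push_cast
  first | rw [h4'] | simp only [map_ofNat] | erw [h4']
end
end Sch

/-- In the two-ramified-primes situation with `𝔭₁, 𝔭₂` primary and
`(𝔭₁/𝔭₂) = (𝔭₂/𝔭₁) = +1`: if `(E₁/𝔭₂) = (E₂/𝔭₁) = -1` then `h(k) ≡ 2 mod 4` and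
`(E_F : N_{k/F} E_k) = 2`; if `(E₁/𝔭₂) = (E₂/𝔭₁) = +1` then `4 ∣ h(k)`. -/
theorem scholz_case_split
    (F : Type*) [Field F] [NumberField F]
    (hoddF : Odd (NumberField.classNumber F))
    (k : Type*) [Field k] [NumberField k] [Algebra F k]
    (hdeg : Module.finrank F k = 2)
    (𝔭₁ 𝔭₂ : Ideal (𝓞 F)) (hp1 : 𝔭₁.IsPrime) (hp2 : 𝔭₂.IsPrime) (hne : 𝔭₁ ≠ 𝔭₂)
    (hN1 : Odd (Ideal.absNorm 𝔭₁)) (hN2 : Odd (Ideal.absNorm 𝔭₂))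
    (hram : ∀ 𝔭 : Ideal (𝓞 F), 𝔭.IsPrime → 𝔭 ≠ ⊥ →
      (IsRamifiedIn F k 𝔭 ↔ 𝔭 = 𝔭₁ ∨ 𝔭 = 𝔭₂))
    (hinf : UnramifiedAtInfinitePlaces F k)
    (hprim1 : IsPrimaryIdeal F 𝔭₁) (hprim2 : IsPrimaryIdeal F 𝔭₂)
    (π₁ π₂ : 𝓞 F) (hπ₁ : IsPrimaryElem F π₁) (hπ₂ : IsPrimaryElem F π₂)
    (hgen1 : 𝔭₁ ^ NumberField.classNumber F = Ideal.span {π₁})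
    (hgen2 : 𝔭₂ ^ NumberField.classNumber F = Ideal.span {π₂})
    (hsym1 : quadResSym F 𝔭₂ π₁ = 1)   -- `(𝔭₁/𝔭₂) = +1`
    (hsym2 : quadResSym F 𝔭₁ π₂ = 1)   -- `(𝔭₂/𝔭₁) = +1`
    (k₁ : Type*) [Field k₁] [NumberField k₁] [Algebra F k₁]
    (hdeg1 : Module.finrank F k₁ = 2)
    (β₁ : k₁) (hβ₁ : β₁ ^ 2 = algebraMap F k₁ (algebraMap (𝓞 F) F π₁))  -- `k₁ = F(√π₁)`
    (k₂ : Type*) [Field k₂] [NumberField k₂] [Algebra F k₂]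
    (hdeg2 : Module.finrank F k₂ = 2)
    (β₂ : k₂) (hβ₂ : β₂ ^ 2 = algebraMap F k₂ (algebraMap (𝓞 F) F π₂))  -- `k₂ = F(√π₂)`
    (𝔓₂ : Ideal (𝓞 k₁)) (hP2 : 𝔓₂.IsPrime) (hP2ne : 𝔓₂ ≠ ⊥)
    (hP2above : Ideal.map (algebraMap (𝓞 F) (𝓞 k₁)) 𝔭₂ ≤ 𝔓₂)  -- `𝔓₂` lies above `𝔭₂`
    (𝔓₁ : Ideal (𝓞 k₂)) (hP1 : 𝔓₁.IsPrime) (hP1ne : 𝔓₁ ≠ ⊥)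
    (hP1above : Ideal.map (algebraMap (𝓞 F) (𝓞 k₂)) 𝔭₁ ≤ 𝔓₁)  -- `𝔓₁` lies above `𝔭₁`
    : ((¬ (∀ ε : (𝓞 k₁)ˣ, quadResSym k₁ 𝔓₂ (ε : 𝓞 k₁) = 1) ∧
        ¬ (∀ ε : (𝓞 k₂)ˣ, quadResSym k₂ 𝔓₁ (ε : 𝓞 k₂) = 1) →
          NumberField.classNumber k % 4 = 2 ∧ (relUnitNormRange F k).index = 2) ∧
       ((∀ ε : (𝓞 k₁)ˣ, quadResSym k₁ 𝔓₂ (ε : 𝓞 k₁) = 1) ∧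
        (∀ ε : (𝓞 k₂)ˣ, quadResSym k₂ 𝔓₁ (ε : 𝓞 k₂) = 1) →
          NumberField.classNumber k % 4 = 0)) := by
  have hb1 : 𝔭₁ ≠ ⊥ := by rintro rfl; simp at hN1
  have hb2 : 𝔭₂ ≠ ⊥ := by rintro rfl; simp at hN2
  obtain ⟨Q⟩ := Sch.quad_exists F k hdeg
  obtain ⟨Q₁⟩ := Sch.quad_exists F k₁ hdeg1
  set v₁ : Sch.Pr F := ⟨𝔭₁, hp1, hb1⟩ with hv1
  set v₂ : Sch.Pr F := ⟨𝔭₂, hp2, hb2⟩ with hv2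
  obtain ⟨p₁, e1, h1, h1'⟩ := Sch.gen_ord v₁ π₁ hgen1
  obtain ⟨p₂, e2, h2, h2'⟩ := Sch.gen_ord v₂ π₂ hgen2
  have hne' : v₁ ≠ v₂ := fun h => hne (congrArg IsDedekindDomain.HeightOneSpectrum.asIdeal h)
  have q1 : ∀ (α : 𝓞 F) (𝔭 : Ideal (𝓞 F)), quadResSym F 𝔭 α = 1 → α ^ ((Ideal.absNorm 𝔭 - 1) / 2) - 1 ∈ 𝔭 := by
    intro α 𝔭 h
    unfold quadResSym at h
    by_contra hn
    rw [if_neg hn] at h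
    norm_num at h
  let D : Sch.Two F :=
    { ho := hoddF, v₁ := v₁, v₂ := v₂, hne := hne', o1 := Sch.oddP_of_norm v₁ hN1, o2 := Sch.oddP_of_norm v₂ hN2
      p₁ := p₁, p₂ := p₂, hp1 := Sch.prim_of p₁ π₁ e1 hπ₁.1 hπ₁.2, hp2 := Sch.prim_of p₂ π₂ e2 hπ₂.1 hπ₂.2
      h1 := h1, h1' := h1', h2 := h2, h2' := h2' }
  have hnm : ∀ (v : Sch.Pr F) (p : Fˣ) (π : 𝓞 F), (p : F) = π → Sch.ord v p = 0 → π ∉ v.asIdeal := by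
    intro v p π h h0 hm
    have := (Sch.ord_int_pos_iff v p π h.symm).2 hm
    omega
  have s1 : Sch.SqMod v₂ (p₁ : F) := by
    rw [e1]
    exact (Sch.quadRes_iff v₂ hN2 π₁ (hnm v₂ p₁ π₁ e1 (h1' v₂ hne'.symm))).1 (q1 _ _ hsym1)
  have s2 : Sch.SqMod v₁ (p₂ : F) := by
    rw [e2]
    exact (Sch.quadRes_iff v₁ hN1 π₂ (hnm v₁ p₂ π₂ e2 (h2' v₁ hne'))).1 (q1 _ _ hsym2)
  have hr : ∀ w : Sch.Pr k, Sch.ee F w = 2 ↔ Sch.un F w = v₁ ∨ Sch.un F w = v₂ := by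
    intro w
    have h3 := hram (Sch.un F w).asIdeal (Sch.un F w).isPrime (Sch.un F w).ne_bot
    have h4 : IsRamifiedIn F k (Sch.un F w).asIdeal ↔ Sch.ee F w = 2 := by
      unfold IsRamifiedIn
      rw [Sch.ram_iff]
      constructor
      · rintro ⟨w', hw', he⟩
        rw [Q.ee_same w' w hw'] at he
        exact (Q.ee_le w).resolve_left he
      · intro h; exact ⟨w, rfl, by omega⟩
    rw [← h4, h3, IsDedekindDomain.HeightOneSpectrum.ext_iff, IsDedekindDomain.HeightOneSpectrum.ext_iff]
  have hβ0 : β₁ ≠ 0 := by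
    rintro rfl
    rw [zero_pow two_ne_zero] at hβ₁
    have h5 := (map_eq_zero _).1 hβ₁.symm
    exact p₁.ne_zero (e1.trans h5)
  set P : Sch.Pr k₁ := ⟨𝔓₂, hP2, hP2ne⟩ with hPdef
  have hP : Sch.un F P = v₂ := (Sch.pr_eq_of_le v₂ (Sch.un F P) (Ideal.map_le_iff_le_comap.1 hP2above)).symm
  have oP : Sch.OddP P := by
    rw [Sch.oddP_map (M := F), hP]; exact D.o2
  have hall : (∀ ε : (𝓞 k₁)ˣ, quadResSym k₁ 𝔓₂ (ε : 𝓞 k₁) = 1) ↔ ∀ e ∈ Sch.AS (∅ : Set (Sch.Pr k₁)), Sch.SqMod P (e : k₁) := by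
    rw [Sch.unit_all P (Sch.norm_of_oddP P oP)]
    refine forall_congr' fun ε => ?_
    unfold quadResSym
    constructor
    · intro h
      by_contra hn
      rw [if_neg hn] at h
      norm_num at h
    · intro h
      exact if_pos h
  obtain ⟨A, B⟩ := Sch.main_abs D Q Q₁ hinf hr s1 s2 (Units.mk0 β₁ hβ0)
    (by ext; exact hβ₁.trans (congrArg (algebraMap F k₁) e1.symm)) P hP
  constructor
  · rintro ⟨hn, -⟩
    rw [hall] at hn
    push Not at hn
    obtain ⟨hA, hi⟩ := A hn
    exact ⟨hA, (Sch.idx_eq Q).trans hi⟩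
  · rintro ⟨hn, -⟩
    exact B (hall.1 hn)
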